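/- arXiv:2010.09428 — 4 statements merged into one kernel-verified Lean document; each statement's English description precedes it below -/
import Mathlib

section
/- Let B, C, D be unital complex Banach algebras and let φ : B → D, ψ : C → D be continuous unital algebra homomorphisms such that every element d ∈ D can be written d = φ(b) + ψ(c) with b ∈ B, c ∈ C, and such that at least one of φ, ψ has dense range in D. Then the map π : Bˣ × Cˣ → Dˣ, π(S,T) = φ(S)⁻¹ · ψ(T), is a Serre fibration. -/
/-- A continuous map `f : E → B` is a Serre fibration if it has the homotopy lifting
property with respect to maps from finite-dimensional cubes `[0,1]ᵏ`. -/
def IsSerreFibration {E B : Type*} [TopologicalSpace E] [TopologicalSpace B]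
    (f : E → B) : Prop :=
  Continuous f ∧
    ∀ (k : ℕ) (H : ((Fin k → unitInterval) × unitInterval) → B)
      (h : (Fin k → unitInterval) → E),
      Continuous H → Continuous h → (∀ x, f (h x) = H (x, 0)) →
        ∃ H' : ((Fin k → unitInterval) × unitInterval) → E,
          Continuous H' ∧ (∀ p, f (H' p) = H p) ∧ ∀ x, H' (x, 0) = h x

open Topology Filter

theorem surjective_of_approx {E F : Type*} [NormedAddCommGroup E] [NormedSpace ℝ E] [CompleteSpace E]
    [NormedAddCommGroup F] [NormedSpace ℝ F] (T : E →L[ℝ] F) (K : ℝ)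
    (h : ∀ y, ∃ x, ‖x‖ ≤ K * ‖y‖ ∧ ‖y - T x‖ ≤ (1/2) * ‖y‖) : Function.Surjective T := by
  choose g hg1 hg2 using h
  intro y
  let r : ℕ → F := fun n => (fun z => z - T (g z))^[n] y
  have hr : ∀ n, r (n+1) = r n - T (g (r n)) := fun n => by
    simp only [r, Function.iterate_succ_apply']
  have hrn : ∀ n, ‖r n‖ ≤ (1/2)^n * ‖y‖ := by
    intro n
    induction n with
    | zero => simp [r]
    | succ n ih =>
      rw [hr, pow_succ]
      have := hg2 (r n)
      nlinarith
  have hsum : Summable (fun n => g (r n)) := by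
    refine Summable.of_norm_bounded (g := fun n => (|K| * ‖y‖) * (1/2 : ℝ)^n)
      ((summable_geometric_of_lt_one (by norm_num) (by norm_num)).mul_left _) ?_
    intro n
    calc ‖g (r n)‖ ≤ K * ‖r n‖ := hg1 _
      _ ≤ |K| * ‖r n‖ := by gcongr; exact le_abs_self K
      _ ≤ |K| * ((1/2)^n * ‖y‖) := by gcongr; exact hrn n
      _ = _ := by ring
  have hpart : ∀ n, ∑ i ∈ Finset.range n, T (g (r i)) = y - r n := by
    intro n
    induction n with
    | zero => simp [r]
    | succ n ih => rw [Finset.sum_range_succ, ih, hr]; abel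
  refine ⟨∑' n, g (r n), ?_⟩
  have h1 := (hsum.hasSum.mapL T).tendsto_sum_nat
  simp only [hpart] at h1
  have h0 : Tendsto r atTop (𝓝 0) := by
    refine squeeze_zero_norm hrn ?_
    simpa using (tendsto_pow_atTop_nhds_zero_of_lt_one (r := (1/2:ℝ)) (by norm_num) (by norm_num)).mul_const ‖y‖
  have h2 := h0.const_sub y
  simpa using tendsto_nhds_unique h1 h2

theorem surjective_comp {Y E F : Type*} [TopologicalSpace Y] [CompactSpace Y] [T2Space Y]
    [NormedAddCommGroup E] [NormedSpace ℝ E] [CompleteSpace E]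
    [NormedAddCommGroup F] [NormedSpace ℝ F] [CompleteSpace F] (T : E →L[ℝ] F)
    (hT : Function.Surjective T) (f : C(Y, F)) : ∃ g : C(Y, E), ∀ y, T (g y) = f y := by
  obtain ⟨K, hK0, hK⟩ := T.exists_preimage_norm_le hT
  have key : Function.Surjective (T.compLeftContinuous ℝ Y) := by
    apply surjective_of_approx _ K
    intro f
    rcases eq_or_ne f 0 with rfl | hf
    · exact ⟨0, by simp, by simp⟩
    have hf0 : 0 < ‖f‖ := norm_pos_iff.2 hf
    obtain ⟨g, hg⟩ := exists_continuous_forall_mem_convex_of_local_const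
      (t := fun y => {e : E | ‖e‖ ≤ K * ‖f‖} ∩ {e | ‖f y - T e‖ ≤ 1/2 * ‖f‖}) (by
        intro y
        refine Convex.inter ?_ ?_
        · simpa [Metric.closedBall, dist_eq_norm] using convex_closedBall (0:E) (K * ‖f‖)
        · have := (convex_closedBall (f y) (1/2*‖f‖)).linear_preimage (T : E →ₗ[ℝ] F)
          convert this using 1
          ext e
          simp [dist_eq_norm, norm_sub_rev]) (by
        intro y
        obtain ⟨e, he, hn⟩ := hK (f y)
        refine ⟨e, ?_⟩
        have : ∀ᶠ z in 𝓝 y, ‖f z - f y‖ < 1/2 * ‖f‖ := by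
          have hc : Continuous fun z => ‖f z - f y‖ := by fun_prop
          exact hc.continuousAt.eventually_lt continuousAt_const (by simpa using hf0)
        filter_upwards [this] with z hz
        refine ⟨hn.trans ?_, ?_⟩
        · gcongr; exact f.norm_coe_le_norm y
        · simpa [he] using hz.le)
    refine ⟨g, ?_, ?_⟩
    · rw [ContinuousMap.norm_le _ (by positivity)]
      exact fun y => (hg y).1
    · rw [ContinuousMap.norm_le _ (by positivity)]
      exact fun y => (hg y).2
  obtain ⟨g, hg⟩ := key f
  exact ⟨g, fun y => DFunLike.congr_fun hg y⟩

theorem dense_comp {Y E F : Type*} [TopologicalSpace Y] [CompactSpace Y] [T2Space Y]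
    [NormedAddCommGroup E] [NormedSpace ℝ E]
    [NormedAddCommGroup F] [NormedSpace ℝ F] (T : E →L[ℝ] F)
    (hT : DenseRange T) : DenseRange (fun g : C(Y, E) => (T : C(E,F)).comp g) := by
  rw [Metric.denseRange_iff]
  intro f r hr
  obtain ⟨g, hg⟩ := exists_continuous_forall_mem_convex_of_local_const
      (t := fun y => {e : E | ‖T e - f y‖ < r}) (by
        intro y
        have := (convex_ball (f y) r).linear_preimage (T : E →ₗ[ℝ] F)
        convert this using 1
        ext e
        simp [dist_eq_norm]) (by
        intro y
        obtain ⟨e, he⟩ := (Metric.denseRange_iff.1 hT) (f y) r hr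
        refine ⟨e, ?_⟩
        have hc : Continuous fun z => ‖T e - f z‖ := by fun_prop
        exact hc.continuousAt.eventually_lt continuousAt_const
          (by simpa [dist_eq_norm, norm_sub_rev] using he))
  refine ⟨g, ?_⟩
  rw [ContinuousMap.dist_lt_iff hr]
  intro y
  have := hg y
  rw [dist_comm, dist_eq_norm]
  exact this

theorem conj_approx {B D : Type*} [NormedRing D] (φ : B → D) (hφ : DenseRange φ)
    (a a' : D) (ε : ℝ) (hε : 0 < ε) :
    ∃ b b' : B, ∀ x : D, ‖a * x * a' - φ b * x * φ b'‖ ≤ ε * ‖x‖ := by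
  have hd : DenseRange (Prod.map φ φ) := hφ.prodMap hφ
  let f : D × D → ℝ := fun p => ‖a - p.1‖ * ‖a'‖ + ‖p.1‖ * ‖a' - p.2‖
  have hf : Continuous f := by fun_prop
  have hopen : IsOpen {p | f p < ε} := isOpen_lt hf continuous_const
  obtain ⟨⟨b, b'⟩, hb⟩ := hd.exists_mem_open hopen ⟨(a, a'), by simpa [f] using hε⟩
  refine ⟨b, b', fun x => ?_⟩
  have hb : ‖a - φ b‖ * ‖a'‖ + ‖φ b‖ * ‖a' - φ b'‖ < ε := hb
  have e : a * x * a' - φ b * x * φ b' = (a - φ b) * x * a' + φ b * x * (a' - φ b') := by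
    noncomm_ring
  rw [e]
  calc _ ≤ ‖a - φ b‖ * ‖x‖ * ‖a'‖ + ‖φ b‖ * ‖x‖ * ‖a' - φ b'‖ := by
        refine (norm_add_le _ _).trans (add_le_add ?_ ?_)
        · exact (norm_mul_le _ _).trans (by gcongr; exact norm_mul_le _ _)
        · exact (norm_mul_le _ _).trans (by gcongr; exact norm_mul_le _ _)
    _ = (‖a - φ b‖ * ‖a'‖ + ‖φ b‖ * ‖a' - φ b'‖) * ‖x‖ := by ring
    _ ≤ ε * ‖x‖ := by gcongr

section
variable {B C D : Type*} [NormedRing B] [NormedAlgebra ℝ B] [CompleteSpace B]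
    [NormedRing C] [NormedAlgebra ℝ C] [CompleteSpace C]
    [NormedRing D] [NormedAlgebra ℝ D] [CompleteSpace D]

theorem deriv_surj
    (φ : B →ₐ[ℝ] D) (hφ : Continuous φ)
    (ψ : C →ₐ[ℝ] D) (hψ : Continuous ψ)
    (hsum : ∀ d : D, ∃ b : B, ∃ c : C, d = φ b + ψ c)
    (hdense : DenseRange φ ∨ DenseRange ψ) (d : Dˣ) (y : D) :
    ∃ b c, φ b * d + d * ψ c = y := by
  let φL : B →L[ℝ] D := ⟨φ.toLinearMap, hφ⟩
  let ψL : C →L[ℝ] D := ⟨ψ.toLinearMap, hψ⟩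
  let T0 : B × C →L[ℝ] D := φL.comp (.fst ℝ B C) + ψL.comp (.snd ℝ B C)
  have hT0 : Function.Surjective T0 := fun y => by
    obtain ⟨b, c, h⟩ := hsum y
    exact ⟨(b, c), h.symm⟩
  obtain ⟨K, hK0, hK⟩ := T0.exists_preimage_norm_le hT0
  let T : B × C →L[ℝ] D :=
    ((ContinuousLinearMap.mul ℝ D).flip (d : D)).comp (φL.comp (.fst ℝ B C)) +
      (ContinuousLinearMap.mul ℝ D (d : D)).comp (ψL.comp (.snd ℝ B C))
  have hTa : ∀ b c, T (b, c) = φ b * d + d * ψ c := fun b c => rfl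
  suffices hT : Function.Surjective T by
    obtain ⟨⟨b, c⟩, h⟩ := hT y
    exact ⟨b, c, h⟩
  let i : D := (d⁻¹ : Dˣ)
  have hid : i * d = 1 := d.inv_mul
  have hdi : d * i = 1 := d.mul_inv
  rcases hdense with hd | hd
  · let N := ‖φL‖ * (K * ‖i‖) * ‖(d : D)‖
    have hN : 0 ≤ N := by positivity
    obtain ⟨b1, b0, hb⟩ := conj_approx φ hd (d : D) i (1 / (2 * (N + 1))) (by positivity)
    apply surjective_of_approx T (max (‖b1‖ * (K * ‖i‖) * ‖b0‖) (K * ‖i‖))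
    intro y
    obtain ⟨⟨b, c⟩, hbc, hn⟩ := hK (i * y)
    have hbc : φ b + ψ c = i * y := hbc
    have hn' : ‖(b, c)‖ ≤ (K * ‖i‖) * ‖y‖ := hn.trans (by
      rw [mul_assoc]; gcongr; exact norm_mul_le _ _)
    have hnb : ‖b‖ ≤ (K * ‖i‖) * ‖y‖ := (norm_fst_le (b, c)).trans hn'
    have hnc : ‖c‖ ≤ (K * ‖i‖) * ‖y‖ := (norm_snd_le (b, c)).trans hn'
    refine ⟨(b1 * b * b0, c), ?_, ?_⟩
    · refine max_le ?_ ?_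
      · calc ‖b1 * b * b0‖ ≤ ‖b1‖ * ‖b‖ * ‖b0‖ :=
            (norm_mul_le _ _).trans (by gcongr; exact norm_mul_le _ _)
          _ ≤ ‖b1‖ * ((K * ‖i‖) * ‖y‖) * ‖b0‖ := by gcongr
          _ = ‖b1‖ * (K * ‖i‖) * ‖b0‖ * ‖y‖ := by ring
          _ ≤ _ := by gcongr; exact le_max_left _ _
      · exact hnc.trans (by gcongr; exact le_max_right _ _)
    · have e : y - T (b1 * b * b0, c) = (d * φ b * i - φ b1 * φ b * φ b0) * d := by
        have : y = d * (φ b + ψ c) := by rw [hbc, ← mul_assoc, hdi, one_mul]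
        rw [hTa, map_mul, map_mul, sub_mul, mul_assoc (d * φ b) i d, hid, this]
        noncomm_ring
      rw [e]
      calc _ ≤ (1 / (2 * (N + 1)) * ‖φ b‖) * ‖(d : D)‖ :=
            (norm_mul_le _ _).trans (by gcongr; exact hb _)
        _ ≤ (1 / (2 * (N + 1)) * (‖φL‖ * ((K * ‖i‖) * ‖y‖))) * ‖(d : D)‖ := by
            gcongr
            exact (φL.le_opNorm b).trans (by gcongr)
        _ = (N / (N + 1)) * (1 / 2 * ‖y‖) := by simp only [N]; field_simp
        _ ≤ 1 * (1 / 2 * ‖y‖) := by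
            gcongr
            rw [div_le_one (by positivity)]; linarith
        _ = _ := one_mul _
  · let N := ‖ψL‖ * (K * ‖i‖) * ‖(d : D)‖
    have hN : 0 ≤ N := by positivity
    obtain ⟨c1, c0, hc⟩ := conj_approx ψ hd i (d : D) (1 / (2 * (N + 1))) (by positivity)
    apply surjective_of_approx T (max (K * ‖i‖) (‖c1‖ * (K * ‖i‖) * ‖c0‖))
    intro y
    obtain ⟨⟨b, c⟩, hbc, hn⟩ := hK (y * i)
    have hbc : φ b + ψ c = y * i := hbc
    have hn' : ‖(b, c)‖ ≤ (K * ‖i‖) * ‖y‖ := hn.trans (by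
      rw [mul_assoc, mul_comm ‖i‖]; gcongr; exact norm_mul_le _ _)
    have hnb : ‖b‖ ≤ (K * ‖i‖) * ‖y‖ := (norm_fst_le (b, c)).trans hn'
    have hnc : ‖c‖ ≤ (K * ‖i‖) * ‖y‖ := (norm_snd_le (b, c)).trans hn'
    refine ⟨(b, c1 * c * c0), ?_, ?_⟩
    · refine max_le ?_ ?_
      · exact hnb.trans (by gcongr; exact le_max_left _ _)
      · calc ‖c1 * c * c0‖ ≤ ‖c1‖ * ‖c‖ * ‖c0‖ :=
            (norm_mul_le _ _).trans (by gcongr; exact norm_mul_le _ _)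
          _ ≤ ‖c1‖ * ((K * ‖i‖) * ‖y‖) * ‖c0‖ := by gcongr
          _ = ‖c1‖ * (K * ‖i‖) * ‖c0‖ * ‖y‖ := by ring
          _ ≤ _ := by gcongr; exact le_max_right _ _
    · have e : y - T (b, c1 * c * c0) = d * (i * ψ c * d - ψ c1 * ψ c * ψ c0) := by
        have : y = (φ b + ψ c) * d := by rw [hbc, mul_assoc, hid, mul_one]
        rw [hTa, map_mul, map_mul, mul_sub, ← mul_assoc (d : D) (i * ψ c) d,
          ← mul_assoc (d : D) i, hdi, this]
        noncomm_ring
      rw [e]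
      calc _ ≤ ‖(d : D)‖ * (1 / (2 * (N + 1)) * ‖ψ c‖) :=
            (norm_mul_le _ _).trans (by gcongr; exact hc _)
        _ ≤ ‖(d : D)‖ * (1 / (2 * (N + 1)) * (‖ψL‖ * ((K * ‖i‖) * ‖y‖))) := by
            gcongr
            exact (ψL.le_opNorm c).trans (by gcongr)
        _ = (N / (N + 1)) * (1 / 2 * ‖y‖) := by simp only [N]; field_simp
        _ ≤ 1 * (1 / 2 * ‖y‖) := by
            gcongr
            rw [div_le_one (by positivity)]; linarith
        _ = _ := one_mul _

theorem orbit_open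
    (φ : B →ₐ[ℝ] D) (hφ : Continuous φ)
    (ψ : C →ₐ[ℝ] D) (hψ : Continuous ψ)
    (hsum : ∀ d : D, ∃ b : B, ∃ c : C, d = φ b + ψ c)
    (hdense : DenseRange φ ∨ DenseRange ψ) (d : Dˣ) :
    ∀ᶠ y in 𝓝 (d : D), ∃ (u : Bˣ) (v : Cˣ), y = φ u * d * ψ v := by
  let φL : B →L[ℝ] D := ⟨φ.toLinearMap, hφ⟩
  let ψL : C →L[ℝ] D := ⟨ψ.toLinearMap, hψ⟩
  let F : B × C → D := fun p => φL p.1 * d * ψL p.2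
  have h1 : HasStrictFDerivAt (fun p : B × C => φL p.1) (φL.comp (.fst ℝ B C)) (1, 1) :=
    (φL.comp (.fst ℝ B C)).hasStrictFDerivAt
  have h2 : HasStrictFDerivAt (fun p : B × C => ψL p.2) (ψL.comp (.snd ℝ B C)) (1, 1) :=
    (ψL.comp (.snd ℝ B C)).hasStrictFDerivAt
  have hF := (h1.mul_const' (d : D)).mul' h2
  have e1 : φL 1 = 1 := map_one φ
  have e2 : ψL 1 = 1 := map_one ψ
  have hm := hF.map_nhds_eq_of_surj (by
    rw [LinearMap.range_eq_top]
    intro y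
    obtain ⟨b, c, h⟩ := deriv_surj φ hφ ψ hψ hsum hdense d y
    refine ⟨(b, c), ?_⟩
    rw [← h]
    have e3 : φL b = φ b := rfl
    have e4 : ψL c = ψ c := rfl
    simp [e1, e2, e3, e4, add_comm])
  have hp : φL 1 * (d : D) * ψL 1 = d := by rw [e1, e2, one_mul, mul_one]
  simp only [Pi.mul_apply] at hm
  have hu : ∀ᶠ p : B × C in 𝓝 (1, 1), IsUnit p.1 ∧ IsUnit p.2 := by
    rw [nhds_prod_eq]
    exact (Units.isOpen.eventually_mem (isUnit_one : IsUnit (1 : B))).prod_mk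
      (Units.isOpen.eventually_mem (isUnit_one : IsUnit (1 : C)))
  rw [← hp, ← hm, eventually_map]
  filter_upwards [hu] with p hp
  obtain ⟨⟨u, hu⟩, ⟨v, hv⟩⟩ := hp
  exact ⟨u, v, by rw [hu, hv, e1, e2, one_mul, mul_one]; rfl⟩

theorem path_orbit
    (φ : B →ₐ[ℝ] D) (hφ : Continuous φ)
    (ψ : C →ₐ[ℝ] D) (hψ : Continuous ψ)
    (hsum : ∀ d : D, ∃ b : B, ∃ c : C, d = φ b + ψ c)
    (hdense : DenseRange φ ∨ DenseRange ψ)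
    (γ : unitInterval → D) (hγ : Continuous γ) (hu : ∀ t, IsUnit (γ t)) :
    ∃ (u : Bˣ) (v : Cˣ), γ 1 = φ u * γ 0 * ψ v := by
  have hloc : ∀ t, ∀ᶠ s in 𝓝 t, ∃ (u : Bˣ) (v : Cˣ), γ s = φ u * γ t * ψ v := by
    intro t
    obtain ⟨d, hd⟩ := hu t
    have := orbit_open φ hφ ψ hψ hsum hdense d
    rw [hd] at this
    exact hγ.continuousAt.eventually this
  let S : Set unitInterval := {t | ∃ (u : Bˣ) (v : Cˣ), γ t = φ u * γ 0 * ψ v}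
  have hφu : ∀ u : Bˣ, φ (↑u⁻¹) * φ u = 1 := fun u => by rw [← map_mul, u.inv_mul, map_one]
  have hψu : ∀ u : Cˣ, ψ u * ψ (↑u⁻¹) = 1 := fun u => by rw [← map_mul, u.mul_inv, map_one]
  have hS : IsClopen S := by
    constructor
    · rw [← isOpen_compl_iff, isOpen_iff_mem_nhds]
      intro t ht
      filter_upwards [hloc t] with s hs hs'
      obtain ⟨u, v, h⟩ := hs
      obtain ⟨u', v', h'⟩ := hs'
      refine ht ⟨u⁻¹ * u', v' * v⁻¹, ?_⟩
      rw [Units.val_mul, Units.val_mul, map_mul, map_mul]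
      calc γ t = (φ ↑u⁻¹ * φ u) * γ t * (ψ v * ψ ↑v⁻¹) := by rw [hφu, hψu, one_mul, mul_one]
        _ = φ ↑u⁻¹ * γ s * ψ ↑v⁻¹ := by rw [h]; noncomm_ring
        _ = _ := by rw [h']; noncomm_ring
    · rw [isOpen_iff_mem_nhds]
      intro t ht
      filter_upwards [hloc t] with s hs
      obtain ⟨u, v, h⟩ := hs
      obtain ⟨u', v', h'⟩ := ht
      refine ⟨u * u', v' * v, ?_⟩
      rw [Units.val_mul, Units.val_mul, map_mul, map_mul, h, h']
      noncomm_ring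
  have : S = Set.univ := hS.eq_univ ⟨0, 1, 1, by simp⟩
  have h1 : (1 : unitInterval) ∈ S := by rw [this]; exact Set.mem_univ _
  exact h1

theorem lift_exists {Y : Type*} [TopologicalSpace Y] [CompactSpace Y] [T2Space Y]
    (φ : B →ₐ[ℝ] D) (hφ : Continuous φ)
    (ψ : C →ₐ[ℝ] D) (hψ : Continuous ψ)
    (hsum : ∀ d : D, ∃ b : B, ∃ c : C, d = φ b + ψ c)
    (hdense : DenseRange φ ∨ DenseRange ψ)
    (H : Y × unitInterval → Dˣ) (hH : Continuous H) :
    ∃ (u : C(Y × unitInterval, Bˣ)) (v : C(Y × unitInterval, Cˣ)), ∀ p,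
      (H p : D) = φ (u p) * H (p.1, 0) * ψ (v p) := by
  let φL : B →L[ℝ] D := ⟨φ.toLinearMap, hφ⟩
  let ψL : C →L[ℝ] D := ⟨ψ.toLinearMap, hψ⟩
  let T0 : B × C →L[ℝ] D := φL.comp (.fst ℝ B C) + ψL.comp (.snd ℝ B C)
  have hT0 : Function.Surjective T0 := fun y => by
    obtain ⟨b, c, h⟩ := hsum y
    exact ⟨(b, c), h.symm⟩
  let Φ : C(Y × unitInterval, B) →ₐ[ℝ] C(Y × unitInterval, D) := φ.compLeftContinuous ℝ hφ
  let Ψ : C(Y × unitInterval, C) →ₐ[ℝ] C(Y × unitInterval, D) := ψ.compLeftContinuous ℝ hψ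
  have hΦ : Continuous Φ := ContinuousMap.continuous_postcomp (⟨φ, hφ⟩ : C(B, D))
  have hΨ : Continuous Ψ := ContinuousMap.continuous_postcomp (⟨ψ, hψ⟩ : C(C, D))
  have hs : ∀ d : C(Y × unitInterval, D), ∃ b c, d = Φ b + Ψ c := by
    intro d
    obtain ⟨g, hg⟩ := surjective_comp T0 hT0 d
    refine ⟨ContinuousMap.fst.comp g, ContinuousMap.snd.comp g, ?_⟩
    ext z
    exact (hg z).symm
  have hd : DenseRange Φ ∨ DenseRange Ψ := by
    rcases hdense with h | h
    · exact Or.inl (dense_comp (Y := Y × unitInterval) φL h)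
    · exact Or.inr (dense_comp (Y := Y × unitInterval) ψL h)
  let G : C(unitInterval × (Y × unitInterval), Dˣ) := ⟨fun q => H (q.2.1, q.1 * q.2.2), by fun_prop⟩
  let γ : C(unitInterval, C(Y × unitInterval, D)) :=
    ContinuousMap.curry ⟨fun q => (G q : D), Units.continuous_val.comp G.continuous⟩
  obtain ⟨u, v, h⟩ := path_orbit Φ hΦ Ψ hΨ hs hd γ γ.continuous (fun t =>
    ⟨ContinuousMap.unitsLift (G.curry t), by ext z; rfl⟩)
  refine ⟨ContinuousMap.unitsLift.symm u, ContinuousMap.unitsLift.symm v, fun p => ?_⟩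
  have := DFunLike.congr_fun h p
  have e1 : γ 1 p = H p := by
    change (H (p.1, 1 * p.2) : D) = _
    rw [one_mul]
  have e0 : γ 0 p = H (p.1, 0) := by
    change (H (p.1, 0 * p.2) : D) = _
    rw [zero_mul]
  rw [e1] at this
  rw [this, ← e0]
  rfl
end

/-- **The double-coset map on invertibles is a Serre fibration.** Let `B, C, D` be
unital complex Banach algebras and `φ : B → D`, `ψ : C → D` continuous unital algebra
homomorphisms such that `φ[B] + ψ[C] = D` and at least one of `φ`, `ψ` has dense range.
Then the map `π : Bˣ × Cˣ → Dˣ`, `π (S, T) = φ(S)⁻¹ * ψ(T)`, is a Serre fibration. -/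
theorem units_map_isSerreFibration
    {B C D : Type*} [NormedRing B] [NormedAlgebra ℂ B] [CompleteSpace B]
    [NormedRing C] [NormedAlgebra ℂ C] [CompleteSpace C]
    [NormedRing D] [NormedAlgebra ℂ D] [CompleteSpace D]
    (φ : B →ₐ[ℂ] D) (hφ : Continuous φ)
    (ψ : C →ₐ[ℂ] D) (hψ : Continuous ψ)
    (hsum : ∀ d : D, ∃ b : B, ∃ c : C, d = φ b + ψ c)
    (hdense : DenseRange φ ∨ DenseRange ψ) :
    IsSerreFibration (fun p : Bˣ × Cˣ =>
      (Units.map φ.toRingHom.toMonoidHom p.1)⁻¹ *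
        Units.map ψ.toRingHom.toMonoidHom p.2) := by
  have hcφ : Continuous (Units.map φ.toRingHom.toMonoidHom) :=
    Continuous.units_map φ.toRingHom.toMonoidHom hφ
  have hcψ : Continuous (Units.map ψ.toRingHom.toMonoidHom) :=
    Continuous.units_map ψ.toRingHom.toMonoidHom hψ
  refine ⟨by fun_prop, ?_⟩
  intro k H h hH hh hH0
  obtain ⟨u, v, huv⟩ := lift_exists (φ.restrictScalars ℝ) hφ (ψ.restrictScalars ℝ) hψ
    hsum hdense H hH
  have huv' : ∀ p, H p = Units.map φ.toRingHom.toMonoidHom (u p) * H (p.1, 0) *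
      Units.map ψ.toRingHom.toMonoidHom (v p) := fun p => Units.ext (huv p)
  refine ⟨fun p => ((h p.1).1 * u (p.1, 0) * (u p)⁻¹, (h p.1).2 * (v (p.1, 0))⁻¹ * v p),
    by fun_prop, fun p => ?_, fun x => ?_⟩
  · have h0 := huv' (p.1, 0)
    rw [huv' p]
    simp only [← hH0, map_mul, map_inv] at h0 ⊢
    generalize Units.map φ.toRingHom.toMonoidHom (u (p.1, 0)) = a at *
    generalize Units.map ψ.toRingHom.toMonoidHom (v (p.1, 0)) = b at *
    generalize Units.map φ.toRingHom.toMonoidHom (h p.1).1 = s at *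
    generalize Units.map ψ.toRingHom.toMonoidHom (h p.1).2 = t at *
    have h1 : a⁻¹ * (s⁻¹ * t) * b⁻¹ = s⁻¹ * t := by
      conv_lhs => rw [h0]
      group
    rw [← h1]
    group
  · simp
end

section
/- Let B, C, D be unital complex Banach algebras and let φ : B → D, ψ : C → D be continuous unital algebra homomorphisms such that every element d ∈ D can be written d = φ(b) + ψ(c) with b ∈ B, c ∈ C, and such that at least one of φ, ψ has dense range in D. Then the image of the map π : Bˣ × Cˣ → Dˣ, π(S,T) = φ(S)⁻¹ · ψ(T), is both open and closed in Dˣ; in particular it is a union of connected components of Dˣ. -/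
open Filter Topology NormedSpace

section helpers

theorem group_aux {G : Type*} [Group G] [TopologicalSpace G] [IsTopologicalGroup G]
    (P Q : Subgroup G) (E I : Set G) (hI : ∀ g, g ∈ I ↔ ∃ p ∈ P, ∃ q ∈ Q, g = p * q)
    (hV : I ∈ 𝓝 (1 : G)) (hE : E ∈ 𝓝 (1 : G))
    (hconj : ∀ g : G, ∀ e ∈ E, g * e * g⁻¹ ∈ E)
    (hEP : E ⊆ closure (P : Set G)) : IsClopen I := by
  constructor
  · refine isClosed_of_closure_subset ?_
    intro R hR
    have h1 : {x : G | x⁻¹ * R ∈ E} ∈ 𝓝 R := by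
      have : Tendsto (fun x : G => x⁻¹ * R) (𝓝 R) (𝓝 1) := by
        have h : Continuous (fun x : G => x⁻¹ * R) := by fun_prop
        simpa using h.tendsto R
      exact this hE
    obtain ⟨x, hx, hxI⟩ := mem_closure_iff_nhds.1 hR _ h1
    obtain ⟨p, hp, q, hq, rfl⟩ := (hI x).1 hxI
    have he := hEP (hconj q _ hx)
    set e := q * ((p * q)⁻¹ * R) * q⁻¹ with hedef
    have h2 : {x : G | x⁻¹ * e ∈ I} ∈ 𝓝 e := by
      have : Tendsto (fun x : G => x⁻¹ * e) (𝓝 e) (𝓝 1) := by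
        have h : Continuous (fun x : G => x⁻¹ * e) := by fun_prop
        simpa using h.tendsto e
      exact this hV
    obtain ⟨p', hp', hpP⟩ := mem_closure_iff_nhds.1 he _ h2
    obtain ⟨p2, hp2, q2, hq2, h⟩ := (hI _).1 hp'
    refine (hI R).2 ⟨p * p' * p2, P.mul_mem (P.mul_mem hp hpP) hp2, q2 * q, Q.mul_mem hq2 hq, ?_⟩
    have h3 : e = p' * (p2 * q2) := by rw [← h]; group
    have h4 : R = p * e * q := by rw [hedef]; group
    rw [h4, h3]; group
  · rw [isOpen_iff_mem_nhds]
    intro x hx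
    obtain ⟨p, hp, q, hq, rfl⟩ := (hI x).1 hx
    have : Tendsto (fun x : G => p⁻¹ * x * q⁻¹) (𝓝 (p * q)) (𝓝 1) := by
      have h : Continuous (fun x : G => p⁻¹ * x * q⁻¹) := by fun_prop
      simpa using h.tendsto (p * q)
    filter_upwards [this hV] with y hy
    obtain ⟨p2, hp2, q2, hq2, h⟩ := (hI _).1 hy
    refine (hI y).2 ⟨p * p2, P.mul_mem hp hp2, q2 * q, Q.mul_mem hq2 hq, ?_⟩
    have : y = p * (p⁻¹ * y * q⁻¹) * q := by group
    beta_reduce at h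
    rw [this, h]; group

theorem exp_unit_exists {A : Type*} [NormedRing A] [NormedAlgebra ℂ A] [CompleteSpace A] (a : A) :
    ∃ u : Aˣ, (u : A) = exp a := by
  let _ := NormedAlgebra.restrictScalars ℚ ℂ A
  exact isUnit_exp a

theorem exp_cont {A : Type*} [NormedRing A] [NormedAlgebra ℂ A] [CompleteSpace A] :
    Continuous (exp : A → A) := by
  let _ := NormedAlgebra.restrictScalars ℚ ℂ A
  exact exp_continuous

theorem exp_conj_aux {A : Type*} [NormedRing A] [NormedAlgebra ℂ A] [CompleteSpace A] (y : Aˣ) (x : A) :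
    exp (y * x * ↑(y⁻¹) : A) = y * exp x * ↑(y⁻¹) := by
  let _ := NormedAlgebra.restrictScalars ℚ ℂ A
  exact exp_units_conj y x

theorem exp_map {A D : Type*} [NormedRing A] [NormedAlgebra ℂ A] [CompleteSpace A]
    [NormedRing D] [NormedAlgebra ℂ D] (φ : A →ₐ[ℂ] D) (hφ : Continuous φ) (a : A) :
    φ (exp a) = exp (φ a) := by
  let _ := NormedAlgebra.restrictScalars ℚ ℂ A
  let _ := NormedAlgebra.restrictScalars ℚ ℂ D
  exact map_exp φ hφ a

theorem clopen_aux
    {B C D : Type*} [NormedRing B] [NormedAlgebra ℂ B] [CompleteSpace B]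
    [NormedRing C] [NormedAlgebra ℂ C] [CompleteSpace C]
    [NormedRing D] [NormedAlgebra ℂ D] [CompleteSpace D]
    (φ : B →ₐ[ℂ] D) (hφ : Continuous φ)
    (ψ : C →ₐ[ℂ] D) (hψ : Continuous ψ)
    (hsum : ∀ d : D, ∃ b : B, ∃ c : C, d = φ b + ψ c)
    (hdense : DenseRange φ) :
    IsClopen (Set.range (fun p : Bˣ × Cˣ =>
        (Units.map φ.toRingHom.toMonoidHom p.1)⁻¹ *
          Units.map ψ.toRingHom.toMonoidHom p.2)) := by
  refine group_aux (Units.map φ.toRingHom.toMonoidHom).range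
    (Units.map ψ.toRingHom.toMonoidHom).range
    {u : Dˣ | ∃ d : D, (u : D) = exp d} _ ?_ ?_ ?_ ?_ ?_
  · intro g
    constructor
    · rintro ⟨⟨S, T⟩, rfl⟩
      exact ⟨_, ⟨S⁻¹, rfl⟩, _, ⟨T, rfl⟩, by simp⟩
    · rintro ⟨_, ⟨S, rfl⟩, _, ⟨T, rfl⟩, rfl⟩
      exact ⟨(S⁻¹, T), by simp⟩
  · let φL : B →L[ℂ] D := ⟨φ.toLinearMap, hφ⟩
    let ψL : C →L[ℂ] D := ⟨ψ.toLinearMap, hψ⟩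
    have hB : HasStrictFDerivAt (fun p : B × C => exp (φL p.1))
        (φL.comp (ContinuousLinearMap.fst ℂ B C)) 0 := by
      have h0 : HasStrictFDerivAt (exp : D → D) (1 : D →L[ℂ] D)
          ((φL.comp (ContinuousLinearMap.fst ℂ B C)) 0) := by
        rw [map_zero]; exact hasStrictFDerivAt_exp_zero
      exact h0.comp (0 : B × C) (φL.comp (ContinuousLinearMap.fst ℂ B C)).hasStrictFDerivAt
    have hC : HasStrictFDerivAt (fun p : B × C => exp (ψL p.2))
        (ψL.comp (ContinuousLinearMap.snd ℂ B C)) 0 := by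
      have h0 : HasStrictFDerivAt (exp : D → D) (1 : D →L[ℂ] D)
          ((ψL.comp (ContinuousLinearMap.snd ℂ B C)) 0) := by
        rw [map_zero]; exact hasStrictFDerivAt_exp_zero
      exact h0.comp (0 : B × C) (ψL.comp (ContinuousLinearMap.snd ℂ B C)).hasStrictFDerivAt
    have hF := hB.mul' hC
    have hn := hF.map_nhds_eq_of_surj (by
      rw [LinearMap.range_eq_top]
      intro d
      obtain ⟨b, c, h⟩ := hsum d
      refine ⟨(b, c), ?_⟩
      simp [φL, ψL, h, add_comm])
    have hr : Set.range (fun p : B × C => exp (φL p.1) * exp (ψL p.2)) ∈ 𝓝 (1 : D) := by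
      have : (1 : D) = exp (φL (0 : B × C).1) * exp (ψL (0 : B × C).2) := by simp
      rw [this]
      change _ ∈ 𝓝 (((fun p : B × C => exp (φL p.1)) * fun p : B × C => exp (ψL p.2)) 0)
      rw [← hn]
      exact Filter.range_mem_map
    have hv : Tendsto (Units.val : Dˣ → D) (𝓝 1) (𝓝 1) := Units.continuous_val.tendsto 1
    filter_upwards [hv hr] with u hu
    obtain ⟨⟨b, c⟩, h⟩ := hu
    obtain ⟨S, hS⟩ := exp_unit_exists b
    obtain ⟨T, hT⟩ := exp_unit_exists c
    refine ⟨(S⁻¹, T), ?_⟩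
    ext
    have h1 := exp_map φ hφ b
    have h2 := exp_map ψ hψ c
    rw [← hS] at h1
    rw [← hT] at h2
    simp only [map_inv, inv_inv, Units.val_mul]
    rw [← h]
    change φ S * ψ T = exp (φ b) * exp (ψ c)
    rw [h1, h2]
  · have hn := (hasStrictFDerivAt_exp_zero (𝕂 := ℂ) (𝔸 := D)).map_nhds_eq_of_surj (by
      rw [LinearMap.range_eq_top]
      intro d
      exact ⟨d, rfl⟩)
    have hr : Set.range (exp : D → D) ∈ 𝓝 (1 : D) := by
      rw [exp_zero] at hn
      rw [← hn]
      exact Filter.range_mem_map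
    have hv : Tendsto (Units.val : Dˣ → D) (𝓝 1) (𝓝 1) := Units.continuous_val.tendsto 1
    filter_upwards [hv hr] with u hu
    obtain ⟨d, h⟩ := hu
    exact ⟨d, h.symm⟩
  · rintro g e ⟨d, hd⟩
    refine ⟨g * d * ↑(g⁻¹), ?_⟩
    rw [exp_conj_aux, Units.val_mul, Units.val_mul, hd]
  · rintro u ⟨d, hd⟩
    rw [Units.isOpenEmbedding_val.isInducing.closure_eq_preimage_closure_image, Set.mem_preimage, hd]
    have hd' : d ∈ closure (Set.range φ) := hdense d
    refine map_mem_closure exp_cont hd' ?_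
    rintro _ ⟨b, rfl⟩
    obtain ⟨S, hS⟩ := exp_unit_exists b
    refine ⟨_, ⟨S, rfl⟩, ?_⟩
    change φ S = _
    rw [hS, exp_map φ hφ]

end helpers


/-- **Openness and closedness of the image of the double-coset map.** Let `B, C, D` be
unital complex Banach algebras and `φ : B → D`, `ψ : C → D` continuous unital algebra
homomorphisms such that `φ[B] + ψ[C] = D` and at least one of `φ`, `ψ` has dense range.
Then the image of the map `π : Bˣ × Cˣ → Dˣ`, `π (S, T) = φ(S)⁻¹ * ψ(T)`, is both open
and closed in `Dˣ`; in particular it is a union of connected components of `Dˣ`. -/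
theorem units_map_image_isOpen_isClosed
    {B C D : Type*} [NormedRing B] [NormedAlgebra ℂ B] [CompleteSpace B]
    [NormedRing C] [NormedAlgebra ℂ C] [CompleteSpace C]
    [NormedRing D] [NormedAlgebra ℂ D] [CompleteSpace D]
    (φ : B →ₐ[ℂ] D) (hφ : Continuous φ)
    (ψ : C →ₐ[ℂ] D) (hψ : Continuous ψ)
    (hsum : ∀ d : D, ∃ b : B, ∃ c : C, d = φ b + ψ c)
    (hdense : DenseRange φ ∨ DenseRange ψ) :
    IsOpen (Set.range (fun p : Bˣ × Cˣ =>
        (Units.map φ.toRingHom.toMonoidHom p.1)⁻¹ *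
          Units.map ψ.toRingHom.toMonoidHom p.2)) ∧
      IsClosed (Set.range (fun p : Bˣ × Cˣ =>
        (Units.map φ.toRingHom.toMonoidHom p.1)⁻¹ *
          Units.map ψ.toRingHom.toMonoidHom p.2)) ∧
      ∀ R : Dˣ, R ∈ Set.range (fun p : Bˣ × Cˣ =>
          (Units.map φ.toRingHom.toMonoidHom p.1)⁻¹ *
            Units.map ψ.toRingHom.toMonoidHom p.2) →
        connectedComponent R ⊆ Set.range (fun p : Bˣ × Cˣ =>
          (Units.map φ.toRingHom.toMonoidHom p.1)⁻¹ *
            Units.map ψ.toRingHom.toMonoidHom p.2) := by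
  have key : IsClopen (Set.range (fun p : Bˣ × Cˣ =>
        (Units.map φ.toRingHom.toMonoidHom p.1)⁻¹ *
          Units.map ψ.toRingHom.toMonoidHom p.2)) := by
    rcases hdense with h | h
    · exact clopen_aux φ hφ ψ hψ hsum h
    · have h' := (clopen_aux ψ hψ φ hφ (fun d => by
        obtain ⟨b, c, hd⟩ := hsum d
        exact ⟨c, b, by rw [hd, add_comm]⟩) h).preimage (continuous_inv (G := Dˣ))
      convert h' using 1
      ext g
      constructor
      · rintro ⟨⟨S, T⟩, rfl⟩
        exact ⟨(T, S), by simp⟩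
      · rintro ⟨⟨T, S⟩, hg⟩
        refine ⟨(S, T), ?_⟩
        beta_reduce at hg
        rw [← inv_inv g, ← hg]
        simp
  exact ⟨key.isOpen, key.isClosed, fun R hR => key.connectedComponent_subset hR⟩
end

section
/- Let N ≥ 1, let r₁,…,r_N > 0, and let W = {v ∈ ℂᴺ : |vᵢ| ≤ rᵢ for all i} be the corresponding closed polydisk. Let α : ℂᴺ → ℝ be an ℝ-linear functional, let c₁ < c₂ be real numbers, and set W′ = {v ∈ W : α(v) ≤ c₂} and W″ = {v ∈ W : α(v) ≥ c₁}. Then every f ∈ B(W′ ∩ W″) can be written as a sum of restrictions: there exist f′ ∈ B(W′) and f″ ∈ B(W″) such that f(v) = f′(v) + f″(v) for all v ∈ W′ ∩ W″. -/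
/-- For a compact set `X ⊆ ℂᴺ`, `BXset X` is the Banach algebra `B(X)`: the closure in
`C(X, ℂ)` (with the supremum norm) of the set of restrictions to `X` of complex
polynomial functions. -/
noncomputable def BXset {ι : Type*} [Fintype ι] (X : Set (ι → ℂ)) : Set C(X, ℂ) :=
  closure (Set.range fun p : MvPolynomial ι ℂ =>
    (⟨fun z => MvPolynomial.eval (z : ι → ℂ) p,
      (MvPolynomial.continuous_eval p).comp continuous_subtype_val⟩ : C(X, ℂ)))

theorem hasDerivAt_param_integral (H H' : ℝ → ℝ → ℂ) (a b : ℝ)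
    (hH : Continuous (Function.uncurry H)) (hH' : Continuous (Function.uncurry H'))
    (hd : ∀ s t, HasDerivAt (fun s => H s t) (H' s t) s) (s : ℝ) :
    HasDerivAt (fun s => ∫ t in a..b, H s t) (∫ t in a..b, H' s t) s := by
  obtain ⟨B, hB⟩ := ((isCompact_closedBall s 1).prod (isCompact_uIcc (a := a) (b := b))).exists_bound_of_continuousOn
    hH'.continuousOn
  have hc : ∀ s, Continuous (H s) := fun s => hH.comp (by fun_prop : Continuous fun t => (s, t))
  have hc' : ∀ s, Continuous (H' s) := fun s => hH'.comp (by fun_prop : Continuous fun t => (s, t))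
  refine (intervalIntegral.hasDerivAt_integral_of_dominated_loc_of_deriv_le (bound := fun _ => B)
    (Metric.closedBall_mem_nhds s one_pos) ?_ ?_ ?_ ?_ ?_ ?_).2
  · exact Filter.Eventually.of_forall fun x => (hc x).aestronglyMeasurable
  · exact (hc s).intervalIntegrable _ _
  · exact (hc' s).aestronglyMeasurable
  · refine Filter.Eventually.of_forall fun t ht x hx => hB (x, t) ⟨hx, Set.uIoc_subset_uIcc ht⟩
  · exact intervalIntegrable_const
  · exact Filter.Eventually.of_forall fun t ht x hx => hd x t

open ComplexConjugate in
theorem pompeiu_bound (φ φ1 φ2 : ℂ → ℂ) (h0 : Continuous φ) (h1 : Continuous φ1) (h2 : Continuous φ2)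
    (hφ : ∀ (c : ℝ → ℂ) (c' : ℂ) (t : ℝ), HasDerivAt c c' t →
      HasDerivAt (fun t => φ (c t)) (φ1 (c t) * c' + φ2 (c t) * conj c') t)
    (R : ℝ) (w : ℂ) (hw : ‖w‖ < R) (M : ℝ) (hM : ∀ z, ‖z‖ ≤ R → ‖φ2 z‖ ≤ M)
    (hk : (∫ θ in (0 : ℝ)..(2 * Real.pi), circleMap 0 R θ / (circleMap 0 R θ - w))
      = 2 * Real.pi) :
    ‖(∫ θ in (0 : ℝ)..(2 * Real.pi), φ (circleMap 0 R θ) *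
        (circleMap 0 R θ / (circleMap 0 R θ - w))) - 2 * Real.pi * φ w‖
      ≤ (2 * R * M) * (2 * Real.pi) := by
  have hR : 0 < R := (norm_nonneg w).trans_lt hw
  set e : ℝ → ℂ := circleMap 0 R with he
  have hec : Continuous e := continuous_circleMap 0 R
  have hen : ∀ θ, ‖e θ‖ = R := fun θ => by simp [he, abs_of_pos hR]
  have hne : ∀ θ, e θ - w ≠ 0 := fun θ h => by
    have := hen θ
    rw [sub_eq_zero.1 h] at this
    linarith
  have hed : ∀ θ, HasDerivAt e (e θ * Complex.I) θ := fun θ => by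
    have := hasDerivAt_circleMap 0 R θ
    simpa [he] using this
  have hkc : Continuous fun θ => e θ / (e θ - w) := hec.div (hec.sub continuous_const) hne
  let z : ℝ → ℝ → ℂ := fun s θ => w + s * (e θ - w)
  have hz : Continuous (Function.uncurry z) := by
    simp only [z, Function.uncurry_def]; fun_prop
  let I' : ℝ → ℂ := fun s => ∫ θ in (0 : ℝ)..(2 * Real.pi),
    (φ1 (z s θ) * (e θ - w) + φ2 (z s θ) * conj (e θ - w)) * (e θ / (e θ - w))
  have hI : ∀ s, HasDerivAt (fun s => ∫ θ in (0 : ℝ)..(2 * Real.pi), φ (z s θ) *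
        (e θ / (e θ - w))) (I' s) s := by
    intro s
    refine hasDerivAt_param_integral (fun s θ => φ (z s θ) * (e θ / (e θ - w)))
      (fun s θ => (φ1 (z s θ) * (e θ - w) + φ2 (z s θ) * conj (e θ - w)) * (e θ / (e θ - w)))
      _ _ ?_ ?_ ?_ s
    · exact (h0.comp hz).mul (hkc.comp continuous_snd)
    · refine Continuous.mul (Continuous.add ((h1.comp hz).mul ?_) ((h2.comp hz).mul ?_))
        (hkc.comp continuous_snd)
      · fun_prop
      · fun_prop
    · intro s θ
      refine HasDerivAt.mul_const (hφ (fun s => z s θ) _ s ?_) _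
      have : HasDerivAt (fun s : ℝ => (s : ℂ)) 1 s := Complex.ofRealCLM.hasDerivAt
      have h := (this.mul_const (e θ - w)).const_add w
      rw [one_mul] at h
      exact h
  -- integration by parts along the circle
  have hparts : ∀ s : ℝ, (∫ θ in (0 : ℝ)..(2 * Real.pi), φ1 (z s θ) * e θ)
      = ∫ θ in (0 : ℝ)..(2 * Real.pi), φ2 (z s θ) * conj (e θ) := by
    intro s
    have hzs : Continuous (z s) := hz.comp (by fun_prop : Continuous fun t => (s, t))
    have i1 : Continuous fun θ => φ1 (z s θ) * e θ := (h1.comp hzs).mul hec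
    have i2 : Continuous fun θ => φ2 (z s θ) * conj (e θ) := (h2.comp hzs).mul (by fun_prop)
    by_cases hs : s = 0
    · subst hs
      have : ∀ θ, z 0 θ = w := fun θ => by simp [z]
      simp only [this]
      have key : (∫ θ in (0 : ℝ)..(2 * Real.pi), e θ) = 0 := by
        have h3 : (∫ θ in (0 : ℝ)..(2 * Real.pi), e θ * Complex.I) = e (2 * Real.pi) - e 0 :=
          intervalIntegral.integral_eq_sub_of_hasDerivAt (fun θ _ => hed θ)
            ((hec.mul continuous_const).intervalIntegrable _ _)
        have h4 : e (2 * Real.pi) = e 0 := by simp [he, circleMap]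
        rw [h4, sub_self, intervalIntegral.integral_mul_const] at h3
        simpa using h3
      have key2 : (∫ θ in (0 : ℝ)..(2 * Real.pi), conj (e θ)) = 0 := by
        have := Complex.conjCLE.toContinuousLinearMap.intervalIntegral_comp_comm
          (hec.intervalIntegrable (μ := MeasureTheory.volume) 0 (2 * Real.pi))
        rw [key] at this
        simpa using this
      rw [intervalIntegral.integral_const_mul, intervalIntegral.integral_const_mul, key, key2]
      simp
    · have hd : ∀ θ, HasDerivAt (fun θ => φ (z s θ))
          ((φ1 (z s θ) * e θ - φ2 (z s θ) * conj (e θ)) * (s * Complex.I)) θ := by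
        intro θ
        have := hφ (z s) (s * (e θ * Complex.I)) θ
          (((hed θ).sub_const w).const_mul (s : ℂ) |>.const_add w)
        convert this using 1
        simp
        ring
      have h3 := intervalIntegral.integral_eq_sub_of_hasDerivAt (a := 0) (b := 2 * Real.pi)
        (fun θ _ => hd θ) (((i1.sub i2).mul continuous_const).intervalIntegrable _ _)
      have h4 : z s (2 * Real.pi) = z s 0 := by simp [z, he, circleMap]
      rw [h4, sub_self, intervalIntegral.integral_mul_const,
        intervalIntegral.integral_sub (i1.intervalIntegrable _ _) (i2.intervalIntegrable _ _)] at h3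
      have h5 : (s : ℂ) * Complex.I ≠ 0 := by simp [hs]
      exact sub_eq_zero.1 ((mul_eq_zero.1 h3).resolve_right h5)
  have hI2 : ∀ s, I' s = ∫ θ in (0 : ℝ)..(2 * Real.pi),
      φ2 (z s θ) * (conj (e θ) + conj (e θ - w) * (e θ / (e θ - w))) := by
    intro s
    have hzs : Continuous (z s) := hz.comp (by fun_prop : Continuous fun t => (s, t))
    have i1 : Continuous fun θ => φ1 (z s θ) * e θ := (h1.comp hzs).mul hec
    have i2 : Continuous fun θ => φ2 (z s θ) * conj (e θ) := (h2.comp hzs).mul (by fun_prop)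
    have i3 : Continuous fun θ => φ2 (z s θ) * (conj (e θ - w) * (e θ / (e θ - w))) :=
      (h2.comp hzs).mul (Continuous.mul (by fun_prop) hkc)
    simp only [I', mul_add]
    rw [intervalIntegral.integral_add (i2.intervalIntegrable _ _) (i3.intervalIntegrable _ _),
      ← hparts s, ← intervalIntegral.integral_add (i1.intervalIntegrable _ _)
        (i3.intervalIntegrable _ _)]
    congr 1
    ext θ
    have := hne θ
    field_simp
  have hbound : ∀ s ∈ Set.Ico (0 : ℝ) 1, ‖I' s‖ ≤ (2 * R * M) * (2 * Real.pi) := by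
    intro s hs
    rw [hI2]
    have := intervalIntegral.norm_integral_le_of_norm_le_const (a := 0) (b := 2 * Real.pi)
      (C := 2 * R * M)
      (f := fun θ => φ2 (z s θ) * (conj (e θ) + conj (e θ - w) * (e θ / (e θ - w)))) ?_
    · simpa [abs_of_pos Real.pi_pos] using this
    · intro θ _
      have hzn : ‖z s θ‖ ≤ R := by
        have : z s θ = ((1 - s : ℝ) : ℂ) * w + (s : ℂ) * e θ := by simp [z]; ring
        rw [this]
        refine (norm_add_le _ _).trans ?_
        rw [norm_mul, norm_mul, hen, Complex.norm_real, Complex.norm_real, Real.norm_of_nonneg hs.1,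
          Real.norm_of_nonneg (by linarith [hs.2])]
        nlinarith [hs.1, hs.2]
      have hk2 : ‖conj (e θ) + conj (e θ - w) * (e θ / (e θ - w))‖ ≤ 2 * R := by
        refine (norm_add_le _ _).trans ?_
        rw [norm_mul, norm_div, Complex.norm_conj, Complex.norm_conj, hen,
          mul_div_cancel₀ _ (norm_ne_zero_iff.2 (hne θ))]
        linarith
      rw [norm_mul, mul_comm]
      exact mul_le_mul hk2 (hM _ hzn) (norm_nonneg _) (by positivity)
  have := norm_image_sub_le_of_norm_deriv_le_segment_01'
    (fun s _ => (hI s).hasDerivWithinAt) hbound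
  have e1 : ∀ θ, z 1 θ = e θ := fun θ => by simp [z]
  have e0 : ∀ θ, z 0 θ = w := fun θ => by simp [z]
  simp only [e1, e0] at this
  rw [intervalIntegral.integral_const_mul, hk] at this
  rwa [mul_comm (2 * (Real.pi : ℂ))]

/-- Cauchy integral of an integer power. -/
theorem cauchy_zpow (R : ℝ) (w : ℂ) (hw : ‖w‖ < R) (m : ℤ) :
    (∫ θ in (0 : ℝ)..(2 * Real.pi), (circleMap 0 R θ) ^ m *
        (circleMap 0 R θ / (circleMap 0 R θ - w))) =
      2 * Real.pi * (if 0 ≤ m then w ^ m.toNat else 0) := by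
  have hR : 0 < R := (norm_nonneg w).trans_lt hw
  have hen : ∀ θ, circleMap 0 R θ ≠ 0 := fun θ => by simp [hR.ne']
  have hci : CircleIntegrable (fun z : ℂ => z ^ m) 0 R := by
    refine ContinuousOn.circleIntegrable hR.le ?_
    intro x hx
    have : x ≠ 0 := by rintro rfl; simp at hx; exact hR.ne hx
    exact (continuousAt_zpow₀ x m (Or.inl this)).continuousWithinAt
  have key := hasSum_two_pi_I_cauchyPowerSeries_integral hci hw
  have hterm : ∀ n : ℕ, (∮ z in C((0 : ℂ), R), (w / (z - 0)) ^ n • (z - 0)⁻¹ • (fun z : ℂ => z ^ m) z)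
      = if (n : ℤ) = m then w ^ n * (2 * Real.pi * Complex.I) else 0 := by
    intro n
    have : (∮ z in C((0 : ℂ), R), (w / (z - 0)) ^ n • (z - 0)⁻¹ • (fun z : ℂ => z ^ m) z)
        = ∮ z in C((0 : ℂ), R), w ^ n * (z - 0) ^ (m - n - 1) := by
      refine circleIntegral.integral_congr hR.le fun x hx => ?_
      have hx0 : x ≠ 0 := by rintro rfl; simp at hx; exact hR.ne hx
      simp only [sub_zero, smul_eq_mul, div_pow]
      rw [zpow_sub₀ hx0, zpow_sub₀ hx0]
      simp
      field_simp
    rw [this, circleIntegral.integral_const_mul]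
    split_ifs with h
    · rw [← h]
      have h1 : ((n : ℤ) - n - 1) = -1 := by ring
      rw [h1]
      simp only [zpow_neg_one]
      rw [circleIntegral.integral_sub_center_inv _ hR.ne']
    · rw [circleIntegral.integral_sub_zpow_of_ne (by omega), mul_zero]
  have hval : (∮ z in C((0 : ℂ), R), (z - (0 + w))⁻¹ • (fun z : ℂ => z ^ m) z)
      = (2 * Real.pi * Complex.I) * (if 0 ≤ m then w ^ m.toNat else 0) := by
    refine key.unique ?_
    simp_rw [hterm]
    split_ifs with h
    · obtain ⟨k, rfl⟩ := Int.eq_ofNat_of_zero_le h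
      simp only [Nat.cast_inj, Int.toNat_natCast]
      rw [mul_comm (2 * (Real.pi : ℂ) * Complex.I) (w ^ k)]
      have : (fun n : ℕ => if n = k then w ^ n * (2 * Real.pi * Complex.I) else 0)
          = fun n : ℕ => if n = k then w ^ k * (2 * Real.pi * Complex.I) else 0 := by
        ext n
        split_ifs with h
        · rw [h]
        · rfl
      rw [this]
      exact hasSum_ite_eq k _
    · rw [mul_zero]
      convert hasSum_zero with n
      rw [if_neg]; omega
  rw [circleIntegral] at hval
  have : (∫ θ in (0 : ℝ)..(2 * Real.pi), (circleMap 0 R θ) ^ m *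
        (circleMap 0 R θ / (circleMap 0 R θ - w))) * Complex.I =
      (2 * Real.pi * Complex.I) * (if 0 ≤ m then w ^ m.toNat else 0) := by
    rw [← hval, ← intervalIntegral.integral_mul_const]
    congr 1
    ext θ
    simp only [deriv_circleMap, smul_eq_mul, zero_add]
    ring
  apply mul_right_cancel₀ Complex.I_ne_zero
  rw [this]; ring

/-! ### Polynomials in `v` and `conj v` -/

/-- Polynomials in `v` (left variables) and `conj v` (right variables). -/
abbrev RPoly (ι : Type*) := MvPolynomial (ι ⊕ ι) ℂ

open ComplexConjugate in
/-- The point at which an `RPoly` is evaluated. -/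
noncomputable def rpt {ι : Type*} (v : ι → ℂ) : ι ⊕ ι → ℂ := Sum.elim v (fun i => conj (v i))

/-- The exponent of the Cauchy projection of a monomial. -/
noncomputable def cexp {ι : Type*} [DecidableEq ι] (i : ι) (m : ι ⊕ ι →₀ ℕ) : ι ⊕ ι →₀ ℕ :=
  (m.update (Sum.inl i) (m (Sum.inl i) - m (Sum.inr i))).update (Sum.inr i) 0

/-- The Cauchy projection of a monomial. -/
noncomputable def cmon {ι : Type*} [DecidableEq ι] (R : ℝ) (i : ι) (m : ι ⊕ ι →₀ ℕ) : RPoly ι :=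
  if m (Sum.inr i) ≤ m (Sum.inl i) then
    MvPolynomial.monomial (cexp i m) (((R : ℂ) ^ 2) ^ m (Sum.inr i)) else 0

/-- The Cauchy projection in the variable `i`. -/
noncomputable def cproj {ι : Type*} [DecidableEq ι] (R : ℝ) (i : ι) : RPoly ι →ₗ[ℂ] RPoly ι :=
  (MvPolynomial.basisMonomials (ι ⊕ ι) ℂ).constr ℂ (cmon R i)

theorem cproj_monomial {ι : Type*} [DecidableEq ι] (R : ℝ) (i : ι) (m : ι ⊕ ι →₀ ℕ) (a : ℂ) :
    cproj R i (MvPolynomial.monomial m a) = a • cmon R i m := by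
  have h : MvPolynomial.monomial m a = a • MvPolynomial.basisMonomials (ι ⊕ ι) ℂ m := by
    simp [MvPolynomial.smul_monomial]
  rw [h, map_smul, cproj, Module.Basis.constr_basis]

theorem pderiv_cproj_of_ne {ι : Type*} [DecidableEq ι] (R : ℝ) (i j : ι) (hij : j ≠ i)
    (F : RPoly ι) :
    MvPolynomial.pderiv (Sum.inr j) (cproj R i F) = cproj R i (MvPolynomial.pderiv (Sum.inr j) F) := by
  induction F using MvPolynomial.induction_on' with
  | add p q hp hq => simp only [map_add, hp, hq]
  | monomial m a =>
    rw [cproj_monomial, MvPolynomial.pderiv_monomial, cproj_monomial, Derivation.map_smul]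
    have e1 : (m - Finsupp.single (Sum.inr j) 1 : ι ⊕ ι →₀ ℕ) (Sum.inr i) = m (Sum.inr i) := by
      simp [Finsupp.single_apply, hij]
    have e2 : (m - Finsupp.single (Sum.inr j) 1 : ι ⊕ ι →₀ ℕ) (Sum.inl i) = m (Sum.inl i) := by
      simp [Finsupp.single_apply]
    rw [cmon, cmon, e1, e2]
    split_ifs with h
    · rw [MvPolynomial.pderiv_monomial, MvPolynomial.smul_monomial, MvPolynomial.smul_monomial]
      have e3 : cexp i m (Sum.inr j) = m (Sum.inr j) := by
        simp [cexp, Finsupp.update_apply, hij]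
      have e4 : cexp i m - Finsupp.single (Sum.inr j) 1
          = cexp i (m - Finsupp.single (Sum.inr j) 1) := by
        ext x
        rcases x with x | x
        · by_cases hx : x = i
          · subst hx; simp [cexp, Finsupp.update_apply, hij, Finsupp.single_apply]
          · simp [cexp, Finsupp.update_apply, hx, Finsupp.single_apply]
        · by_cases hx : x = i
          · subst hx; simp [cexp, Finsupp.update_apply, Finsupp.single_apply]
          · simp [cexp, Finsupp.update_apply, hx, Finsupp.single_apply]
      rw [e3, e4]
      congr 1
      simp only [smul_eq_mul]
      ring
    · simp

theorem cproj_support {ι : Type*} [DecidableEq ι] (R : ℝ) (i : ι) (J : Finset ι) (F : RPoly ι)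
    (hF : F ∈ Submodule.span ℂ ((fun m => MvPolynomial.monomial m (1 : ℂ)) ''
      {m : ι ⊕ ι →₀ ℕ | ∀ j ∈ J, m (Sum.inr j) = 0})) :
    cproj R i F ∈ Submodule.span ℂ ((fun m => MvPolynomial.monomial m (1 : ℂ)) ''
      {m : ι ⊕ ι →₀ ℕ | ∀ j ∈ insert i J, m (Sum.inr j) = 0}) := by
  induction hF using Submodule.span_induction with
  | zero => simp
  | add x y _ _ hx hy => rw [map_add]; exact Submodule.add_mem _ hx hy
  | smul a x _ hx => rw [map_smul]; exact Submodule.smul_mem _ _ hx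
  | mem x h =>
    obtain ⟨m, hm, rfl⟩ := h
    simp only [cproj_monomial, one_smul, cmon]
    split_ifs with h
    · have : MvPolynomial.monomial (cexp i m) (((R : ℂ) ^ 2) ^ m (Sum.inr i))
          = (((R : ℂ) ^ 2) ^ m (Sum.inr i)) • MvPolynomial.monomial (cexp i m) (1 : ℂ) := by
        simp [MvPolynomial.smul_monomial]
      rw [this]
      refine Submodule.smul_mem _ _ (Submodule.subset_span ⟨_, ?_, rfl⟩)
      intro j hj
      by_cases hji : j = i
      · subst hji; simp [cexp]
      · have := hm j (Finset.mem_of_mem_insert_of_ne hj hji)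
        simpa [cexp, Finsupp.update_apply, hji] using this
    · exact Submodule.zero_mem _

theorem exists_holo {ι : Type*} [Fintype ι] (F : RPoly ι)
    (hF : F ∈ Submodule.span ℂ ((fun m => MvPolynomial.monomial m (1 : ℂ)) ''
      {m : ι ⊕ ι →₀ ℕ | ∀ j ∈ (Finset.univ : Finset ι), m (Sum.inr j) = 0})) :
    ∃ p : MvPolynomial ι ℂ, ∀ v, MvPolynomial.eval (rpt v) F = MvPolynomial.eval v p := by
  induction hF using Submodule.span_induction with
  | zero => exact ⟨0, by simp⟩
  | add x y _ _ hx hy =>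
    obtain ⟨p, hp⟩ := hx
    obtain ⟨q, hq⟩ := hy
    exact ⟨p + q, fun v => by simp [hp, hq]⟩
  | smul a x _ hx =>
    obtain ⟨p, hp⟩ := hx
    exact ⟨a • p, fun v => by simp [hp, MvPolynomial.smul_eval]⟩
  | mem x h =>
    obtain ⟨m, hm, rfl⟩ := h
    refine ⟨∏ i, MvPolynomial.X i ^ m (Sum.inl i), fun v => ?_⟩
    have hm' : ∀ j, m (Sum.inr j) = 0 := fun j => hm j (Finset.mem_univ _)
    simp only [MvPolynomial.eval_monomial, one_mul, map_prod, map_pow, MvPolynomial.eval_X]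
    rw [Finsupp.prod_fintype _ _ (by simp), Fintype.prod_sum_type]
    simp [hm', rpt]

open ComplexConjugate in
theorem rpoly_hasDerivAt {ι : Type*} [DecidableEq ι] (F : RPoly ι) (i : ι) (v : ι → ℂ)
    (c : ℝ → ℂ) (c' : ℂ) (t : ℝ) (hc : HasDerivAt c c' t) :
    HasDerivAt (fun t => MvPolynomial.eval (rpt (Function.update v i (c t))) F)
      (MvPolynomial.eval (rpt (Function.update v i (c t))) (MvPolynomial.pderiv (Sum.inl i) F) * c'
        + MvPolynomial.eval (rpt (Function.update v i (c t))) (MvPolynomial.pderiv (Sum.inr i) F)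
          * conj c') t := by
  induction F using MvPolynomial.induction_on with
  | C a => simpa using hasDerivAt_const t a
  | add p q hp hq =>
    simp only [map_add]
    refine (hp.add hq).congr_deriv ?_
    ring
  | mul_X p x hp =>
    have hx : HasDerivAt (fun t => rpt (Function.update v i (c t)) x)
        (MvPolynomial.eval (rpt (Function.update v i (c t))) (MvPolynomial.pderiv (Sum.inl i) (MvPolynomial.X x)) * c'
        + MvPolynomial.eval (rpt (Function.update v i (c t))) (MvPolynomial.pderiv (Sum.inr i) (MvPolynomial.X x))
          * conj c') t := by
      rcases x with x | x
      · have h0 : (Sum.inl x : ι ⊕ ι) ≠ Sum.inr i := by simp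
        rw [MvPolynomial.pderiv_X_of_ne h0]
        by_cases h : x = i
        · subst h
          rw [MvPolynomial.pderiv_X_self]
          simp only [rpt, Sum.elim_inl, Function.update_self, map_one, map_zero, one_mul, zero_mul,
            add_zero]
          exact hc
        · have h' : (Sum.inl x : ι ⊕ ι) ≠ Sum.inl i := by simpa using h
          rw [MvPolynomial.pderiv_X_of_ne h']
          simp only [rpt, Sum.elim_inl, Function.update_of_ne h, map_zero, zero_mul, add_zero]
          exact hasDerivAt_const t (v x)
      · have h0 : (Sum.inr x : ι ⊕ ι) ≠ Sum.inl i := by simp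
        rw [MvPolynomial.pderiv_X_of_ne h0]
        by_cases h : x = i
        · subst h
          rw [MvPolynomial.pderiv_X_self]
          simp only [rpt, Sum.elim_inr, Function.update_self, map_one, map_zero, one_mul, zero_mul,
            zero_add]
          exact hc.star
        · have h' : (Sum.inr x : ι ⊕ ι) ≠ Sum.inr i := by simpa using h
          rw [MvPolynomial.pderiv_X_of_ne h']
          simp only [rpt, Sum.elim_inr, Function.update_of_ne h, map_zero, zero_mul, add_zero]
          exact hasDerivAt_const t (conj (v x))
    simp only [map_mul, MvPolynomial.eval_X]
    refine (hp.mul hx).congr_deriv ?_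
    simp only [Derivation.leibniz, map_add, map_mul, smul_eq_mul, MvPolynomial.eval_X]
    ring

theorem rpt_continuous {ι : Type*} : Continuous (rpt (ι := ι)) := by
  refine continuous_pi fun x => ?_
  rcases x with x | x
  · simp only [rpt, Sum.elim_inl]; fun_prop
  · simp only [rpt, Sum.elim_inr]; fun_prop

theorem rpoly_continuous {ι : Type*} (F : RPoly ι) :
    Continuous fun v => MvPolynomial.eval (rpt v) F :=
  (MvPolynomial.continuous_eval F).comp rpt_continuous

theorem cproj_integral {ι : Type*} [Fintype ι] [DecidableEq ι] (R : ℝ) (i : ι) (F : RPoly ι) (v : ι → ℂ)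
    (w : ℂ) (hw : ‖w‖ < R) :
    (∫ θ in (0 : ℝ)..(2 * Real.pi), MvPolynomial.eval (rpt (Function.update v i (circleMap 0 R θ))) F *
        (circleMap 0 R θ / (circleMap 0 R θ - w))) =
      2 * Real.pi * MvPolynomial.eval (rpt (Function.update v i w)) (cproj R i F) := by
  have hR : 0 < R := (norm_nonneg w).trans_lt hw
  have hen : ∀ θ, circleMap 0 R θ ≠ 0 := fun θ => by simp [hR.ne']
  have hne : ∀ θ, circleMap 0 R θ - w ≠ 0 := fun θ h => by
    have : ‖circleMap 0 R θ‖ = R := by simp [abs_of_pos hR]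
    rw [sub_eq_zero.1 h] at this
    linarith
  have hkc : Continuous fun θ => circleMap 0 R θ / (circleMap 0 R θ - w) :=
    (continuous_circleMap 0 R).div ((continuous_circleMap 0 R).sub continuous_const) hne
  have hint : ∀ F : RPoly ι, Continuous fun θ =>
      MvPolynomial.eval (rpt (Function.update v i (circleMap 0 R θ))) F *
        (circleMap 0 R θ / (circleMap 0 R θ - w)) := fun F =>
    ((rpoly_continuous F).comp (continuous_const.update i (continuous_circleMap 0 R))).mul hkc
  induction F using MvPolynomial.induction_on' with
  | add p q hp hq =>
    simp only [map_add, add_mul, mul_add]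
    rw [intervalIntegral.integral_add ((hint p).intervalIntegrable _ _)
      ((hint q).intervalIntegrable _ _), hp, hq]
  | monomial m a =>
    -- the factor coming from the other variables
    set K : ℂ := ∏ x ∈ (Finset.univ.erase i), (v x ^ m (Sum.inl x) * rpt v (Sum.inr x) ^ m (Sum.inr x)) with hK
    have hev : ∀ (ζ : ℂ) (m' : ι ⊕ ι →₀ ℕ) (b : ℂ), (∀ x, x ≠ i → m' (Sum.inl x) = m (Sum.inl x)) →
        (∀ x, x ≠ i → m' (Sum.inr x) = m (Sum.inr x)) →
        MvPolynomial.eval (rpt (Function.update v i ζ)) (MvPolynomial.monomial m' b)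
        = b * (ζ ^ m' (Sum.inl i) * (starRingEnd ℂ ζ) ^ m' (Sum.inr i)) * K := by
      intro ζ m' b h1 h2
      rw [MvPolynomial.eval_monomial, Finsupp.prod_fintype _ _ (by simp), Fintype.prod_sum_type,
        ← Finset.prod_mul_distrib, ← Finset.mul_prod_erase _ _ (Finset.mem_univ i), mul_assoc b]
      congr 1
      congr 1
      · simp [rpt]
      · refine Finset.prod_congr rfl fun x hx => ?_
        have hx' := Finset.ne_of_mem_erase hx
        simp [rpt, hx', h1 x hx', h2 x hx']
    have hz := cauchy_zpow R w hw ((m (Sum.inl i) : ℤ) - m (Sum.inr i))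
    have hL : ∀ θ, MvPolynomial.eval (rpt (Function.update v i (circleMap 0 R θ)))
        (MvPolynomial.monomial m a) * (circleMap 0 R θ / (circleMap 0 R θ - w))
        = (a * K * ((R : ℂ) ^ 2) ^ m (Sum.inr i)) *
          (circleMap 0 R θ ^ ((m (Sum.inl i) : ℤ) - m (Sum.inr i)) *
            (circleMap 0 R θ / (circleMap 0 R θ - w))) := by
      intro θ
      rw [hev _ m a (fun _ _ => rfl) (fun _ _ => rfl)]
      have hconj : starRingEnd ℂ (circleMap 0 R θ) = (R : ℂ) ^ 2 / circleMap 0 R θ := by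
        rw [eq_div_iff (hen θ), mul_comm, Complex.mul_conj, Complex.normSq_eq_norm_sq]
        simp
      rw [hconj, zpow_sub₀ (hen θ), div_pow]
      simp only [zpow_natCast]
      ring
    simp_rw [hL]
    rw [intervalIntegral.integral_const_mul, hz, cproj_monomial, MvPolynomial.smul_eval, cmon]
    by_cases h : m (Sum.inr i) ≤ m (Sum.inl i)
    · rw [if_pos (by omega), if_pos h, hev]
      · have e1 : ((m (Sum.inl i) : ℤ) - m (Sum.inr i)).toNat = m (Sum.inl i) - m (Sum.inr i) := by
          omega
        have e2 : cexp i m (Sum.inl i) = m (Sum.inl i) - m (Sum.inr i) := by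
          simp [cexp, Finsupp.update_apply]
        have e3 : cexp i m (Sum.inr i) = 0 := by simp [cexp]
        rw [e1, e2, e3]
        ring
      · intro x hx; simp [cexp, Finsupp.update_apply, hx]
      · intro x hx; simp [cexp, Finsupp.update_apply, hx]
    · rw [if_neg (by omega), if_neg h]
      simp

/-- The basic one-variable estimate. -/
theorem cproj_bound {ι : Type*} [Fintype ι] [DecidableEq ι] (r : ι → ℝ) (hr : ∀ i, 0 < r i) (i : ι)
    (F : RPoly ι) (M : ℝ)
    (hM : ∀ v : ι → ℂ, (∀ j, ‖v j‖ ≤ r j) →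
      ‖MvPolynomial.eval (rpt v) (MvPolynomial.pderiv (Sum.inr i) F)‖ ≤ M)
    (v : ι → ℂ) (hv : ∀ j, ‖v j‖ ≤ r j) :
    ‖MvPolynomial.eval (rpt v) (cproj (r i) i F) - MvPolynomial.eval (rpt v) F‖ ≤ 2 * r i * M := by
  have hcu : ∀ F : RPoly ι, Continuous fun z : ℂ => MvPolynomial.eval (rpt (Function.update v i z)) F :=
    fun F => (rpoly_continuous F).comp (continuous_const.update i continuous_id)
  have key : ∀ w : ℂ, ‖w‖ < r i →
      ‖MvPolynomial.eval (rpt (Function.update v i w)) (cproj (r i) i F)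
        - MvPolynomial.eval (rpt (Function.update v i w)) F‖ ≤ 2 * r i * M := by
    intro w hw
    have hk : (∫ θ in (0 : ℝ)..(2 * Real.pi), circleMap 0 (r i) θ / (circleMap 0 (r i) θ - w))
      = 2 * Real.pi := by
      simpa using cauchy_zpow (r i) w hw 0
    have := pompeiu_bound (fun z => MvPolynomial.eval (rpt (Function.update v i z)) F)
      (fun z => MvPolynomial.eval (rpt (Function.update v i z)) (MvPolynomial.pderiv (Sum.inl i) F))
      (fun z => MvPolynomial.eval (rpt (Function.update v i z)) (MvPolynomial.pderiv (Sum.inr i) F))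
      (hcu _) (hcu _) (hcu _) (fun c c' t hc => rpoly_hasDerivAt F i v c c' t hc) (r i) w hw M
      (fun z hz => hM _ fun j => by
        by_cases h : j = i
        · subst h; simpa using hz
        · simpa [h] using hv j) hk
    rw [cproj_integral _ _ _ _ _ hw, ← mul_sub, norm_mul] at this
    have h2 : ‖(2 * Real.pi : ℂ)‖ = 2 * Real.pi := by
      simp [abs_of_pos Real.pi_pos]
    rw [h2, mul_comm] at this
    exact le_of_mul_le_mul_right this (by positivity)
  have hclosed : IsClosed {w : ℂ | ‖MvPolynomial.eval (rpt (Function.update v i w)) (cproj (r i) i F)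
        - MvPolynomial.eval (rpt (Function.update v i w)) F‖ ≤ 2 * r i * M} :=
    isClosed_le ((hcu _).sub (hcu _)).norm continuous_const
  have hsub : Metric.closedBall (0 : ℂ) (r i) ⊆ {w : ℂ | ‖MvPolynomial.eval (rpt (Function.update v i w)) (cproj (r i) i F)
        - MvPolynomial.eval (rpt (Function.update v i w)) F‖ ≤ 2 * r i * M} := by
    rw [← closure_ball _ (hr i).ne']
    refine hclosed.closure_subset_iff.2 fun w hw => key w (by simpa using hw)
  have := hsub (show v i ∈ Metric.closedBall (0 : ℂ) (r i) by simpa using hv i)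
  simpa using this

theorem cproj_iterate {ι : Type*} [Fintype ι] [DecidableEq ι] (r : ι → ℝ) (hr : ∀ i, 0 < r i)
    (b : ι → ℂ) (B : ℝ) (hB0 : 0 ≤ B) (hB : ∀ i, 2 * r i * ‖b i‖ ≤ B)
    (F : ℕ → RPoly ι) (hF : ∀ k j, MvPolynomial.pderiv (Sum.inr j) (F k) = b j • F (k + 1))
    (M : ℝ) (hM0 : 0 ≤ M) (J : Finset ι) :
    ∀ m : ℕ, (∀ k, 1 ≤ k → k ≤ m + J.card → ∀ v : ι → ℂ, (∀ j, ‖v j‖ ≤ r j) →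
        ‖MvPolynomial.eval (rpt v) (F k)‖ ≤ M) →
      ∃ G : ℕ → RPoly ι,
        (∀ k j, j ∉ J → MvPolynomial.pderiv (Sum.inr j) (G k) = b j • G (k + 1)) ∧
        (∀ k, G k ∈ Submodule.span ℂ ((fun m => MvPolynomial.monomial m (1 : ℂ)) ''
          {m : ι ⊕ ι →₀ ℕ | ∀ j ∈ J, m (Sum.inr j) = 0})) ∧
        (∀ k ≤ m, ∀ v : ι → ℂ, (∀ j, ‖v j‖ ≤ r j) →
          ‖MvPolynomial.eval (rpt v) (G k) - MvPolynomial.eval (rpt v) (F k)‖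
            ≤ ((1 + B) ^ J.card - 1) * M) := by
  induction J using Finset.induction_on with
  | empty =>
    intro m _
    refine ⟨F, fun k j _ => hF k j, fun k => ?_, fun k _ v _ => by simp⟩
    induction (F k) using MvPolynomial.induction_on' with
    | add p q hp hq => exact Submodule.add_mem _ hp hq
    | monomial m a =>
      have : MvPolynomial.monomial m a = a • MvPolynomial.monomial m (1 : ℂ) := by
        simp [MvPolynomial.smul_monomial]
      rw [this]
      exact Submodule.smul_mem _ _ (Submodule.subset_span ⟨m, by simp, rfl⟩)
  | insert i J hi ih =>
    intro m hm
    have hcard : (insert i J).card = J.card + 1 := Finset.card_insert_of_notMem hi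
    rw [hcard] at hm ⊢
    obtain ⟨G, hG1, hG2, hG3⟩ := ih (m + 1) (fun k h1 h2 => hm k h1 (by omega))
    refine ⟨fun k => cproj (r i) i (G k), ?_, fun k => cproj_support _ _ _ _ (hG2 k), ?_⟩
    · intro k j hj
      rw [Finset.mem_insert, not_or] at hj
      rw [pderiv_cproj_of_ne _ _ _ hj.1, hG1 k j hj.2, map_smul]
    · intro k hk v hv
      have h1 := cproj_bound r hr i (G k) (‖b i‖ * ((1 + B) ^ J.card * M)) (by
        intro u hu
        rw [hG1 k i hi, MvPolynomial.smul_eval, norm_mul]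
        refine mul_le_mul_of_nonneg_left ?_ (norm_nonneg _)
        have e1 := hG3 (k + 1) (by omega) u hu
        have e2 := hm (k + 1) (by omega) (by omega) u hu
        have e3 := norm_sub_norm_le (MvPolynomial.eval (rpt u) (G (k + 1)))
          (MvPolynomial.eval (rpt u) (F (k + 1)))
        linarith) v hv
      have h2 := hG3 k (by omega) v hv
      have h3 : 2 * r i * (‖b i‖ * ((1 + B) ^ J.card * M)) ≤ B * ((1 + B) ^ J.card * M) := by
        rw [← mul_assoc]
        exact mul_le_mul_of_nonneg_right (hB i) (by positivity)
      have h4 := norm_sub_le_norm_sub_add_norm_sub (MvPolynomial.eval (rpt v) (cproj (r i) i (G k)))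
        (MvPolynomial.eval (rpt v) (G k)) (MvPolynomial.eval (rpt v) (F k))
      have h5 : ((1 + B) ^ (J.card + 1) - 1) * M
          = B * ((1 + B) ^ J.card * M) + ((1 + B) ^ J.card - 1) * M := by ring
      linarith

/-! ### Real cutoff functions and polynomial approximation -/

theorem exists_antideriv (q : Polynomial ℝ) : ∃ Q : Polynomial ℝ, Polynomial.derivative Q = q := by
  induction q using Polynomial.induction_on' with
  | add p q hp hq =>
    obtain ⟨P, rfl⟩ := hp
    obtain ⟨Q, rfl⟩ := hq
    exact ⟨P + Q, by simp⟩
  | monomial n a =>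
    refine ⟨Polynomial.monomial (n + 1) (a / (n + 1)), ?_⟩
    rw [Polynomial.derivative_monomial]
    have : ((n : ℝ) + 1) ≠ 0 := by positivity
    simp
    field_simp

open scoped ContDiff in
theorem exists_poly_approx (n : ℕ) (A : ℝ) (hA : 0 ≤ A) : ∀ (f : ℝ → ℝ) (_ : ContDiff ℝ ∞ f)
    (ε : ℝ) (_ : 0 < ε), ∃ q : Polynomial ℝ, ∀ k ≤ n, ∀ x ∈ Set.Icc (-A) A,
      |iteratedDeriv k f x - (Polynomial.derivative^[k] q).eval x| ≤ ε := by
  induction n with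
  | zero =>
    intro f hf ε hε
    obtain ⟨q, hq⟩ := exists_polynomial_near_of_continuousOn (-A) A f hf.continuous.continuousOn ε hε
    refine ⟨q, fun k hk x hx => ?_⟩
    obtain rfl : k = 0 := by omega
    rw [abs_sub_comm]
    simpa using (hq x hx).le
  | succ n ih =>
    intro f hf ε hε
    have hf' : ContDiff ℝ ∞ (deriv f) := (contDiff_infty_iff_deriv.1 hf).2
    have hfd : Differentiable ℝ f := (contDiff_infty_iff_deriv.1 hf).1
    obtain ⟨q, hq⟩ := ih (deriv f) hf' (ε / (A + 1)) (by positivity)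
    have hle : ε / (A + 1) ≤ ε := div_le_self hε.le (by linarith)
    obtain ⟨Q, hQ⟩ := exists_antideriv q
    refine ⟨Q + Polynomial.C (f 0 - Q.eval 0), fun k hk x hx => ?_⟩
    rcases k with _ | k
    · simp only [iteratedDeriv_zero, Function.iterate_zero, id]
      have hd : ∀ y ∈ Set.Icc (-A) A, HasDerivWithinAt
          (fun y => f y - (Q + Polynomial.C (f 0 - Q.eval 0)).eval y)
          (deriv f y - q.eval y) (Set.Icc (-A) A) y := by
        intro y _
        have h1 := (hfd y).hasDerivAt
        have h2 := (Q + Polynomial.C (f 0 - Q.eval 0)).hasDerivAt y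
        have := h1.sub h2
        simp only [Polynomial.derivative_add, Polynomial.derivative_C, add_zero, hQ] at this
        exact this.hasDerivWithinAt
      have := (convex_Icc (-A) A).norm_image_sub_le_of_norm_hasDerivWithin_le hd
        (C := ε / (A + 1)) (fun y hy => by simpa using hq 0 (Nat.zero_le _) y hy)
        (show (0 : ℝ) ∈ Set.Icc (-A) A from ⟨by linarith, hA⟩) hx
      simp only [Polynomial.eval_add, Polynomial.eval_C, Real.norm_eq_abs, sub_zero] at this
      have h3 : |x| ≤ A := abs_le.2 hx
      have h4 : ε / (A + 1) * |x| ≤ ε := by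
        calc ε / (A + 1) * |x| ≤ ε / (A + 1) * (A + 1) := by gcongr; linarith
          _ = ε := by field_simp
      refine le_trans (le_of_eq ?_) (this.trans h4)
      rw [Polynomial.eval_add, Polynomial.eval_C]
      congr 1
      ring
    · rw [iteratedDeriv_succ', Function.iterate_succ_apply]
      simp only [Polynomial.derivative_add, Polynomial.derivative_C, add_zero, hQ]
      exact (hq k (by omega) x hx).trans hle

open scoped ContDiff in
theorem exists_cutoff (c₁ c₂ : ℝ) (hc : c₁ < c₂) (n : ℕ) :
    ∃ (χ : ℝ → ℝ) (D : ℝ), ContDiff ℝ ∞ χ ∧ 0 ≤ D ∧ (∀ x ≤ c₁, χ x = 0) ∧ (∀ x, c₂ ≤ x → χ x = 1) ∧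
      (∀ k, 1 ≤ k → ∀ x, (x < c₁ ∨ c₂ < x) → iteratedDeriv k χ x = 0) ∧
      (∀ k ≤ n, ∀ x ∈ Set.Icc c₁ c₂, |iteratedDeriv k χ x| ≤ D) := by
  have hpos : 0 < c₂ - c₁ := by linarith
  let χ : ℝ → ℝ := fun x => Real.smoothTransition ((x - c₁) / (c₂ - c₁))
  have hχ : ContDiff ℝ ∞ χ :=
    Real.smoothTransition.contDiff.comp ((contDiff_id.sub contDiff_const).div_const _)
  have h0 : ∀ x ≤ c₁, χ x = 0 := fun x hx =>
    Real.smoothTransition.zero_of_nonpos (div_nonpos_of_nonpos_of_nonneg (by linarith) hpos.le)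
  have h1 : ∀ x, c₂ ≤ x → χ x = 1 := fun x hx =>
    Real.smoothTransition.one_of_one_le ((one_le_div hpos).2 (by linarith))
  have hb : ∀ k : ℕ, ∃ D : ℝ, 0 ≤ D ∧ ∀ x ∈ Set.Icc c₁ c₂, |iteratedDeriv k χ x| ≤ D := by
    intro k
    obtain ⟨D, hD⟩ := (isCompact_Icc (a := c₁) (b := c₂)).exists_bound_of_continuousOn
      (hχ.continuous_iteratedDeriv k (by exact_mod_cast le_top)).continuousOn
    exact ⟨D, (norm_nonneg _).trans (hD c₁ ⟨le_rfl, hc.le⟩), hD⟩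
  choose D hD0 hD using hb
  refine ⟨χ, ∑ k ∈ Finset.range (n + 1), D k, hχ, Finset.sum_nonneg fun k _ => hD0 k, h0, h1, ?_, ?_⟩
  · intro k hk x hx
    obtain ⟨a, ha⟩ : ∃ a : ℝ, χ =ᶠ[nhds x] fun _ => a := by
      rcases hx with hx | hx
      · exact ⟨0, by filter_upwards [Iio_mem_nhds hx] with y hy using h0 y (le_of_lt hy)⟩
      · exact ⟨1, by filter_upwards [Ioi_mem_nhds hx] with y hy using h1 y (le_of_lt hy)⟩
    rw [ha.iteratedDeriv_eq, iteratedDeriv_const]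
    simp; omega
  · intro k hk x hx
    exact (hD k x hx).trans (Finset.single_le_sum (f := D) (fun k _ => hD0 k)
      (Finset.mem_range.2 (by omega)))

/-! ### The key estimate for polynomials -/

theorem exists_alpha_poly {ι : Type*} [Fintype ι] [DecidableEq ι] (α : (ι → ℂ) →ₗ[ℝ] ℝ) :
    ∃ (P : RPoly ι) (b : ι → ℂ), (∀ v, MvPolynomial.eval (rpt v) P = (α v : ℂ)) ∧
      ∀ j, MvPolynomial.pderiv (Sum.inr j) P = MvPolynomial.C (b j) := by
  let b : ι → ℂ := fun j => ((α (Pi.single j 1) : ℂ) + α (Pi.single j Complex.I) * Complex.I) / 2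
  let b' : ι → ℂ := fun j => ((α (Pi.single j 1) : ℂ) - α (Pi.single j Complex.I) * Complex.I) / 2
  refine ⟨∑ j, (MvPolynomial.C (b' j) * MvPolynomial.X (Sum.inl j)
    + MvPolynomial.C (b j) * MvPolynomial.X (Sum.inr j)), b, ?_, ?_⟩
  · intro v
    have hv : v = ∑ j, ((v j).re • (Pi.single j (1 : ℂ) : ι → ℂ)
        + (v j).im • (Pi.single j Complex.I : ι → ℂ)) := by
      conv_lhs => rw [← Finset.univ_sum_single v]
      refine Finset.sum_congr rfl fun j _ => ?_
      rw [← Pi.single_smul, ← Pi.single_smul, ← Pi.single_add]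
      congr 1
      simp
    have hα : α v = ∑ j, ((v j).re * α (Pi.single j 1) + (v j).im * α (Pi.single j Complex.I)) := by
      conv_lhs => rw [hv]
      simp
    rw [hα]
    push_cast
    rw [map_sum]
    refine Finset.sum_congr rfl fun j _ => ?_
    simp only [map_add, map_mul, MvPolynomial.eval_C, MvPolynomial.eval_X, rpt, Sum.elim_inl,
      Sum.elim_inr, b, b']
    apply Complex.ext <;> simp <;> ring
  · intro j
    rw [map_sum, Finset.sum_eq_single j]
    · simp [MvPolynomial.pderiv_X_of_ne]
    · intro i _ hij
      have h' : (Sum.inr i : ι ⊕ ι) ≠ Sum.inr j := by simpa using hij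
      have h0 : (Sum.inl i : ι ⊕ ι) ≠ Sum.inr j := by simp
      simp [MvPolynomial.pderiv_X_of_ne h0, MvPolynomial.pderiv_X_of_ne h']
    · simp

theorem key_estimate {N : ℕ} (r : Fin N → ℝ) (hr : ∀ i, 0 < r i)
    (α : (Fin N → ℂ) →ₗ[ℝ] ℝ) (c₁ c₂ : ℝ) (hc : c₁ < c₂) :
    ∃ C : ℝ, 0 < C ∧ ∀ (p : MvPolynomial (Fin N) ℂ) (η : ℝ), 0 < η →
      (∀ v : Fin N → ℂ, (∀ i, ‖v i‖ ≤ r i) → c₁ ≤ α v → α v ≤ c₂ →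
        ‖MvPolynomial.eval v p‖ ≤ η) →
      ∃ p' : MvPolynomial (Fin N) ℂ,
        (∀ v : Fin N → ℂ, (∀ i, ‖v i‖ ≤ r i) → α v ≤ c₂ → ‖MvPolynomial.eval v p'‖ ≤ C * η) ∧
        (∀ v : Fin N → ℂ, (∀ i, ‖v i‖ ≤ r i) → c₁ ≤ α v →
          ‖MvPolynomial.eval v p - MvPolynomial.eval v p'‖ ≤ C * η) := by
  obtain ⟨P, b, hP, hPd⟩ := exists_alpha_poly α
  obtain ⟨χ, D, hχ, hD0, hχ0, hχ1, hχd, hχD⟩ := exists_cutoff c₁ c₂ hc N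
  have hWc : IsCompact {v : Fin N → ℂ | ∀ i, ‖v i‖ ≤ r i} := by
    have : {v : Fin N → ℂ | ∀ i, ‖v i‖ ≤ r i} = Set.univ.pi fun i => Metric.closedBall (0 : ℂ) (r i) := by
      ext v; simp [Set.mem_pi]
    rw [this]
    exact isCompact_univ_pi fun i => isCompact_closedBall _ _
  obtain ⟨A, hA⟩ := hWc.exists_bound_of_continuousOn
    (α.continuous_of_finiteDimensional).continuousOn
  have hA0 : 0 ≤ A := (norm_nonneg _).trans (hA 0 (fun i => by simpa using (hr i).le))
  let B : ℝ := ∑ i, 2 * r i * ‖b i‖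
  have hterm : ∀ i, 0 ≤ 2 * r i * ‖b i‖ := fun i => by have := hr i; positivity
  have hB0 : 0 ≤ B := Finset.sum_nonneg fun i _ => hterm i
  have hB : ∀ i, 2 * r i * ‖b i‖ ≤ B := fun i =>
    Finset.single_le_sum (f := fun i => 2 * r i * ‖b i‖) (fun i _ => hterm i) (Finset.mem_univ i)
  have hBN : 1 ≤ (1 + B) ^ N := one_le_pow₀ (by linarith)
  refine ⟨(1 + B) ^ N * (D + 2), by positivity, ?_⟩
  intro p η hη hp
  obtain ⟨P0, hP0⟩ := hWc.exists_bound_of_continuousOn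
    (MvPolynomial.continuous_eval p).continuousOn
  have hP00 : 0 ≤ P0 := (norm_nonneg _).trans (hP0 0 (fun i => by simpa using (hr i).le))
  obtain ⟨q, hq⟩ := exists_poly_approx N A hA0 χ hχ (η / (P0 + 1)) (by positivity)
  let Q : ℕ → Polynomial ℂ := fun k => (Polynomial.derivative^[k] q).map Complex.ofRealHom
  let F : ℕ → RPoly (Fin N) := fun k => MvPolynomial.rename Sum.inl p * Polynomial.aeval P (Q k)
  have hFev : ∀ k v, MvPolynomial.eval (rpt v) (F k)
      = MvPolynomial.eval v p * (((Polynomial.derivative^[k] q).eval (α v) : ℝ) : ℂ) := by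
    intro k v
    simp only [F, map_mul, Q]
    congr 1
    · rw [MvPolynomial.eval_rename]; rfl
    · have h1 : MvPolynomial.eval (rpt v) (Polynomial.aeval P ((Polynomial.derivative^[k] q).map Complex.ofRealHom))
          = Polynomial.aeval (MvPolynomial.eval (rpt v) P) ((Polynomial.derivative^[k] q).map Complex.ofRealHom) :=
        (Polynomial.aeval_algHom_apply (MvPolynomial.aeval (rpt v)) P _).symm
      rw [h1, hP, Polynomial.coe_aeval_eq_eval, Polynomial.eval_map]
      exact Polynomial.eval₂_at_apply Complex.ofRealHom (α v)
  have hFd : ∀ k j, MvPolynomial.pderiv (Sum.inr j) (F k) = b j • F (k + 1) := by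
    intro k j
    have h1 : MvPolynomial.pderiv (Sum.inr j) (MvPolynomial.rename (Sum.inl : Fin N → Fin N ⊕ Fin N) p) = 0 := by
      apply MvPolynomial.pderiv_eq_zero_of_notMem_vars
      intro h
      have := MvPolynomial.vars_rename _ _ h
      simp at this
    have h2 : Polynomial.derivative (Q k) = Q (k + 1) := by
      simp only [Q, Polynomial.derivative_map, Function.iterate_succ_apply']
    simp only [F, Derivation.leibniz, h1, smul_zero, add_zero, Derivation.map_aeval, hPd, h2, smul_eq_mul]
    rw [MvPolynomial.smul_eq_C_mul]
    ring
  have hsmall : ∀ k ≤ N, ∀ v : Fin N → ℂ, (∀ i, ‖v i‖ ≤ r i) →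
      ‖MvPolynomial.eval v p‖ * |iteratedDeriv k χ (α v) - (Polynomial.derivative^[k] q).eval (α v)| ≤ η := by
    intro k hk v hv
    have h1 := hq k hk (α v) (abs_le.1 (hA v hv))
    calc _ ≤ P0 * (η / (P0 + 1)) := mul_le_mul (hP0 v hv) h1 (abs_nonneg _) hP00
      _ ≤ (P0 + 1) * (η / (P0 + 1)) := by gcongr; linarith
      _ = η := by field_simp
  have hbig : ∀ k ≤ N, ∀ v : Fin N → ℂ, (∀ i, ‖v i‖ ≤ r i) →
      (1 ≤ k ∨ α v ≤ c₂) → ‖MvPolynomial.eval v p‖ * |iteratedDeriv k χ (α v)| ≤ D * η := by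
    intro k hk v hv hor
    by_cases hin : α v ∈ Set.Icc c₁ c₂
    · rw [mul_comm]
      exact mul_le_mul (hχD k hk _ hin) (hp v hv hin.1 hin.2) (norm_nonneg _) hD0
    · have hz : iteratedDeriv k χ (α v) = 0 := by
        rw [Set.mem_Icc, not_and_or, not_le, not_le] at hin
        rcases Nat.eq_zero_or_pos k with rfl | hk1
        · rw [iteratedDeriv_zero]
          have : α v ≤ c₂ := hor.resolve_left (by omega)
          exact hχ0 _ (hin.resolve_right (by linarith)).le
        · exact hχd k hk1 _ hin
      rw [hz, abs_zero, mul_zero]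
      positivity
  have hFb : ∀ k ≤ N, ∀ v : Fin N → ℂ, (∀ i, ‖v i‖ ≤ r i) →
      (1 ≤ k ∨ α v ≤ c₂) → ‖MvPolynomial.eval (rpt v) (F k)‖ ≤ (D + 1) * η := by
    intro k hk v hv hor
    rw [hFev, norm_mul, Complex.norm_real, Real.norm_eq_abs]
    have h1 := hsmall k hk v hv
    have h2 := hbig k hk v hv hor
    have h3 : |(Polynomial.derivative^[k] q).eval (α v)| ≤ |iteratedDeriv k χ (α v)|
        + |iteratedDeriv k χ (α v) - (Polynomial.derivative^[k] q).eval (α v)| := by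
      have := abs_sub_abs_le_abs_sub ((Polynomial.derivative^[k] q).eval (α v)) (iteratedDeriv k χ (α v))
      rw [abs_sub_comm] at this
      linarith
    have h4 := mul_le_mul_of_nonneg_left h3 (norm_nonneg (MvPolynomial.eval v p))
    rw [mul_add] at h4
    linarith
  obtain ⟨G, -, hG2, hG3⟩ := cproj_iterate r hr b B hB0 hB F hFd ((D + 1) * η) (by positivity)
    Finset.univ 0 (fun k h1 h2 v hv => hFb k (by simpa using h2) v hv (Or.inl h1))
  obtain ⟨p', hp'⟩ := exists_holo (G 0) (hG2 0)
  have hdiff : ∀ v : Fin N → ℂ, (∀ i, ‖v i‖ ≤ r i) →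
      ‖MvPolynomial.eval v p' - MvPolynomial.eval (rpt v) (F 0)‖ ≤ ((1 + B) ^ N - 1) * ((D + 1) * η) := by
    intro v hv
    have := hG3 0 le_rfl v hv
    rw [hp'] at this
    simpa using this
  have hfin : ((1 + B) ^ N - 1) * ((D + 1) * η) + (D + 2) * η ≤ (1 + B) ^ N * (D + 2) * η := by
    nlinarith [mul_nonneg (sub_nonneg.2 hBN) hη.le]
  refine ⟨p', fun v hv hα => ?_, fun v hv hα => ?_⟩
  · have h1 := hdiff v hv
    have h2 := hFb 0 (Nat.zero_le _) v hv (Or.inr hα)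
    have h3 := norm_sub_norm_le (MvPolynomial.eval v p') (MvPolynomial.eval (rpt v) (F 0))
    linarith
  · have h1 := hdiff v hv
    have h2 : ‖MvPolynomial.eval v p - MvPolynomial.eval (rpt v) (F 0)‖ ≤ (D + 2) * η := by
      have e : MvPolynomial.eval v p - MvPolynomial.eval (rpt v) (F 0)
          = MvPolynomial.eval v p * (((1 - q.eval (α v)) : ℝ) : ℂ) := by
        rw [hFev]; simp; ring
      rw [e, norm_mul, Complex.norm_real, Real.norm_eq_abs]
      have e1 := hsmall 0 (Nat.zero_le _) v hv
      simp only [iteratedDeriv_zero, Function.iterate_zero, id] at e1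
      have e2 : ‖MvPolynomial.eval v p‖ * |1 - χ (α v)| ≤ (D + 1) * η := by
        by_cases h : c₂ ≤ α v
        · rw [hχ1 _ h]; simp; positivity
        · push Not at h
          have e3 := hχD 0 (Nat.zero_le _) (α v) ⟨hα, h.le⟩
          rw [iteratedDeriv_zero] at e3
          have e4 : |1 - χ (α v)| ≤ D + 1 := by
            have := abs_sub (1 : ℝ) (χ (α v))
            simp at this
            linarith
          rw [mul_comm]
          exact mul_le_mul e4 (hp v hv hα h.le) (norm_nonneg _) (by positivity)
      have e5 : |1 - q.eval (α v)| ≤ |1 - χ (α v)| + |χ (α v) - q.eval (α v)| :=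
        abs_sub_le _ _ _
      have e6 := mul_le_mul_of_nonneg_left e5 (norm_nonneg (MvPolynomial.eval v p))
      rw [mul_add] at e6
      linarith
    have h3 := norm_sub_le_norm_sub_add_norm_sub (MvPolynomial.eval v p)
      (MvPolynomial.eval (rpt v) (F 0)) (MvPolynomial.eval v p')
    rw [norm_sub_rev (MvPolynomial.eval (rpt v) (F 0))] at h3
    linarith

/-! ### Assembling the result -/

/-- Restriction of polynomials to `X` as an additive homomorphism. -/
noncomputable def polyHom {ι : Type*} [Fintype ι] (X : Set (ι → ℂ)) :
    MvPolynomial ι ℂ →+ C(X, ℂ) where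
  toFun p := ⟨fun z => MvPolynomial.eval (z : ι → ℂ) p,
      (MvPolynomial.continuous_eval p).comp continuous_subtype_val⟩
  map_zero' := by ext; simp
  map_add' p q := by ext; simp

theorem mem_BXset_iff {ι : Type*} [Fintype ι] (X : Set (ι → ℂ)) [CompactSpace X] (f : C(X, ℂ)) :
    f ∈ BXset X ↔ f ∈ (polyHom X).range.topologicalClosure := Iff.rfl

theorem decomposition_of_estimate {ι : Type*} [Fintype ι] (X Y : Set (ι → ℂ))
    (hX : IsCompact X) (hY : IsCompact Y) (C : ℝ) (hC : 0 < C)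
    (key : ∀ (p : MvPolynomial ι ℂ) (η : ℝ), 0 < η →
      (∀ v ∈ X ∩ Y, ‖MvPolynomial.eval v p‖ ≤ η) →
      ∃ p' : MvPolynomial ι ℂ, (∀ v ∈ X, ‖MvPolynomial.eval v p'‖ ≤ C * η) ∧
        (∀ v ∈ Y, ‖MvPolynomial.eval v p - MvPolynomial.eval v p'‖ ≤ C * η))
    (f : C(↥(X ∩ Y), ℂ)) (hf : f ∈ BXset (X ∩ Y)) :
    ∃ f' ∈ BXset X, ∃ f'' ∈ BXset Y, ∀ (v : ι → ℂ) (hv : v ∈ X ∩ Y),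
        f ⟨v, hv⟩ = f' ⟨v, hv.1⟩ + f'' ⟨v, hv.2⟩ := by
  have : CompactSpace X := isCompact_iff_compactSpace.1 hX
  have : CompactSpace Y := isCompact_iff_compactSpace.1 hY
  have : CompactSpace ↥(X ∩ Y) := isCompact_iff_compactSpace.1 (hX.inter_right hY.isClosed)
  let iX : C(↥(X ∩ Y), X) := ⟨fun z => ⟨z.1, z.2.1⟩, by fun_prop⟩
  let iY : C(↥(X ∩ Y), Y) := ⟨fun z => ⟨z.1, z.2.2⟩, by fun_prop⟩
  let AX := (polyHom X).range.topologicalClosure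
  let AY := (polyHom Y).range.topologicalClosure
  have : CompleteSpace AX := (AddSubgroup.isClosed_topologicalClosure _).completeSpace_coe
  have : CompleteSpace AY := (AddSubgroup.isClosed_topologicalClosure _).completeSpace_coe
  let T0 : (AX × AY) →+ C(↥(X ∩ Y), ℂ) :=
    { toFun := fun g => (g.1 : C(X, ℂ)).comp iX + (g.2 : C(Y, ℂ)).comp iY
      map_zero' := by ext; simp
      map_add' := fun g h => by ext; simp; ring }
  have hT0 : ∀ g, ‖T0 g‖ ≤ 2 * ‖g‖ := by
    intro g
    rw [ContinuousMap.norm_le _ (by positivity)]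
    intro z
    have h1 : ‖(g.1 : C(X, ℂ)) (iX z)‖ ≤ ‖g‖ :=
      (ContinuousMap.norm_coe_le_norm _ _).trans (norm_fst_le g)
    have h2 : ‖(g.2 : C(Y, ℂ)) (iY z)‖ ≤ ‖g‖ :=
      (ContinuousMap.norm_coe_le_norm _ _).trans (norm_snd_le g)
    calc ‖T0 g z‖ ≤ ‖(g.1 : C(X, ℂ)) (iX z)‖ + ‖(g.2 : C(Y, ℂ)) (iY z)‖ := norm_add_le _ _
      _ ≤ 2 * ‖g‖ := by linarith
  let T : NormedAddGroupHom (AX × AY) C(↥(X ∩ Y), ℂ) := T0.mkNormedAddGroupHom 2 hT0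
  have hsurj : T.SurjectiveOnWith (polyHom (X ∩ Y)).range C := by
    rintro _ ⟨p, rfl⟩
    by_cases h0 : polyHom (X ∩ Y) p = 0
    · exact ⟨0, by rw [h0, map_zero], by rw [norm_zero]; positivity⟩
    · obtain ⟨p', hp1, hp2⟩ := key p ‖polyHom (X ∩ Y) p‖ (norm_pos_iff.2 h0) (fun v hv =>
        ContinuousMap.norm_coe_le_norm (polyHom (X ∩ Y) p) ⟨v, hv⟩)
      refine ⟨(⟨polyHom X p', AddSubgroup.le_topologicalClosure _ ⟨p', rfl⟩⟩,
        ⟨polyHom Y (p - p'), AddSubgroup.le_topologicalClosure _ ⟨p - p', rfl⟩⟩), ?_, ?_⟩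
      · ext z
        change MvPolynomial.eval (z : ι → ℂ) p' + MvPolynomial.eval (z : ι → ℂ) (p - p')
          = MvPolynomial.eval (z : ι → ℂ) p
        simp
      · rw [Prod.norm_def]
        refine max_le ?_ ?_
        · change ‖polyHom X p'‖ ≤ _
          rw [ContinuousMap.norm_le _ (by positivity)]
          exact fun z => hp1 z z.2
        · change ‖polyHom Y (p - p')‖ ≤ _
          rw [ContinuousMap.norm_le _ (by positivity)]
          intro z
          have := hp2 z z.2
          rw [← map_sub] at this
          exact this
  obtain ⟨g, hg, -⟩ := controlled_closure_of_complete hC one_pos hsurj f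
    ((mem_BXset_iff _ f).1 hf)
  refine ⟨g.1, (mem_BXset_iff _ _).2 g.1.2, g.2, (mem_BXset_iff _ _).2 g.2.2, fun v hv => ?_⟩
  rw [← hg]
  rfl

/-- **Additive decomposition over a sliced polydisk.** Let `W ⊆ ℂᴺ` be a closed
polydisk, `α` an `ℝ`-linear functional, `c₁ < c₂`, and
`W′ = {v ∈ W : α v ≤ c₂}`, `W″ = {v ∈ W : α v ≥ c₁}`. Then every `f ∈ B(W′ ∩ W″)` is a
sum of restrictions of elements `f′ ∈ B(W′)` and `f″ ∈ B(W″)`. -/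
theorem BX_decomposition_of_polydisk_slices
    (N : ℕ) (hN : 1 ≤ N) (r : Fin N → ℝ) (hr : ∀ i, 0 < r i)
    (α : (Fin N → ℂ) →ₗ[ℝ] ℝ) (c₁ c₂ : ℝ) (hc : c₁ < c₂)
    (W W' W'' : Set (Fin N → ℂ))
    (hW : W = {v | ∀ i, ‖v i‖ ≤ r i})
    (hW' : W' = {v ∈ W | α v ≤ c₂})
    (hW'' : W'' = {v ∈ W | c₁ ≤ α v})
    (f : C(↥(W' ∩ W''), ℂ)) (hf : f ∈ BXset (W' ∩ W'')) :
    ∃ f' ∈ BXset W', ∃ f'' ∈ BXset W'',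
      ∀ (v : Fin N → ℂ) (hv : v ∈ W' ∩ W''),
        f ⟨v, hv⟩ = f' ⟨v, hv.1⟩ + f'' ⟨v, hv.2⟩ := by
  have hWc : IsCompact W := by
    have : W = Set.univ.pi fun i => Metric.closedBall (0 : ℂ) (r i) := by
      rw [hW]; ext v; simp [Set.mem_pi]
    rw [this]
    exact isCompact_univ_pi fun i => isCompact_closedBall _ _
  have hαc : Continuous α := α.continuous_of_finiteDimensional
  have hX : IsCompact W' := by
    rw [hW']
    exact hWc.inter_right (isClosed_le hαc continuous_const)
  have hY : IsCompact W'' := by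
    rw [hW'']
    exact hWc.inter_right (isClosed_le continuous_const hαc)
  obtain ⟨C, hC, key⟩ := key_estimate r hr α c₁ c₂ hc
  refine decomposition_of_estimate W' W'' hX hY C hC ?_ f hf
  intro p η hη hp
  subst hW hW' hW''
  obtain ⟨p', h1, h2⟩ := key p η hη (fun v hv ha hb => hp v ⟨⟨hv, hb⟩, ⟨hv, ha⟩⟩)
  exact ⟨p', fun v hv => h1 v hv.1 hv.2, fun v hv => h2 v hv.1 hv.2⟩
end

section
/- Let N ≥ 1, let r₁,…,r_N > 0, and let W = {v ∈ ℂᴺ : |vᵢ| ≤ rᵢ for all i} be the corresponding closed polydisk. Let α : ℂᴺ → ℝ be an ℝ-linear functional, let c₁ < c₂ be real numbers, and set W′ = {v ∈ W : α(v) ≤ c₂} and W″ = {v ∈ W : α(v) ≥ c₁}. Then there is a constant C > 0 such that for every function f that is holomorphic on an open neighborhood of W′ ∩ W″ there exist f′ ∈ B(W′) and f″ ∈ B(W″) with f(v) = f′(v) + f″(v) for all v ∈ W′ ∩ W″, and with ‖f′‖_{W′} ≤ C·‖f‖_{W′∩W″} and ‖f″‖_{W″} ≤ C·‖f‖_{W′∩W″},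 where ‖·‖_K denotes the supremum of the absolute value over K. -/
section Aux
open MeasureTheory Filter Topology Metric Set Function
set_option linter.unusedSectionVars false


theorem PI_differentiableAt {T : Type*} [MeasurableSpace T] {μ : Measure T} {F : ℂ → T → ℂ}
    {z0 : ℂ} {ρ : ℝ} (hρ : 0 < ρ) {b : T → ℝ} (hb : Integrable b μ)
    (hm : ∀ z ∈ ball z0 ρ, AEStronglyMeasurable (F z) μ)
    (hd : ∀ᵐ w ∂μ, DifferentiableOn ℂ (fun z => F z w) (ball z0 ρ))
    (hbd : ∀ᵐ w ∂μ, ∀ z ∈ ball z0 ρ, ‖F z w‖ ≤ b w) :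
    DifferentiableAt ℂ (fun z => ∫ w, F z w ∂μ) z0 := by
  have hz0 : z0 ∈ ball z0 ρ := mem_ball_self hρ
  have hdiff : ∀ᵐ w ∂μ, ∀ z ∈ ball z0 (ρ/2),
      HasDerivAt (fun z => F z w) (deriv (fun z => F z w) z) z := by
    filter_upwards [hd] with w hw z hz
    have : z ∈ ball z0 ρ := ball_subset_ball (by linarith) hz
    exact (hw.differentiableAt (isOpen_ball.mem_nhds this)).hasDerivAt
  have := hasDerivAt_integral_of_dominated_loc_of_deriv_le (μ := μ) (F := F) (x₀ := z0)
    (s := ball z0 (ρ/2)) (F' := fun z w => deriv (fun z => F z w) z)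
    (bound := fun w => b w / (ρ/4)) (ball_mem_nhds _ (by linarith))
    (by filter_upwards [ball_mem_nhds z0 hρ] with z hz using hm z hz)
    (hb.mono' (hm z0 hz0) (by filter_upwards [hbd] with w hw using hw z0 hz0))
    ?_ ?_ (hb.div_const _) hdiff
  · exact this.2.differentiableAt
  · let u : ℕ → ℂ := fun n => ((ρ / (n + 2 : ℝ) : ℝ) : ℂ)
    have hu : Tendsto u atTop (𝓝[≠] 0) := by
      refine tendsto_nhdsWithin_iff.2 ⟨?_, ?_⟩
      · have : Tendsto (fun n : ℕ => ρ / (n + 2 : ℝ)) atTop (𝓝 0) :=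
          tendsto_const_nhds.div_atTop
            (tendsto_atTop_add_const_right _ _ tendsto_natCast_atTop_atTop)
        have h2 := (Complex.continuous_ofReal.tendsto 0).comp this
        simpa [u, Function.comp_def] using h2
      · filter_upwards with n
        have : ρ / (n + 2 : ℝ) ≠ 0 := by positivity
        exact Complex.ofReal_ne_zero.2 this
    have humem : ∀ n, z0 + u n ∈ ball z0 ρ := by
      intro n
      simp only [u, mem_ball, dist_self_add_left, Complex.norm_real, Real.norm_eq_abs]
      rw [abs_of_pos (by positivity), div_lt_iff₀ (by positivity)]
      nlinarith [(Nat.cast_nonneg n : (0:ℝ) ≤ n)]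
    refine aestronglyMeasurable_of_tendsto_ae (u := atTop)
      (f := fun n w => (u n)⁻¹ • (F (z0 + u n) w - F z0 w)) ?_ ?_
    · intro n
      exact ((hm _ (humem n)).sub (hm _ hz0)).const_smul ((u n)⁻¹)
    · filter_upwards [hdiff] with w hw
      have := (hw z0 (mem_ball_self (by linarith))).tendsto_slope_zero
      exact this.comp hu
  · filter_upwards [hd, hbd] with w hw hw2 z hz
    have hsub : closedBall z (ρ/4) ⊆ ball z0 ρ := by
      intro y hy
      rw [mem_ball] at hz ⊢
      rw [mem_closedBall] at hy
      linarith [dist_triangle y z z0]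
    refine Complex.norm_deriv_le_of_forall_mem_sphere_norm_le (by linarith) ?_ ?_
    · refine DifferentiableOn.diffContOnCl (hw.mono ?_)
      exact closure_ball_subset_closedBall.trans hsub
    · intro y hy
      exact hw2 y (hsub (sphere_subset_closedBall hy))

/-- point of the plane -/
noncomputable def wpt (p : ℝ × ℝ) : ℂ := (p.1 : ℂ) + p.2 * Complex.I

theorem wpt_continuous : Continuous wpt := by unfold wpt; fun_prop

theorem wpt_inj (p : ℝ × ℝ) (z : ℂ) : wpt p = z ↔ p = (z.re, z.im) := by
  constructor
  · rintro rfl; ext <;> simp [wpt]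
  · rintro rfl; simp [wpt]

theorem wpt_re (p : ℝ × ℝ) : (wpt p).re = p.1 := by simp [wpt]
theorem wpt_im (p : ℝ × ℝ) : (wpt p).im = p.2 := by simp [wpt]

/-- measure on the rectangle -/
noncomputable def rectM (s t Y : ℝ) : Measure (ℝ × ℝ) :=
  (volume.restrict (Ioo s t)).prod (volume.restrict (Ioo (-Y) Y))

theorem rectM_eq (s t Y : ℝ) : rectM s t Y = volume.restrict (Ioo s t ×ˢ Ioo (-Y) Y) := by
  rw [rectM, Measure.prod_restrict]; rfl

instance (s t Y : ℝ) : IsFiniteMeasure (rectM s t Y) := by unfold rectM; infer_instance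

theorem rectM_ne (s t Y : ℝ) (z : ℂ) : ∀ᵐ p ∂rectM s t Y, wpt p ≠ z := by
  rw [rectM_eq]
  refine ae_restrict_of_ae ?_
  simp only [ne_eq, wpt_inj]
  have : (volume : Measure (ℝ × ℝ)) {(z.re, z.im)} = 0 := measure_singleton _
  exact measure_eq_zero_iff_ae_notMem.1 this

theorem rectM_mem (s t Y : ℝ) : ∀ᵐ p ∂rectM s t Y, p ∈ Ioo s t ×ˢ Ioo (-Y) Y := by
  rw [rectM_eq]
  exact ae_restrict_mem (measurableSet_Ioo.prod measurableSet_Ioo)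

/-- the one dimensional kernel -/
noncomputable def k1 (x : ℝ) : ℝ := indicator (Icc (-1) 1) (fun x => |x| ^ (-(1/2) : ℝ)) x

theorem k1_integrable : Integrable k1 := by
  unfold k1
  rw [integrable_indicator_iff measurableSet_Icc]
  have h : IntegrableOn (fun x : ℝ => x ^ (-(1/2) : ℝ)) (Ioc 0 1) :=
    (intervalIntegral.intervalIntegrable_rpow' (by norm_num : (-1:ℝ) < -(1/2))).1
  have h0 : IntegrableOn (fun x : ℝ => |x| ^ (-(1/2) : ℝ)) (Ioc 0 1) :=
    h.congr_fun (fun x hx => by simp [abs_of_pos hx.1]) measurableSet_Ioc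
  have h1 : IntegrableOn (fun x : ℝ => |x| ^ (-(1/2) : ℝ)) (Icc 0 1) :=
    (integrableOn_Icc_iff_integrableOn_Ioc (by simp)).2 h0
  have h2 : IntegrableOn (fun x : ℝ => |x| ^ (-(1/2) : ℝ)) (Icc (-1) 0) := by
    have := h1.comp_neg
    simpa using this
  have := h2.union h1
  rwa [Icc_union_Icc_eq_Icc (by norm_num) (by norm_num)] at this

theorem k1_nonneg (x : ℝ) : 0 ≤ k1 x := indicator_nonneg (fun x _ => by positivity) x

theorem k1_bound (x : ℝ) : |x| ^ (-(1/2) : ℝ) ≤ k1 x + 1 := by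
  by_cases hx : x ∈ Icc (-1:ℝ) 1
  · simp [k1, hx]
  · have : 1 ≤ |x| := by
      by_contra hlt
      push Not at hlt
      exact hx ⟨(abs_le.1 hlt.le).1, (abs_le.1 hlt.le).2⟩
    simp only [k1, hx, not_false_eq_true, indicator_of_notMem, zero_add]
    exact Real.rpow_le_one_of_one_le_of_nonpos this (by norm_num)

theorem inv_norm_le (p : ℝ × ℝ) (z : ℂ) (h1 : p.1 ≠ z.re) (h2 : p.2 ≠ z.im) :
    ‖wpt p - z‖⁻¹ ≤ (k1 (p.1 - z.re) + 1) * (k1 (p.2 - z.im) + 1) := by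
  set x := p.1 - z.re
  set y := p.2 - z.im
  have hx0 : 0 < |x| := abs_pos.2 (sub_ne_zero.2 h1)
  have hy0 : 0 < |y| := abs_pos.2 (sub_ne_zero.2 h2)
  have hx : (wpt p - z).re = x := by simp [wpt, x]
  have hy : (wpt p - z).im = y := by simp [wpt, y]
  have hnx : |x| ≤ ‖wpt p - z‖ := hx ▸ Complex.abs_re_le_norm _
  have hny : |y| ≤ ‖wpt p - z‖ := hy ▸ Complex.abs_im_le_norm _
  have hpos : 0 < ‖wpt p - z‖ := hx0.trans_le hnx
  have e : ‖wpt p - z‖⁻¹ = ‖wpt p - z‖ ^ (-(1/2) : ℝ) * ‖wpt p - z‖ ^ (-(1/2) : ℝ) := by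
    rw [← Real.rpow_add hpos, ← Real.rpow_neg_one]; norm_num
  rw [e]
  have a1 := (Real.rpow_le_rpow_of_nonpos hx0 hnx (by norm_num : (-(1/2) : ℝ) ≤ 0)).trans
    (k1_bound x)
  have a2 := (Real.rpow_le_rpow_of_nonpos hy0 hny (by norm_num : (-(1/2) : ℝ) ≤ 0)).trans
    (k1_bound y)
  exact mul_le_mul a1 a2 (by positivity) (by linarith [k1_nonneg x])

theorem inv_norm_le_ae (s t Y : ℝ) (z : ℂ) : ∀ᵐ p ∂rectM s t Y,
    ‖wpt p - z‖⁻¹ ≤ (k1 (p.1 - z.re) + 1) * (k1 (p.2 - z.im) + 1) := by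
  have a1 : ∀ᵐ p ∂rectM s t Y, p.1 ≠ z.re := by
    have : ∀ᵐ x ∂(volume.restrict (Ioo s t)), x ≠ z.re := by
      exact measure_eq_zero_iff_ae_notMem.1 (measure_singleton _)
    exact Measure.quasiMeasurePreserving_fst.ae this
  have a2 : ∀ᵐ p ∂rectM s t Y, p.2 ≠ z.im := by
    have : ∀ᵐ x ∂(volume.restrict (Ioo (-Y) Y)), x ≠ z.im := by
      exact measure_eq_zero_iff_ae_notMem.1 (measure_singleton _)
    exact Measure.quasiMeasurePreserving_snd.ae this
  filter_upwards [a1, a2] with p h1 h2 using inv_norm_le p z h1 h2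

theorem k1_shift_int (s t x : ℝ) :
    Integrable (fun τ => k1 (τ - x) + 1) (volume.restrict (Ioo s t)) :=
  (k1_integrable.comp_sub_right x).integrableOn.add (integrable_const _)

theorem k1_shift_le (s t x : ℝ) (h : s ≤ t) :
    ∫ τ in Ioo s t, (k1 (τ - x) + 1) ≤ (∫ τ, k1 τ) + (t - s) := by
  rw [integral_add (k1_integrable.comp_sub_right x).integrableOn (integrable_const _)]
  refine add_le_add ?_ ?_
  · refine (setIntegral_le_integral (k1_integrable.comp_sub_right x)
      (ae_of_all _ fun τ => k1_nonneg _)).trans ?_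
    rw [integral_sub_right_eq_self]
  · simp [h]

theorem kern_int (s t Y : ℝ) (z : ℂ) : Integrable (fun p => ‖wpt p - z‖⁻¹) (rectM s t Y) := by
  refine ((k1_shift_int s t z.re).mul_prod (k1_shift_int (-Y) Y z.im)).mono' ?_ ?_
  · exact (((wpt_continuous.sub continuous_const).norm.measurable).inv).aestronglyMeasurable
  · filter_upwards [inv_norm_le_ae s t Y z] with p hp
    simpa using hp

theorem kern_bound (s t Y : ℝ) (hst : s ≤ t) (hY : 0 ≤ Y) (z : ℂ) :
    ∫ p, ‖wpt p - z‖⁻¹ ∂(rectM s t Y) ≤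
      ((∫ τ, k1 τ) + (t - s)) * ((∫ τ, k1 τ) + (Y - -Y)) := by
  refine (integral_mono_ae (kern_int s t Y z)
    ((k1_shift_int s t z.re).mul_prod (k1_shift_int (-Y) Y z.im)) (inv_norm_le_ae s t Y z)).trans ?_
  rw [rectM, integral_prod_mul (fun x => k1 (x - z.re) + 1) (fun x => k1 (x - z.im) + 1)]
  have : 0 ≤ ∫ τ, k1 τ := integral_nonneg fun x => k1_nonneg x
  refine mul_le_mul (k1_shift_le _ _ _ hst) (k1_shift_le _ _ _ (by linarith)) ?_ (by linarith)
  exact integral_nonneg fun x => by have := k1_nonneg (x - z.im); simp; linarith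


/-- logarithm difference -/
noncomputable def Lg (Y τ : ℝ) (z : ℂ) : ℂ :=
  Complex.log (τ + Y * Complex.I - z) - Complex.log (τ + (-Y : ℝ) * Complex.I - z)

theorem line_int (Y τ : ℝ) (z : ℂ) (hY : 0 < Y) (hz : |z.im| < Y) (hτ : τ ≠ z.re) :
    ∫ y in Ioo (-Y) Y, (wpt (τ, y) - z)⁻¹ =
      -Complex.I * Lg Y τ z - 2 * Real.pi * (if τ < z.re then 1 else 0) := by
  have hle : -Y ≤ Y := by linarith
  rw [← integral_Ioc_eq_integral_Ioo, ← intervalIntegral.integral_of_le hle]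
  have hne : ∀ y : ℝ, wpt (τ, y) - z ≠ 0 := by
    intro y h
    have := congrArg Complex.re h
    simp [wpt] at this
    exact hτ (by linarith)
  have hcont : Continuous fun y : ℝ => (wpt (τ, y) - z)⁻¹ :=
    ((wpt_continuous.comp (by fun_prop : Continuous fun y : ℝ => (τ, y))).sub
      continuous_const).inv₀ hne
  obtain ⟨hz1, hz2⟩ := abs_lt.1 hz
  rcases lt_or_gt_of_ne hτ with h | h
  · have hd : ∀ y : ℝ, HasDerivAt (fun y : ℝ => -Complex.I * Complex.log (-(wpt (τ, y) - z)))
        ((wpt (τ, y) - z)⁻¹) y := by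
      intro y
      have h1 : HasDerivAt (fun y : ℝ => -(wpt (τ, y) - z)) (-Complex.I) y := by
        have : HasDerivAt (fun y : ℝ => (y : ℂ)) 1 y := Complex.ofRealCLM.hasDerivAt
        have := (((this.mul_const Complex.I).const_add (τ : ℂ)).sub_const z).neg
        exact this.congr_deriv (by simp)
      have h2 := (h1.clog_real (Or.inl (by simp [wpt]; exact h))).const_mul (-Complex.I)
      refine h2.congr_deriv ?_
      rw [mul_div_assoc', neg_mul_neg, Complex.I_mul_I, neg_div_neg_eq, one_div]
    rw [intervalIntegral.integral_eq_sub_of_hasDerivAt (fun y _ => hd y)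
      (hcont.intervalIntegrable _ _)]
    rw [if_pos h]
    have e1 : Complex.log (-(wpt (τ, Y) - z)) =
        Complex.log (τ + Y * Complex.I - z) - Real.pi * Complex.I := by
      have : 0 < (wpt (τ, Y) - z).im := by simp [wpt]; linarith
      simp only [Complex.log, norm_neg, Complex.arg_neg_eq_arg_sub_pi_of_im_pos this]
      simp only [wpt]
      push_cast
      ring
    have e2 : Complex.log (-(wpt (τ, -Y) - z)) =
        Complex.log (τ + (-Y : ℝ) * Complex.I - z) + Real.pi * Complex.I := by
      have : (wpt (τ, -Y) - z).im < 0 := by simp [wpt]; linarith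
      simp only [Complex.log, norm_neg, Complex.arg_neg_eq_arg_add_pi_of_im_neg this]
      simp only [wpt]
      push_cast
      ring
    rw [e1, e2, Lg]
    linear_combination (2 * Real.pi : ℂ) * Complex.I_sq
  · have hd : ∀ y : ℝ, HasDerivAt (fun y : ℝ => -Complex.I * Complex.log (wpt (τ, y) - z))
        ((wpt (τ, y) - z)⁻¹) y := by
      intro y
      have h1 : HasDerivAt (fun y : ℝ => (wpt (τ, y) - z)) (Complex.I) y := by
        have : HasDerivAt (fun y : ℝ => (y : ℂ)) 1 y := Complex.ofRealCLM.hasDerivAt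
        have := (((this.mul_const Complex.I).const_add (τ : ℂ)).sub_const z)
        simpa [wpt] using this
      have h2 := (h1.clog_real (Or.inl (by simp [wpt]; exact h))).const_mul (-Complex.I)
      refine h2.congr_deriv ?_
      rw [mul_div_assoc', neg_mul, Complex.I_mul_I, neg_neg, one_div]
    rw [intervalIntegral.integral_eq_sub_of_hasDerivAt (fun y _ => hd y)
      (hcont.intervalIntegrable _ _)]
    rw [if_neg (not_lt.2 h.le), Lg]
    simp only [wpt]
    ring

theorem log_bound (ζ : ℂ) (a b : ℝ) (ha : 0 < a) (h1 : a ≤ ‖ζ‖) (h2 : ‖ζ‖ ≤ b) :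
    ‖Complex.log ζ‖ ≤ b + a⁻¹ + Real.pi := by
  have hp : 0 < ‖ζ‖ := ha.trans_le h1
  have k : ‖Complex.log ζ‖ ≤ |Real.log ‖ζ‖| + |Complex.arg ζ| := by
    have := Complex.norm_le_abs_re_add_abs_im (Complex.log ζ)
    rwa [Complex.log_re, Complex.log_im] at this
  have k2 := Complex.abs_arg_le_pi ζ
  have k3 : |Real.log ‖ζ‖| ≤ b + a⁻¹ := by
    have q1 := Real.log_le_sub_one_of_pos hp
    have q2 := Real.log_le_sub_one_of_pos (inv_pos.2 hp)
    rw [Real.log_inv] at q2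
    have q3 : ‖ζ‖⁻¹ ≤ a⁻¹ := inv_anti₀ ha h1
    have := inv_pos.2 ha
    rw [abs_le]; constructor <;> linarith
  linarith

theorem Lg_facts (s t Y : ℝ) (z0 : ℂ) (hY : 0 < Y) (hz : |z0.im| < Y) :
    ∃ ρ > 0, ∃ B : ℝ, (∀ z ∈ ball z0 ρ, AEStronglyMeasurable (fun τ => Lg Y τ z)
        (volume.restrict (Ioo s t)))
      ∧ (∀ τ ∈ Ioo s t, DifferentiableOn ℂ (fun z => Lg Y τ z) (ball z0 ρ))
      ∧ (∀ τ ∈ Ioo s t, ∀ z ∈ ball z0 ρ, ‖Lg Y τ z‖ ≤ B) := by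
  set ρ := (Y - |z0.im|) / 2 with hρ
  have hρ0 : 0 < ρ := by linarith
  have him : ∀ z ∈ ball z0 ρ, |z.im| < Y - ρ := by
    intro z hz'
    have : |z.im - z0.im| < ρ := by
      have h1 := Complex.abs_im_le_norm (z - z0)
      rw [mem_ball, dist_eq_norm] at hz'
      simpa using h1.trans_lt hz'
    have h2 : |z.im| ≤ |z.im - z0.im| + |z0.im| := by
      have := abs_add_le (z.im - z0.im) z0.im; simpa using this
    linarith
  have sp : ∀ z ∈ ball z0 ρ, ∀ τ : ℝ, ∀ Y' : ℝ, |Y'| = Y →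
      ρ ≤ |(τ + Y' * Complex.I - z).im| := by
    intro z hz' τ Y' hY'
    have := him z hz'
    simp
    have := abs_sub_abs_le_abs_sub Y' z.im
    linarith
  have hYY : |(-Y)| = Y := by rw [abs_neg, abs_of_pos hY]
  have hslit : ∀ z ∈ ball z0 ρ, ∀ τ : ℝ, ∀ Y' : ℝ, |Y'| = Y →
      (τ + Y' * Complex.I - z) ∈ Complex.slitPlane := by
    intro z hz' τ Y' hY'
    refine Or.inr fun h0 => ?_
    have := sp z hz' τ Y' hY'
    rw [h0] at this; simp at this; linarith
  set b := |s| + |t| + Y + (‖z0‖ + ρ) with hb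
  have bd : ∀ z ∈ ball z0 ρ, ∀ τ ∈ Ioo s t, ∀ Y' : ℝ, |Y'| = Y →
      ‖Complex.log (τ + Y' * Complex.I - z)‖ ≤ b + ρ⁻¹ + Real.pi := by
    intro z hz' τ hτ Y' hY'
    refine log_bound _ _ _ hρ0 ((sp z hz' τ Y' hY').trans (Complex.abs_im_le_norm _)) ?_
    have h1 : ‖(τ : ℂ) + Y' * Complex.I - z‖ ≤ |τ| + |Y'| + ‖z‖ := by
      refine (norm_sub_le _ _).trans (add_le_add ((norm_add_le _ _).trans ?_) le_rfl)
      simp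
    have h2 : ‖z‖ ≤ ‖z0‖ + ρ := by
      rw [mem_ball, dist_eq_norm] at hz'
      have := norm_add_le z0 (z - z0)
      simp at this; linarith
    have h3 : |τ| ≤ |s| + |t| := by
      rw [abs_le]; constructor
      · linarith [neg_abs_le s, hτ.1, abs_nonneg t]
      · linarith [le_abs_self t, hτ.2, abs_nonneg s]
    rw [hY'] at h1; linarith
  refine ⟨ρ, hρ0, 2 * (b + ρ⁻¹ + Real.pi), ?_, ?_, ?_⟩
  · intro z hz'
    refine Continuous.aestronglyMeasurable ?_
    unfold Lg
    refine Continuous.sub ?_ ?_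
    · exact Continuous.clog (by fun_prop) fun τ => hslit z hz' τ Y (abs_of_pos hY)
    · exact Continuous.clog (by fun_prop) fun τ => hslit z hz' τ (-Y) hYY
  · intro τ hτ z hz'
    unfold Lg
    refine DifferentiableWithinAt.sub ?_ ?_
    · exact DifferentiableWithinAt.clog (by fun_prop) (hslit z hz' τ Y (abs_of_pos hY))
    · exact DifferentiableWithinAt.clog (by fun_prop) (hslit z hz' τ (-Y) hYY)
  · intro τ hτ z hz'
    refine (norm_sub_le _ _).trans ?_
    linarith [bd z hz' τ hτ Y (abs_of_pos hY), bd z hz' τ hτ (-Y) hYY]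

theorem intLg_diff (s t Y : ℝ) (z0 : ℂ) (hY : 0 < Y) (hz : |z0.im| < Y) :
    DifferentiableAt ℂ (fun z => ∫ τ in Ioo s t, Lg Y τ z) z0 := by
  obtain ⟨ρ, hρ, B, h1, h2, h3⟩ := Lg_facts s t Y z0 hY hz
  refine PI_differentiableAt hρ (b := fun _ => B) (integrable_const _) h1 ?_ ?_
  · exact (ae_restrict_iff' measurableSet_Ioo).2 (ae_of_all _ h2)
  · exact (ae_restrict_iff' measurableSet_Ioo).2 (ae_of_all _ h3)

/-- ramp -/
noncomputable def lam (s t x : ℝ) : ℝ := max 0 (min t x - s)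

theorem rect_int (s t Y : ℝ) (z : ℂ) (hY : 0 < Y) (hz : |z.im| < Y) :
    ∫ p, (wpt p - z)⁻¹ ∂rectM s t Y =
      -Complex.I * (∫ τ in Ioo s t, Lg Y τ z) - 2 * Real.pi * lam s t z.re := by
  have hInt : Integrable (fun p => (wpt p - z)⁻¹) (rectM s t Y) := by
    refine (kern_int s t Y z).mono' ?_ (ae_of_all _ fun p => by simp)
    exact (((wpt_continuous.sub continuous_const).measurable).inv).aestronglyMeasurable
  unfold rectM at hInt ⊢
  rw [integral_prod _ hInt]
  have : (fun x => ∫ y in Ioo (-Y) Y, (wpt (x, y) - z)⁻¹) =ᵐ[volume.restrict (Ioo s t)]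
      fun τ => -Complex.I * Lg Y τ z - (Iio z.re).indicator (fun _ => (2 * Real.pi : ℂ)) τ := by
    have : ∀ᵐ x ∂(volume.restrict (Ioo s t)), x ≠ z.re :=
      measure_eq_zero_iff_ae_notMem.1 (measure_singleton _)
    filter_upwards [this] with τ hτ
    rw [line_int Y τ z hY hz hτ]
    by_cases h : τ < z.re <;> simp [h]
  rw [integral_congr_ae this]
  obtain ⟨ρ, hρ, B, h1, h2, h3⟩ := Lg_facts s t Y z hY hz
  have hL : Integrable (fun τ => Lg Y τ z) (volume.restrict (Ioo s t)) := by
    refine (integrable_const B).mono' (h1 z (mem_ball_self hρ)) ?_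
    exact (ae_restrict_iff' measurableSet_Ioo).2
      (ae_of_all _ fun τ hτ => h3 τ hτ z (mem_ball_self hρ))
  rw [integral_sub (hL.const_mul _) ((integrable_const _).indicator measurableSet_Iio),
    integral_const_mul, integral_indicator measurableSet_Iio, Measure.restrict_restrict
    measurableSet_Iio, setIntegral_const]
  congr 1
  have : Iio z.re ∩ Ioo s t = Ioo s (min t z.re) := by
    ext x; simp; tauto
  rw [this, Real.volume_real_Ioo, lam, max_comm]
  simp
  ring


/-- vertical strip -/
def strip (s t : ℝ) : Set ℂ := {w | s < w.re ∧ w.re < t}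

theorem strip_open (s t : ℝ) : IsOpen (strip s t) :=
  (isOpen_lt continuous_const Complex.continuous_re).inter
    (isOpen_lt Complex.continuous_re continuous_const)

/-- truncated Cauchy transform -/
noncomputable def CT (s' t' Y : ℝ) (K : Set ℂ) (h : ℂ → ℂ) (z : ℂ) : ℂ :=
  ∫ p, K.indicator h (wpt p) * (wpt p - z)⁻¹ ∂rectM s' t' Y

section
variable {s s' t' t Y M : ℝ} {K : Set ℂ} {h : ℂ → ℂ}

theorem ind_meas (hs : s < s') (ht : t' < t) (hK : IsOpen K) (hc : ContinuousOn h (K ∩ strip s t)) :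
    AEStronglyMeasurable (fun p => K.indicator h (wpt p)) (rectM s' t' Y) := by
  rw [rectM_eq]
  have hm : MeasurableSet (wpt ⁻¹' K) := (hK.preimage wpt_continuous).measurableSet
  have : (fun p => K.indicator h (wpt p)) = (wpt ⁻¹' K).indicator (fun p => h (wpt p)) := by
    ext p; by_cases hp : wpt p ∈ K <;> simp [indicator, mem_preimage, hp]
  rw [this, aestronglyMeasurable_indicator_iff hm, Measure.restrict_restrict hm]
  refine ContinuousOn.aestronglyMeasurable ?_
    (hm.inter (measurableSet_Ioo.prod measurableSet_Ioo))
  refine hc.comp wpt_continuous.continuousOn ?_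
  rintro p ⟨hp, hp1, hp2⟩
  refine ⟨hp, ?_⟩
  simp only [strip, mem_ofPred_eq, wpt_re]
  exact ⟨hs.trans hp1.1, hp1.2.trans ht⟩

theorem ind_bound (hs : s < s') (ht : t' < t) (hM : 0 ≤ M)
    (hb : ∀ w ∈ K ∩ strip s t, ‖h w‖ ≤ M) :
    ∀ p ∈ Ioo s' t' ×ˢ Ioo (-Y) Y, ‖K.indicator h (wpt p)‖ ≤ M := by
  rintro p ⟨hp1, hp2⟩
  by_cases hp : wpt p ∈ K
  · rw [indicator_of_mem hp]
    refine hb _ ⟨hp, ?_⟩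
    simp only [strip, mem_ofPred_eq, wpt_re]
    exact ⟨hs.trans hp1.1, hp1.2.trans ht⟩
  · simp [hp, hM]

theorem ker_meas (z : ℂ) : AEStronglyMeasurable (fun p => (wpt p - z)⁻¹) (rectM s' t' Y) :=
  (((wpt_continuous.sub continuous_const).measurable).inv).aestronglyMeasurable

theorem CT_bound (hs : s < s') (ht : t' < t) (hst : s' ≤ t') (hY : 0 ≤ Y) (hM : 0 ≤ M)
    (hb : ∀ w ∈ K ∩ strip s t, ‖h w‖ ≤ M) (z : ℂ) :
    ‖CT s' t' Y K h z‖ ≤ M * (((∫ τ, k1 τ) + (t' - s')) * ((∫ τ, k1 τ) + (Y - -Y))) := by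
  refine (norm_integral_le_of_norm_le ((kern_int s' t' Y z).const_mul M) ?_).trans ?_
  · filter_upwards [rectM_mem s' t' Y] with p hp
    rw [norm_mul, norm_inv]
    exact mul_le_mul_of_nonneg_right (ind_bound hs ht hM hb p hp) (by positivity)
  · rw [integral_const_mul]
    exact mul_le_mul_of_nonneg_left (kern_bound s' t' Y hst hY z) hM

theorem CT_diff_off (hs : s < s') (ht : t' < t) (hM : 0 ≤ M) (hK : IsOpen K)
    (hc : ContinuousOn h (K ∩ strip s t))
    (hb : ∀ w ∈ K ∩ strip s t, ‖h w‖ ≤ M) (z : ℂ) (hz : z.re < s' ∨ t' < z.re) :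
    DifferentiableAt ℂ (CT s' t' Y K h) z := by
  obtain ⟨ρ, hρ, hsep⟩ : ∃ ρ > 0, ∀ y ∈ ball z ρ, ∀ p ∈ Ioo s' t' ×ˢ Ioo (-Y) Y,
      ρ ≤ ‖wpt p - y‖ := by
    have aux : ∀ y ρ, y ∈ ball z ρ → |y.re - z.re| < ρ := by
      intro y ρ hy
      rw [mem_ball, dist_eq_norm] at hy
      have := Complex.abs_re_le_norm (y - z)
      simp only [Complex.sub_re] at this; linarith
    have aux2 : ∀ y p, |p.1 - y.re| ≤ ‖wpt p - y‖ := by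
      intro y p
      have := Complex.abs_re_le_norm (wpt p - y)
      simpa [wpt_re] using this
    rcases hz with hz | hz
    · refine ⟨(s' - z.re)/2, by linarith, fun y hy p hp => ?_⟩
      have h1 := (abs_lt.1 (aux y _ hy)).2
      refine le_trans ?_ (aux2 y p)
      refine le_trans ?_ (le_abs_self _)
      linarith [hp.1.1]
    · refine ⟨(z.re - t')/2, by linarith, fun y hy p hp => ?_⟩
      have h1 := (abs_lt.1 (aux y _ hy)).1
      refine le_trans ?_ (aux2 y p)
      refine le_trans ?_ (neg_le_abs _)
      linarith [hp.1.2]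
  refine PI_differentiableAt hρ (b := fun _ => M * ρ⁻¹) (integrable_const _) ?_ ?_ ?_
  · intro y _
    exact (ind_meas hs ht hK hc).mul (ker_meas y)
  · filter_upwards [rectM_mem s' t' Y] with p hp y hy
    have : wpt p - y ≠ 0 := norm_pos_iff.1 (hρ.trans_le (hsep y hy p hp))
    refine DifferentiableWithinAt.const_mul ?_ _
    exact DifferentiableWithinAt.inv (by fun_prop) this
  · filter_upwards [rectM_mem s' t' Y] with p hp y hy
    rw [norm_mul, norm_inv]
    exact mul_le_mul (ind_bound hs ht hM hb p hp) (inv_anti₀ hρ (hsep y hy p hp))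
      (by positivity) hM

theorem CT_diff_on (hs : s < s') (ht : t' < t) (hM : 0 ≤ M) (hY : 0 < Y) (hK : IsOpen K)
    (hKY : ∀ w ∈ K, |w.im| < Y)
    (hd : DifferentiableOn ℂ h (K ∩ strip s t))
    (hb : ∀ w ∈ K ∩ strip s t, ‖h w‖ ≤ M) (z : ℂ) (hz : z ∈ K ∩ strip s t) :
    DifferentiableAt ℂ (fun z => CT s' t' Y K h z + 2 * Real.pi * lam s' t' z.re * h z) z := by
  classical
  have hO : IsOpen (K ∩ strip s t) := hK.inter (strip_open s t)
  obtain ⟨ρ2, hρ2, hball⟩ := Metric.isOpen_iff.1 hO z hz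
  set ρ := ρ2 / 3 with hρdef
  have hρ : 0 < ρ := by linarith
  set D : ℂ → ℝ × ℝ → ℂ := fun y p =>
    if wpt p ∈ K then dslope h (wpt p) y else - h y * (wpt p - y)⁻¹ with hD
  have hyK : ∀ y ∈ ball z ρ, y ∈ K ∩ strip s t := fun y hy =>
    hball (ball_subset_ball (by linarith) hy)
  have hmemK : ∀ p ∈ Ioo s' t' ×ˢ Ioo (-Y) Y, wpt p ∈ K → wpt p ∈ K ∩ strip s t := by
    rintro p ⟨hp1, hp2⟩ hp
    refine ⟨hp, ?_⟩
    simp only [strip, mem_ofPred_eq, wpt_re]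
    exact ⟨hs.trans hp1.1, hp1.2.trans ht⟩
  have hDval : ∀ y p, wpt p ≠ y → D y p = K.indicator h (wpt p) * (wpt p - y)⁻¹
      - h y * (wpt p - y)⁻¹ := by
    intro y p hpy
    have h0 : wpt p - y ≠ 0 := sub_ne_zero.2 hpy
    have h1 : y - wpt p ≠ 0 := sub_ne_zero.2 hpy.symm
    simp only [hD]
    split_ifs with hp
    · rw [indicator_of_mem hp, dslope_of_ne _ hpy.symm, slope_def_field]
      field_simp
      ring
    · rw [indicator_of_notMem hp]; ring
  have hDdiff : DifferentiableAt ℂ (fun y => ∫ p, D y p ∂rectM s' t' Y) z := by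
    refine PI_differentiableAt hρ (b := fun _ => (2 * M) / ρ) (integrable_const _) ?_ ?_ ?_
    · intro y hy
      refine AEStronglyMeasurable.congr (((ind_meas hs ht hK hd.continuousOn).mul
        (ker_meas y)).sub ((ker_meas y).const_mul (h y))) ?_
      filter_upwards [rectM_ne s' t' Y y] with p hp
      exact (hDval y p hp).symm
    · filter_upwards [rectM_mem s' t' Y] with p hp
      by_cases hpK : wpt p ∈ K
      · have : (fun y => D y p) = dslope h (wpt p) := by ext y; simp [hD, hpK]
        rw [this]
        exact ((Complex.differentiableOn_dslope (hO.mem_nhds (hmemK p hp hpK))).2 hd).mono hyK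
      · have : (fun y => D y p) = fun y => - h y * (wpt p - y)⁻¹ := by ext y; simp [hD, hpK]
        rw [this]
        intro y hy
        have h0 : wpt p - y ≠ 0 := sub_ne_zero.2 fun h => hpK (h ▸ (hyK y hy).1)
        exact ((hd.mono hyK y hy).neg).mul (DifferentiableWithinAt.inv (by fun_prop) h0)
    · filter_upwards [rectM_mem s' t' Y] with p hp y hy
      have hfar : ρ ≤ ‖wpt p - y‖ → wpt p ≠ y → ‖D y p‖ ≤ 2 * M / ρ := by
        intro hfar hne
        rw [hDval y p hne, ← sub_mul, norm_mul, norm_inv, div_eq_mul_inv]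
        refine mul_le_mul ?_ (inv_anti₀ hρ hfar) (by positivity) (by positivity)
        refine (norm_sub_le _ _).trans ?_
        linarith [ind_bound (K := K) hs ht hM hb p hp, hb y (hyK y hy)]
      rcases lt_or_ge ‖wpt p - y‖ ρ with hlt | hge
      · have hwball : ball (wpt p) ρ ⊆ K ∩ strip s t := by
          intro x hx
          refine hball ?_
          rw [mem_ball] at hx hy ⊢
          rw [← dist_eq_norm] at hlt
          linarith [dist_triangle4 x (wpt p) y z]
        have hpK : wpt p ∈ K := (hwball (mem_ball_self hρ)).1
        have : D y p = dslope h (wpt p) y := by simp [hD, hpK]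
        rw [this]
        refine Complex.norm_dslope_le_div_of_mapsTo_ball (hd.mono hwball) ?_ ?_
        · intro x hx
          rw [mem_closedBall, dist_eq_norm]
          refine (norm_sub_le _ _).trans ?_
          linarith [hb x (hwball hx), hb _ (hwball (mem_ball_self hρ))]
        · rwa [mem_ball, dist_comm, dist_eq_norm]
      · exact hfar hge fun h => by rw [h, sub_self, norm_zero] at hge; linarith
  have key : ∀ y ∈ ball z ρ, CT s' t' Y K h y + 2 * Real.pi * lam s' t' y.re * h y =
      (∫ p, D y p ∂rectM s' t' Y) + h y * (-Complex.I * (∫ τ in Ioo s' t', Lg Y τ y)) := by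
    intro y hy
    have hi1 : Integrable (fun p => K.indicator h (wpt p) * (wpt p - y)⁻¹) (rectM s' t' Y) := by
      refine ((kern_int s' t' Y y).const_mul M).mono'
        ((ind_meas hs ht hK hd.continuousOn).mul (ker_meas y)) ?_
      filter_upwards [rectM_mem s' t' Y] with p hp
      rw [norm_mul, norm_inv]
      exact mul_le_mul_of_nonneg_right (ind_bound hs ht hM hb p hp) (by positivity)
    have hi2 : Integrable (fun p => h y * (wpt p - y)⁻¹) (rectM s' t' Y) := by
      refine Integrable.const_mul ?_ _
      exact (kern_int s' t' Y y).mono' (ker_meas y) (ae_of_all _ fun p => by simp)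
    have e1 : ∫ p, D y p ∂rectM s' t' Y = CT s' t' Y K h y -
        ∫ p, h y * (wpt p - y)⁻¹ ∂rectM s' t' Y := by
      rw [CT, ← integral_sub hi1 hi2]
      refine integral_congr_ae ?_
      filter_upwards [rectM_ne s' t' Y y] with p hp
      exact hDval y p hp
    rw [e1, integral_const_mul, rect_int s' t' Y y hY (hKY y (hyK y hy).1)]
    ring
  have hfin : DifferentiableAt ℂ (fun y => (∫ p, D y p ∂rectM s' t' Y) +
      h y * (-Complex.I * (∫ τ in Ioo s' t', Lg Y τ y))) z := by
    refine hDdiff.add ((hd.differentiableAt (hO.mem_nhds hz)).mul ?_)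
    exact (intLg_diff s' t' Y z hY (hKY z hz.1)).const_mul _
  refine hfin.congr_of_eventuallyEq ?_
  filter_upwards [ball_mem_nhds z hρ] with y hy using key y hy
end


section SHsec
variable {ι : Type*} [Fintype ι] [DecidableEq ι]

/-- separately holomorphic -/
def SH (f : (ι → ℂ) → ℂ) (Ω : Set (ι → ℂ)) : Prop :=
  ∀ v ∈ Ω, ∀ j, DifferentiableAt ℂ (fun z => f (update v j z)) (v j)

theorem upd_cont (v : ι → ℂ) (j : ι) : Continuous (fun z : ℂ => update v j z) :=
  continuous_const.update j continuous_id

theorem upd_ev {Ω : Set (ι → ℂ)} (hΩ : IsOpen Ω) {v : ι → ℂ} (hv : v ∈ Ω) (j : ι) :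
    ∀ᶠ z in 𝓝 (v j), update v j z ∈ Ω := by
  have := (upd_cont v j).continuousAt (x := v j)
  refine this.eventually (hΩ.mem_nhds ?_)
  simpa using hv

theorem SH.mono {f : (ι → ℂ) → ℂ} {Ω Ω' : Set (ι → ℂ)} (h : SH f Ω) (hs : Ω' ⊆ Ω) : SH f Ω' :=
  fun v hv j => h v (hs hv) j

theorem SH.congr {f g : (ι → ℂ) → ℂ} {Ω : Set (ι → ℂ)} (h : SH f Ω) (hΩ : IsOpen Ω)
    (he : ∀ v ∈ Ω, f v = g v) : SH g Ω := by
  intro v hv j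
  refine (h v hv j).congr_of_eventuallyEq ?_
  filter_upwards [upd_ev hΩ hv j] with z hz using (he _ hz).symm

theorem SH.union {f : (ι → ℂ) → ℂ} {Ω Ω' : Set (ι → ℂ)} (h : SH f Ω) (h' : SH f Ω') :
    SH f (Ω ∪ Ω') := by
  rintro v (hv | hv) j
  exacts [h v hv j, h' v hv j]

theorem SH.add {f g : (ι → ℂ) → ℂ} {Ω : Set (ι → ℂ)} (h : SH f Ω) (h' : SH g Ω) :
    SH (fun v => f v + g v) Ω := fun v hv j => (h v hv j).add (h' v hv j)
theorem SH.sub {f g : (ι → ℂ) → ℂ} {Ω : Set (ι → ℂ)} (h : SH f Ω) (h' : SH g Ω) :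
    SH (fun v => f v - g v) Ω := fun v hv j => (h v hv j).sub (h' v hv j)
theorem SH.mul {f g : (ι → ℂ) → ℂ} {Ω : Set (ι → ℂ)} (h : SH f Ω) (h' : SH g Ω) :
    SH (fun v => f v * g v) Ω := fun v hv j => (h v hv j).mul (h' v hv j)
theorem SH.neg {f : (ι → ℂ) → ℂ} {Ω : Set (ι → ℂ)} (h : SH f Ω) :
    SH (fun v => - f v) Ω := fun v hv j => (h v hv j).neg
theorem SH.const (c : ℂ) (Ω : Set (ι → ℂ)) : SH (fun _ => c) Ω :=
  fun _ _ _ => differentiableAt_const _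

theorem SH.slice {f : (ι → ℂ) → ℂ} {Ω : Set (ι → ℂ)} (h : SH f Ω) (v : ι → ℂ) (j : ι) (z : ℂ)
    (hz : update v j z ∈ Ω) : DifferentiableAt ℂ (fun z => f (update v j z)) z := by
  have := h _ hz j
  simpa using this

/-- box -/
def box (ρ : ι → ℝ) (a : ι → ℂ) (l m : ι → ℝ) : Set (ι → ℂ) :=
  {v | ∀ j, ‖v j‖ < ρ j ∧ l j < (a j * v j).re ∧ (a j * v j).re < m j}

theorem box_open (ρ : ι → ℝ) (a : ι → ℂ) (l m : ι → ℝ) : IsOpen (box ρ a l m) := by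
  have : box ρ a l m = ⋂ j, {v : ι → ℂ | ‖v j‖ < ρ j ∧ l j < (a j * v j).re ∧
      (a j * v j).re < m j} := by
    ext v; simp [box]
  rw [this]
  refine isOpen_iInter_of_finite fun j => ?_
  have o1 : IsOpen {v : ι → ℂ | ‖v j‖ < ρ j} := isOpen_lt (by fun_prop) continuous_const
  have o2 : IsOpen {v : ι → ℂ | l j < (a j * v j).re} :=
    isOpen_lt continuous_const (Complex.continuous_re.comp (by fun_prop))
  have o3 : IsOpen {v : ι → ℂ | (a j * v j).re < m j} :=
    isOpen_lt (Complex.continuous_re.comp (by fun_prop)) continuous_const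
  exact o1.inter (o2.inter o3)

/-- the constant -/
noncomputable def kap (δ Y : ℝ) : ℝ :=
  (2 * Real.pi * (δ / 3))⁻¹ * (((∫ τ, k1 τ) + δ / 3) * ((∫ τ, k1 τ) + (Y - -Y))) + 2

theorem kap_nonneg {δ Y : ℝ} (hδ : 0 < δ) (hY : 0 < Y) : 0 ≤ kap δ Y := by
  have : 0 ≤ ∫ τ, k1 τ := integral_nonneg fun x => k1_nonneg x
  have h2 : 0 ≤ (∫ τ, k1 τ) + (Y - -Y) := by linarith
  unfold kap
  positivity

theorem lam_lo {s t x : ℝ} (h : x ≤ s) : lam s t x = 0 := by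
  unfold lam; rw [max_eq_left]; linarith [min_le_right t x]
theorem lam_hi {s t x : ℝ} (hst : s ≤ t) (h : t ≤ x) : lam s t x = t - s := by
  unfold lam; rw [min_eq_left h, max_eq_right]; linarith
theorem lam_nonneg (s t x : ℝ) : 0 ≤ lam s t x := le_max_left _ _
theorem lam_le {s t : ℝ} (x : ℝ) (h : s ≤ t) : lam s t x ≤ t - s := by
  unfold lam; refine max_le (by linarith) (by linarith [min_le_left t x])

theorem split1 (ρ : ι → ℝ) (a : ι → ℂ) (l m : ι → ℝ) (i : ι) (ha : a i ≠ 0) (s δ Y M : ℝ)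
    (hδ : 0 < δ) (hY : 0 < Y) (haY : ‖a i‖ * ρ i ≤ Y) (hM : 0 ≤ M) (h : (ι → ℂ) → ℂ)
    (hh : SH h (box ρ a l m ∩ {v | s < (a i * v i).re ∧ (a i * v i).re < s + δ}))
    (hb : ∀ v ∈ box ρ a l m ∩ {v | s < (a i * v i).re ∧ (a i * v i).re < s + δ}, ‖h v‖ ≤ M) :
    ∃ h1 h2 : (ι → ℂ) → ℂ, SH h1 (box ρ a l m ∩ {v | (a i * v i).re < s + δ}) ∧
      SH h2 (box ρ a l m ∩ {v | s < (a i * v i).re}) ∧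
      (∀ v, h v = h1 v - h2 v) ∧
      (∀ v ∈ box ρ a l m ∩ {v | (a i * v i).re < s + δ}, ‖h1 v‖ ≤ kap δ Y * M) ∧
      (∀ v ∈ box ρ a l m ∩ {v | s < (a i * v i).re}, ‖h2 v‖ ≤ kap δ Y * M) := by
  set Q := box ρ a l m with hQ
  set s' := s + δ / 3 with hs'
  set t' := s + 2 * (δ / 3) with ht'
  set t := s + δ with htt
  have hss : s < s' := by linarith
  have hst : s' < t' := by linarith
  have htt2 : t' < t := by linarith
  have hts : t' - s' = δ / 3 := by linarith
  set K : Set ℂ := {w | ‖w / a i‖ < ρ i ∧ l i < w.re ∧ w.re < m i} with hKdef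
  have hKo : IsOpen K := by
    have o1 : IsOpen {w : ℂ | ‖w / a i‖ < ρ i} := isOpen_lt (by fun_prop) continuous_const
    have o2 : IsOpen {w : ℂ | l i < w.re} := isOpen_lt continuous_const Complex.continuous_re
    have o3 : IsOpen {w : ℂ | w.re < m i} := isOpen_lt Complex.continuous_re continuous_const
    exact o1.inter (o2.inter o3)
  have hKY : ∀ w ∈ K, |w.im| < Y := by
    intro w hw
    have h1 := hw.1
    rw [norm_div, div_lt_iff₀ (norm_pos_iff.2 ha)] at h1
    linarith [Complex.abs_im_le_norm w]
  -- the fibre of the slab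
  have hmem : ∀ v ∈ Q, ∀ w ∈ K, update v i (w / a i) ∈ Q := by
    intro v hv w hw j
    rcases eq_or_ne j i with rfl | hj
    · simp only [update_self, mul_div_cancel₀ w ha]; exact hw
    · simp only [update_of_ne hj]; exact hv j
  have hmem2 : ∀ v ∈ Q, ∀ w ∈ K ∩ strip s t, update v i (w / a i) ∈
      Q ∩ {v | s < (a i * v i).re ∧ (a i * v i).re < t} := by
    intro v hv w hw
    refine ⟨hmem v hv w hw.1, ?_⟩
    simp only [mem_ofPred_eq, update_self, mul_div_cancel₀ w ha]
    exact hw.2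
  have hback : ∀ v ∈ Q, a i * v i ∈ K := by
    intro v hv
    have := hv i
    refine ⟨?_, this.2⟩
    rw [mul_div_cancel_left₀ _ ha]; exact this.1
  set H : (ι → ℂ) → ℂ → ℂ := fun v w => h (update v i (w / a i)) with hH
  have hHd : ∀ v ∈ Q, DifferentiableOn ℂ (H v) (K ∩ strip s t) := by
    intro v hv w hw
    have h1 := hh.slice v i (w / a i) (hmem2 v hv w hw)
    have h2 : DifferentiableAt ℂ (fun w => w / a i) w := by fun_prop
    exact (h1.comp w h2).differentiableWithinAt
  have hHb : ∀ v ∈ Q, ∀ w ∈ K ∩ strip s t, ‖H v w‖ ≤ M := fun v hv w hw => hb _ (hmem2 v hv w hw)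
  set u : (ι → ℂ) → ℂ := fun v => CT s' t' Y K (H v) (a i * v i) with hu
  set lm : (ι → ℂ) → ℝ := fun v => lam s' t' (a i * v i).re with hlm
  have hHupd : ∀ v z, H (update v i z) = H v := by intro v z; ext w; simp [hH]
  have hui : ∀ v z, u (update v i z) = CT s' t' Y K (H v) (a i * z) := by
    intro v z; simp only [hu, hHupd, update_self]
  -- other variables
  have hother : ∀ v ∈ Q, ∀ j, j ≠ i → DifferentiableAt ℂ (fun z => u (update v j z)) (v j) := by
    intro v hv j hj
    obtain ⟨ε, hε, hball⟩ := Metric.eventually_nhds_iff_ball.1 (upd_ev (box_open ρ a l m) hv j)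
    have : (fun z => u (update v j z)) = fun z => ∫ p, K.indicator (H (update v j z)) (wpt p) *
        (wpt p - a i * v i)⁻¹ ∂rectM s' t' Y := by
      ext z; simp only [hu, CT, update_of_ne hj.symm]
    rw [this]
    refine PI_differentiableAt hε (b := fun p => M * ‖wpt p - a i * v i‖⁻¹)
      ((kern_int s' t' Y _).const_mul M) ?_ ?_ ?_
    · intro z hz
      exact (ind_meas hss htt2 hKo (hHd _ (hball z hz)).continuousOn).mul (ker_meas _)
    · filter_upwards [rectM_mem s' t' Y] with p hp
      refine DifferentiableOn.mul ?_ (differentiableOn_const _)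
      by_cases hpK : wpt p ∈ K
      · simp only [indicator_of_mem hpK, hH]
        intro z hz
        have hst' : wpt p ∈ K ∩ strip s t := by
          refine ⟨hpK, ?_⟩
          simp only [strip, mem_ofPred_eq, wpt_re]
          exact ⟨hss.trans hp.1.1, hp.1.2.trans htt2⟩
        have hm := hmem2 _ (hball z hz) _ hst'
        have e : ∀ z, update (update v j z) i (wpt p / a i) =
            update (update v i (wpt p / a i)) j z := fun z => update_comm hj _ _ _
        simp only [e] at hm ⊢
        exact (hh.slice _ j z hm).differentiableWithinAt
      · simp only [indicator_of_notMem hpK]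
        exact differentiableOn_const _
    · filter_upwards [rectM_mem s' t' Y] with p hp z hz
      rw [norm_mul, norm_inv]
      exact mul_le_mul_of_nonneg_right (ind_bound hss htt2 hM (hHb _ (hball z hz)) p hp)
        (by positivity)
  have hoff : ∀ v ∈ Q, ((a i * v i).re < s' ∨ t' < (a i * v i).re) → ∀ j,
      DifferentiableAt ℂ (fun z => u (update v j z)) (v j) := by
    intro v hv hre j
    rcases eq_or_ne j i with rfl | hj
    · simp only [hui]
      have h1 := CT_diff_off (Y := Y) hss htt2 hM hKo (hHd v hv).continuousOn (hHb v hv) _ hre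
      exact h1.comp (v j) (by fun_prop : DifferentiableAt ℂ (fun z => a j * z) (v j))
    · exact hother v hv j hj
  have hon : ∀ v ∈ Q, s < (a i * v i).re → (a i * v i).re < t → ∀ j,
      DifferentiableAt ℂ (fun z => u (update v j z) +
        2 * Real.pi * lm (update v j z) * h (update v j z)) (v j) := by
    intro v hv h1 h2 j
    rcases eq_or_ne j i with rfl | hj
    · have e : ∀ z, h (update v j z) = H v (a j * z) := by
        intro z; simp only [hH, mul_div_cancel_left₀ _ ha]
      simp only [hui, hlm, update_self, e]
      have h1 := CT_diff_on hss htt2 hM hY hKo hKY (hHd v hv) (hHb v hv) _ ⟨hback v hv, h1, h2⟩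
      exact h1.comp (v j) (by fun_prop : DifferentiableAt ℂ (fun z => a j * z) (v j))
    · refine (hother v hv j hj).add ?_
      simp only [hlm, update_of_ne hj.symm]
      exact (hh v ⟨hv, h1, h2⟩ j).const_mul _
  set c : ℝ := (2 * Real.pi * (δ / 3))⁻¹ with hc
  have hc0 : 0 ≤ c := by positivity
  have hcl : ∀ v, 0 ≤ c * (2 * Real.pi * lm v) ∧ c * (2 * Real.pi * lm v) ≤ 1 := by
    intro v
    have h1 := lam_nonneg s' t' (a i * v i).re
    have h2 := lam_le (s := s') (t := t') (a i * v i).re hst.le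
    refine ⟨by have : 0 ≤ lm v := h1; positivity, ?_⟩
    rw [hc, inv_mul_le_iff₀ (by positivity), mul_one]
    rw [hts] at h2
    exact mul_le_mul_of_nonneg_left h2 (by positivity)
  have hub : ∀ v ∈ Q, ‖(c : ℂ) * u v‖ ≤ (kap δ Y - 2) * M := by
    intro v hv
    have := CT_bound (Y := Y) hss htt2 hst.le hY.le hM (hHb v hv) (a i * v i)
    rw [hts] at this
    rw [norm_mul, Complex.norm_real, Real.norm_of_nonneg hc0]
    refine (mul_le_mul_of_nonneg_left this hc0).trans (le_of_eq ?_)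
    unfold kap; ring
  have hre_cont : ∀ v : ι → ℂ, ∀ j, Continuous (fun z : ℂ => (a i * (update v j z) i).re) := by
    intro v j
    have := (continuous_apply i).comp (upd_cont v j)
    exact Complex.continuous_re.comp (continuous_const.mul this)
  set h1 : (ι → ℂ) → ℂ := fun v => c * (u v + 2 * Real.pi * lm v * h v) with hh1
  refine ⟨h1, fun v => h1 v - h v, ?_, ?_, fun v => by ring, ?_, ?_⟩
  · rintro v ⟨hv, hvt⟩ j
    rcases lt_or_ge s (a i * v i).re with hvs | hvs
    · exact (hon v hv hvs hvt j).const_mul _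
    · have hlt : (a i * v i).re < s' := by linarith
      refine ((hoff v hv (Or.inl hlt) j).const_mul (c : ℂ)).congr_of_eventuallyEq ?_
      have : ∀ᶠ z in 𝓝 (v j), (a i * (update v j z) i).re < s' :=
        (hre_cont v j).continuousAt.eventually_lt continuousAt_const (by simpa using hlt)
      filter_upwards [this] with z hz
      simp only [hh1, hlm, lam_lo hz.le]
      simp
  · rintro v ⟨hv, hvs⟩ j
    rcases lt_or_ge (a i * v i).re t with hvt | hvt
    · exact ((hon v hv hvs hvt j).const_mul _).sub (hh v ⟨hv, hvs, hvt⟩ j)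
    · have hlt : t' < (a i * v i).re := by linarith
      refine ((hoff v hv (Or.inr hlt) j).const_mul (c : ℂ)).congr_of_eventuallyEq ?_
      have : ∀ᶠ z in 𝓝 (v j), t' < (a i * (update v j z) i).re :=
        continuousAt_const.eventually_lt (hre_cont v j).continuousAt (by simpa using hlt)
      filter_upwards [this] with z hz
      simp only [hh1, hlm, lam_hi hst.le hz.le, hts]
      have e : (c : ℂ) * (2 * Real.pi * (δ / 3 : ℝ)) = 1 := by
        rw [hc]
        have : (2 * Real.pi * (δ / 3)) ≠ 0 := by positivity
        exact_mod_cast inv_mul_cancel₀ this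
      linear_combination h (update v j z) * e
  · rintro v ⟨hv, hvt⟩
    have h0 : ‖((c * (2 * Real.pi * lm v) : ℝ) : ℂ) * h v‖ ≤ M := by
      rw [norm_mul, Complex.norm_real, Real.norm_of_nonneg (hcl v).1]
      rcases lt_or_ge s (a i * v i).re with hvs | hvs
      · have := hb v ⟨hv, hvs, hvt⟩
        exact (mul_le_mul (hcl v).2 this (norm_nonneg _) zero_le_one).trans (by simp)
      · have : lm v = 0 := lam_lo (by linarith)
        simp [this, hM]
    have e : h1 v = c * u v + ((c * (2 * Real.pi * lm v) : ℝ) : ℂ) * h v := by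
      simp only [hh1]; push_cast; ring
    rw [e]
    refine (norm_add_le _ _).trans ?_
    linarith [hub v hv]
  · rintro v ⟨hv, hvs⟩
    have h0 : ‖((c * (2 * Real.pi * lm v) - 1 : ℝ) : ℂ) * h v‖ ≤ M := by
      rw [norm_mul, Complex.norm_real]
      rcases lt_or_ge (a i * v i).re t with hvt | hvt
      · have := hb v ⟨hv, hvs, hvt⟩
        have h3 : ‖c * (2 * Real.pi * lm v) - 1‖ ≤ 1 := by
          rw [Real.norm_eq_abs, abs_le]
          constructor <;> linarith [(hcl v).1, (hcl v).2]
        exact (mul_le_mul h3 this (norm_nonneg _) zero_le_one).trans (by simp)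
      · have : lm v = t' - s' := lam_hi hst.le (by linarith)
        rw [this, hts, hc, inv_mul_cancel₀ (by positivity)]
        simp [hM]
    have e : h1 v - h v = c * u v + ((c * (2 * Real.pi * lm v) - 1 : ℝ) : ℂ) * h v := by
      simp only [hh1]; push_cast; ring
    show ‖h1 v - h v‖ ≤ kap δ Y * M
    rw [e]
    refine (norm_add_le _ _).trans ?_
    linarith [hub v hv]
end SHsec


section Split
variable {ι : Type*} [Fintype ι] [DecidableEq ι]

theorem SH.glue {f1 f2 : (ι → ℂ) → ℂ} {Ω1 Ω2 : Set (ι → ℂ)} (h1 : SH f1 Ω1) (h2 : SH f2 Ω2)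
    (o1 : IsOpen Ω1) (o2 : IsOpen Ω2) (he : ∀ v ∈ Ω1, v ∈ Ω2 → f1 v = f2 v) :
    ∃ g : (ι → ℂ) → ℂ, (∀ v ∈ Ω1, g v = f1 v) ∧ (∀ v ∈ Ω2, g v = f2 v) ∧ SH g (Ω1 ∪ Ω2) := by
  classical
  set g : (ι → ℂ) → ℂ := fun v => if v ∈ Ω1 then f1 v else f2 v with hg
  have g1 : ∀ v ∈ Ω1, g v = f1 v := fun v hv => by simp [hg, hv]
  have g2 : ∀ v ∈ Ω2, g v = f2 v := fun v hv => by
    by_cases h : v ∈ Ω1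
    · rw [g1 v h, he v h hv]
    · simp [hg, h]
  exact ⟨g, g1, g2, (h1.congr o1 fun v hv => (g1 v hv).symm).union
    (h2.congr o2 fun v hv => (g2 v hv).symm)⟩

/-- bounded splitting property -/
def SplitP (A B Q : Set (ι → ℂ)) (C : ℝ) : Prop :=
  ∀ (f : (ι → ℂ) → ℂ) (M : ℝ), 0 ≤ M → SH f (Q ∩ A ∩ B) → (∀ v ∈ Q ∩ A ∩ B, ‖f v‖ ≤ M) →
    ∃ f' f'' : (ι → ℂ) → ℂ, SH f' (Q ∩ A) ∧ SH f'' (Q ∩ B) ∧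
      (∀ v ∈ Q ∩ A ∩ B, f v = f' v + f'' v) ∧ (∀ v ∈ Q ∩ A, ‖f' v‖ ≤ C * M) ∧
      (∀ v ∈ Q ∩ B, ‖f'' v‖ ≤ C * M)

theorem SplitP.mono {A B Q : Set (ι → ℂ)} {C C' : ℝ} (h : SplitP A B Q C) (hC : C ≤ C') :
    SplitP A B Q C' := by
  intro f M hM hf hb
  obtain ⟨f', f'', h1, h2, h3, h4, h5⟩ := h f M hM hf hb
  have := mul_le_mul_of_nonneg_right hC hM
  exact ⟨f', f'', h1, h2, h3, fun v hv => (h4 v hv).trans this, fun v hv => (h5 v hv).trans this⟩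

theorem re_open (a : ι → ℂ) (i : ι) (t : ℝ) : IsOpen {v : ι → ℂ | (a i * v i).re < t} :=
  isOpen_lt (Complex.continuous_re.comp (by fun_prop)) continuous_const
theorem re_open' (a : ι → ℂ) (i : ι) (t : ℝ) : IsOpen {v : ι → ℂ | t < (a i * v i).re} :=
  isOpen_lt continuous_const (Complex.continuous_re.comp (by fun_prop))

theorem split_merge (ρ : ι → ℝ) (a : ι → ℂ) (l m : ι → ℝ) (i : ι) (s δ Y C : ℝ)
    (hδ : 0 < δ) (hY : 0 < Y) (haY : ‖a i‖ * ρ i ≤ Y) (hC : 0 ≤ C) {A B : Set (ι → ℂ)}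
    (oA : IsOpen A) (oB : IsOpen B) (hAB : ∀ v, v ∈ A ∨ v ∈ B)
    (H1 : SplitP A B (box ρ a l m ∩ {v | (a i * v i).re < s + δ}) C)
    (H2 : SplitP A B (box ρ a l m ∩ {v | s < (a i * v i).re}) C) :
    SplitP A B (box ρ a l m) (C * (1 + 2 * kap δ Y)) := by
  have hk := kap_nonneg hδ hY
  by_cases ha : a i = 0
  · have hCC : C ≤ C * (1 + 2 * kap δ Y) := by nlinarith [mul_nonneg hC hk]
    rcases lt_or_ge 0 (s + δ) with h | h
    · have : box ρ a l m ∩ {v | (a i * v i).re < s + δ} = box ρ a l m := by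
        rw [inter_eq_left]; intro v _
        show (a i * v i).re < s + δ
        simpa [ha] using h
      rw [this] at H1; exact H1.mono hCC
    · have : box ρ a l m ∩ {v | s < (a i * v i).re} = box ρ a l m := by
        rw [inter_eq_left]; intro v _
        show s < (a i * v i).re
        simp [ha]; linarith
      rw [this] at H2; exact H2.mono hCC
  intro f M hM hf hb
  have oQ := box_open ρ a l m
  have hsp := split1 ρ a l m i ha s δ Y (2 * C * M) hδ hY haY (by positivity)
  set Q := box ρ a l m
  set E1 : Set (ι → ℂ) := {v | (a i * v i).re < s + δ} with hE1
  set E2 : Set (ι → ℂ) := {v | s < (a i * v i).re} with hE2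
  have oE1 : IsOpen E1 := re_open a i _
  have oE2 : IsOpen E2 := re_open' a i _
  have hE : ∀ v, v ∈ E1 ∨ v ∈ E2 := by
    intro v
    rcases lt_or_ge (a i * v i).re (s + δ) with h | h
    · exact Or.inl h
    · exact Or.inr (by show s < (a i * v i).re; linarith)
  obtain ⟨p1, q1, sp1, sq1, e1, bp1, bq1⟩ := H1 f M hM
    (hf.mono fun v hv => ⟨⟨hv.1.1.1, hv.1.2⟩, hv.2⟩) (fun v hv => hb v ⟨⟨hv.1.1.1, hv.1.2⟩, hv.2⟩)
  obtain ⟨p2, q2, sp2, sq2, e2, bp2, bq2⟩ := H2 f M hM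
    (hf.mono fun v hv => ⟨⟨hv.1.1.1, hv.1.2⟩, hv.2⟩) (fun v hv => hb v ⟨⟨hv.1.1.1, hv.1.2⟩, hv.2⟩)
  obtain ⟨h, hA, hB, hh⟩ := SH.glue (f1 := fun v => p1 v - p2 v) (f2 := fun v => q2 v - q1 v)
    (Ω1 := Q ∩ E1 ∩ E2 ∩ A) (Ω2 := Q ∩ E1 ∩ E2 ∩ B)
    ((sp1.mono fun v hv => ⟨hv.1.1, hv.2⟩).sub (sp2.mono fun v hv => ⟨⟨hv.1.1.1, hv.1.2⟩, hv.2⟩))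
    ((sq2.mono fun v hv => ⟨⟨hv.1.1.1, hv.1.2⟩, hv.2⟩).sub (sq1.mono fun v hv => ⟨hv.1.1, hv.2⟩))
    (((oQ.inter oE1).inter oE2).inter oA) (((oQ.inter oE1).inter oE2).inter oB) (by
      intro v hv hv'
      have x1 := e1 v ⟨⟨hv.1.1, hv.2⟩, hv'.2⟩
      have x2 := e2 v ⟨⟨⟨hv.1.1.1, hv.1.2⟩, hv.2⟩, hv'.2⟩
      linear_combination x2 - x1)
  have nsub : ∀ x y : ℂ, ‖x‖ ≤ C * M → ‖y‖ ≤ C * M → ‖x - y‖ ≤ 2 * C * M := by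
    intro x y hx hy; linarith [norm_sub_le x y]
  obtain ⟨h1, h2, s1, s2, eh, b1, b2⟩ := hsp h
    (hh.mono (by
      rintro v ⟨hv, hv2, hv1⟩
      rcases hAB v with h | h
      · exact Or.inl ⟨⟨⟨hv, hv1⟩, hv2⟩, h⟩
      · exact Or.inr ⟨⟨⟨hv, hv1⟩, hv2⟩, h⟩))
    (by
      rintro v ⟨hv, hv2, hv1⟩
      rcases hAB v with h | h
      · rw [hA v ⟨⟨⟨hv, hv1⟩, hv2⟩, h⟩]
        exact nsub _ _ (bp1 v ⟨⟨hv, hv1⟩, h⟩) (bp2 v ⟨⟨hv, hv2⟩, h⟩)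
      · rw [hB v ⟨⟨⟨hv, hv1⟩, hv2⟩, h⟩]
        exact nsub _ _ (bq2 v ⟨⟨hv, hv2⟩, h⟩) (bq1 v ⟨⟨hv, hv1⟩, h⟩))
  obtain ⟨F, F1, F2, sF⟩ := SH.glue (f1 := fun v => p1 v - h1 v) (f2 := fun v => p2 v - h2 v)
    (Ω1 := Q ∩ E1 ∩ A) (Ω2 := Q ∩ E2 ∩ A) (sp1.sub (s1.mono fun v hv => hv.1))
    (sp2.sub (s2.mono fun v hv => hv.1)) ((oQ.inter oE1).inter oA) ((oQ.inter oE2).inter oA) (by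
      intro v hv hv'
      have x := hA v ⟨⟨hv.1, hv'.1.2⟩, hv.2⟩
      have y := eh v
      linear_combination y - x)
  obtain ⟨G, G1, G2, sG⟩ := SH.glue (f1 := fun v => q1 v + h1 v) (f2 := fun v => q2 v + h2 v)
    (Ω1 := Q ∩ E1 ∩ B) (Ω2 := Q ∩ E2 ∩ B) (sq1.add (s1.mono fun v hv => hv.1))
    (sq2.add (s2.mono fun v hv => hv.1)) ((oQ.inter oE1).inter oB) ((oQ.inter oE2).inter oB) (by
      intro v hv hv'
      have x := hB v ⟨⟨hv.1, hv'.1.2⟩, hv.2⟩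
      have y := eh v
      linear_combination x - y)
  have nb : ∀ x y : ℂ, ‖x‖ ≤ C * M → ‖y‖ ≤ kap δ Y * (2 * C * M) →
      ‖x - y‖ ≤ C * (1 + 2 * kap δ Y) * M ∧ ‖x + y‖ ≤ C * (1 + 2 * kap δ Y) * M := by
    intro x y hx hy
    have := norm_sub_le x y
    have := norm_add_le x y
    constructor <;> nlinarith
  refine ⟨F, G, sF.mono ?_, sG.mono ?_, ?_, ?_, ?_⟩
  · rintro v ⟨hv, hvA⟩
    rcases hE v with h | h
    exacts [Or.inl ⟨⟨hv, h⟩, hvA⟩, Or.inr ⟨⟨hv, h⟩, hvA⟩]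
  · rintro v ⟨hv, hvA⟩
    rcases hE v with h | h
    exacts [Or.inl ⟨⟨hv, h⟩, hvA⟩, Or.inr ⟨⟨hv, h⟩, hvA⟩]
  · rintro v ⟨⟨hv, hvA⟩, hvB⟩
    rcases hE v with h | h
    · rw [F1 v ⟨⟨hv, h⟩, hvA⟩, G1 v ⟨⟨hv, h⟩, hvB⟩, e1 v ⟨⟨⟨hv, h⟩, hvA⟩, hvB⟩]; ring
    · rw [F2 v ⟨⟨hv, h⟩, hvA⟩, G2 v ⟨⟨hv, h⟩, hvB⟩, e2 v ⟨⟨⟨hv, h⟩, hvA⟩, hvB⟩]; ring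
  · rintro v ⟨hv, hvA⟩
    rcases hE v with h | h
    · rw [F1 v ⟨⟨hv, h⟩, hvA⟩]; exact (nb _ _ (bp1 v ⟨⟨hv, h⟩, hvA⟩) (b1 v ⟨hv, h⟩)).1
    · rw [F2 v ⟨⟨hv, h⟩, hvA⟩]; exact (nb _ _ (bp2 v ⟨⟨hv, h⟩, hvA⟩) (b2 v ⟨hv, h⟩)).1
  · rintro v ⟨hv, hvA⟩
    rcases hE v with h | h
    · rw [G1 v ⟨⟨hv, h⟩, hvA⟩]; exact (nb _ _ (bq1 v ⟨⟨hv, h⟩, hvA⟩) (b1 v ⟨hv, h⟩)).2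
    · rw [G2 v ⟨⟨hv, h⟩, hvA⟩]; exact (nb _ _ (bq2 v ⟨⟨hv, h⟩, hvA⟩) (b2 v ⟨hv, h⟩)).2

/-- the real-linear functional with coefficients `a` -/
def alf (a : ι → ℂ) (v : ι → ℂ) : ℝ := ∑ j, (a j * v j).re

theorem alf_cont (a : ι → ℂ) : Continuous (alf a) := by
  unfold alf
  exact continuous_finset_sum _ fun j _ => Complex.continuous_re.comp (by fun_prop)

theorem box_up (ρ : ι → ℝ) (a : ι → ℂ) (l m : ι → ℝ) (i : ι) (t : ℝ) :
    box ρ a l (update m i (min (m i) t)) = box ρ a l m ∩ {v | (a i * v i).re < t} := by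
  ext v
  constructor
  · intro hv
    refine ⟨fun j => ?_, ?_⟩
    · have := hv j
      rcases eq_or_ne j i with rfl | hj
      · simp only [update_self, lt_min_iff] at this; tauto
      · simpa only [update_of_ne hj] using this
    · have := hv i
      simp only [update_self, lt_min_iff] at this
      exact this.2.2.2
  · rintro ⟨hv, h2⟩ j
    have := hv j
    rcases eq_or_ne j i with rfl | hj
    · simp only [update_self, lt_min_iff]; exact ⟨this.1, this.2.1, this.2.2, h2⟩
    · simpa only [update_of_ne hj] using this

theorem box_lo (ρ : ι → ℝ) (a : ι → ℂ) (l m : ι → ℝ) (i : ι) (t : ℝ) :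
    box ρ a (update l i (max (l i) t)) m = box ρ a l m ∩ {v | t < (a i * v i).re} := by
  ext v
  constructor
  · intro hv
    refine ⟨fun j => ?_, ?_⟩
    · have := hv j
      rcases eq_or_ne j i with rfl | hj
      · simp only [update_self, max_lt_iff] at this; tauto
      · simpa only [update_of_ne hj] using this
    · have := hv i
      simp only [update_self, max_lt_iff] at this
      exact this.2.1.2
  · rintro ⟨hv, h2⟩ j
    have := hv j
    rcases eq_or_ne j i with rfl | hj
    · simp only [update_self, max_lt_iff]; exact ⟨this.1, ⟨this.2.1, h2⟩, this.2.2⟩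
    · simpa only [update_of_ne hj] using this

theorem split_box (ρ : ι → ℝ) (a : ι → ℂ) (δ Y c1 c2 : ℝ) (hδ : 0 < δ) (hY : 0 < Y)
    (haY : ∀ i, ‖a i‖ * ρ i ≤ Y) (hc : Fintype.card ι * (2 * δ) < c2 - c1) :
    ∀ (k : ℕ) (n : ι → ℕ) (l m : ι → ℝ), ∑ j, n j ≤ k → (∀ j, m j - l j ≤ (n j + 2) * δ) →
      SplitP {v | alf a v < c2} {v | c1 < alf a v} (box ρ a l m) ((1 + 2 * kap δ Y) ^ k) := by
  have hk := kap_nonneg hδ hY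
  have hcc : c1 < c2 := by
    have : 0 ≤ Fintype.card ι * (2 * δ) := by positivity
    linarith
  intro k
  induction k with
  | zero =>
    intro n l m hn hw
    have hn0 : ∀ j, n j = 0 := by
      intro j
      have := Finset.single_le_sum (f := n) (fun i _ => Nat.zero_le _) (Finset.mem_univ j)
      omega
    have hosc : ∀ v ∈ box ρ a l m, ∀ w ∈ box ρ a l m, alf a v - alf a w ≤
        Fintype.card ι * (2 * δ) := by
      intro v hv w hw'
      unfold alf
      rw [← Finset.sum_sub_distrib]
      have : ∀ j ∈ Finset.univ, (a j * v j).re - (a j * w j).re ≤ 2 * δ := by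
        intro j _
        have h1 := hv j; have h2 := hw' j; have h3 := hw j
        rw [hn0 j] at h3
        push_cast at h3
        linarith [h1.2.2, h2.2.1]
      have := Finset.sum_le_card_nsmul _ _ _ this
      simpa using this
    intro f M hM hf hb
    by_cases hA : box ρ a l m ⊆ {v | alf a v < c2}
    · refine ⟨fun _ => 0, f, SH.const _ _, hf.mono fun v hv => ⟨⟨hv.1, hA hv.1⟩, hv.2⟩,
        fun v _ => by simp, fun v _ => by simpa using hM,
        fun v hv => by simpa using hb v ⟨⟨hv.1, hA hv.1⟩, hv.2⟩⟩
    · have hB : box ρ a l m ⊆ {v | c1 < alf a v} := by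
        intro w hw'
        by_contra hcon
        apply hA
        intro v hv
        have := hosc v hv w hw'
        have h3 : ¬ c1 < alf a w := hcon
        show alf a v < c2
        linarith
      refine ⟨f, fun _ => 0, hf.mono fun v hv => ⟨hv, hB hv.1⟩, SH.const _ _,
        fun v _ => by simp, fun v hv => by simpa using hb v ⟨hv, hB hv.1⟩,
        fun v _ => by simpa using hM⟩
  | succ k ih =>
    intro n l m hn hw
    by_cases hn0 : ∀ j, n j = 0
    · refine (ih n l m (by simp [hn0]) hw).mono ?_
      exact pow_le_pow_right₀ (by linarith) (by omega)
    push Not at hn0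
    obtain ⟨i, hi⟩ := hn0
    rw [pow_succ]
    refine split_merge ρ a l m i (l i + δ) δ Y _ hδ hY (haY i) (by positivity)
      (isOpen_lt (alf_cont a) continuous_const) (isOpen_lt continuous_const (alf_cont a)) ?_ ?_ ?_
    · intro v
      rcases lt_or_ge (alf a v) c2 with h | h
      · exact Or.inl h
      · exact Or.inr (by show c1 < alf a v; linarith)
    · rw [← box_up]
      refine ih (update n i 0) _ _ ?_ ?_
      · have : ∑ j, update n i 0 j < ∑ j, n j := by
          refine Finset.sum_lt_sum (fun j _ => ?_) ⟨i, Finset.mem_univ _, ?_⟩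
          · rcases eq_or_ne j i with rfl | hj
            · simp
            · simp [update_of_ne hj]
          · simp; omega
        omega
      · intro j
        rcases eq_or_ne j i with rfl | hj
        · simp only [update_self]
          push_cast
          linarith [min_le_right (m j) (l j + δ + δ)]
        · simpa only [update_of_ne hj] using hw j
    · rw [← box_lo]
      refine ih (update n i (n i - 1)) _ _ ?_ ?_
      · have : ∑ j, update n i (n i - 1) j < ∑ j, n j := by
          refine Finset.sum_lt_sum (fun j _ => ?_) ⟨i, Finset.mem_univ _, ?_⟩
          · rcases eq_or_ne j i with rfl | hj
            · simp
            · simp [update_of_ne hj]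
          · simp; omega
        omega
      · intro j
        rcases eq_or_ne j i with rfl | hj
        · simp only [update_self]
          obtain ⟨q, hq⟩ := Nat.exists_eq_succ_of_ne_zero hi
          have := hw j
          rw [hq] at this ⊢
          simp only [Nat.succ_eq_add_one, Nat.add_sub_cancel]
          push_cast at this
          linarith [le_max_right (l j) (l j + δ)]
        · simpa only [update_of_ne hj] using hw j

/-- open polydisc -/
def pd (ρ : ι → ℝ) : Set (ι → ℂ) := {v | ∀ j, ‖v j‖ < ρ j}

theorem split_thm (a : ι → ℂ) (R γ : ℝ) (hγ : 0 < γ) : ∃ C : ℝ, 1 ≤ C ∧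
    ∀ (ρ : ι → ℝ) (c1 c2 : ℝ), (∀ j, ρ j ≤ R) → γ ≤ c2 - c1 →
      SplitP {v | alf a v < c2} {v | c1 < alf a v} (pd ρ) C := by
  set δ := γ / (2 * (Fintype.card ι + 1)) with hδd
  have hδ : 0 < δ := by positivity
  set Y := (∑ j, ‖a j‖) * |R| + 1 with hYd
  have hY : 0 < Y := by positivity
  have hk := kap_nonneg hδ hY
  obtain ⟨q, hq⟩ := exists_nat_ge (2 * Y / δ)
  refine ⟨(1 + 2 * kap δ Y) ^ (∑ _j : ι, q), one_le_pow₀ (by linarith), ?_⟩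
  intro ρ c1 c2 hρ hcc
  have hle : ∀ i, ‖a i‖ * ρ i ≤ Y - 1 := by
    intro i
    have h1 : ‖a i‖ ≤ ∑ j, ‖a j‖ :=
      Finset.single_le_sum (f := fun j => ‖a j‖) (fun _ _ => norm_nonneg _) (Finset.mem_univ i)
    have h2 : ρ i ≤ |R| := (hρ i).trans (le_abs_self R)
    calc ‖a i‖ * ρ i ≤ ‖a i‖ * |R| := mul_le_mul_of_nonneg_left h2 (norm_nonneg _)
      _ ≤ (∑ j, ‖a j‖) * |R| := mul_le_mul_of_nonneg_right h1 (abs_nonneg _)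
      _ = Y - 1 := by rw [hYd]; ring
  have hbox : box ρ a (fun _ => -Y) (fun _ => Y) = pd ρ := by
    ext v
    refine ⟨fun h j => (h j).1, fun h j => ⟨h j, ?_⟩⟩
    have h1 : |(a j * v j).re| < Y := by
      refine (Complex.abs_re_le_norm _).trans_lt ?_
      rw [norm_mul]
      have := mul_le_mul_of_nonneg_left (h j).le (norm_nonneg (a j))
      linarith [hle j]
    exact abs_lt.1 h1
  rw [← hbox]
  refine split_box ρ a δ Y c1 c2 hδ hY (fun i => by linarith [hle i]) ?_ _ (fun _ => q) _ _ le_rfl ?_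
  · have : δ * (2 * (Fintype.card ι + 1)) = γ := by rw [hδd]; field_simp
    nlinarith
  · intro j
    rw [div_le_iff₀ hδ] at hq
    nlinarith
end Split


theorem circle_diff {G : ℂ → ℂ → ℂ} {z0 : ℂ} {ε r B : ℝ} (hε : 0 < ε) (hr : 0 < r)
    (hm : ∀ z ∈ ball z0 ε, ContinuousOn (G z) (sphere 0 r))
    (hd : ∀ ζ ∈ sphere (0 : ℂ) r, DifferentiableOn ℂ (fun z => G z ζ) (ball z0 ε))
    (hb : ∀ z ∈ ball z0 ε, ∀ ζ ∈ sphere (0 : ℂ) r, ‖G z ζ‖ ≤ B) :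
    DifferentiableAt ℂ (fun z => ∮ ζ in C(0, r), G z ζ) z0 := by
  unfold circleIntegral
  simp only [intervalIntegral.integral_of_le Real.two_pi_pos.le, smul_eq_mul]
  have hs : ∀ θ, circleMap 0 r θ ∈ sphere (0 : ℂ) r := fun θ => circleMap_mem_sphere 0 hr.le θ
  refine PI_differentiableAt hε (b := fun _ => r * B) ?_ ?_ ?_ ?_
  · exact integrable_const _
  · intro z hz
    have h1 : Continuous (fun θ => G z (circleMap 0 r θ)) :=
      (hm z hz).comp_continuous (continuous_circleMap 0 r) hs
    have h2 : Continuous (deriv (circleMap 0 r)) := by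
      have : deriv (circleMap 0 r) = fun θ => circleMap 0 r θ * Complex.I := by
        ext θ; simp
      rw [this]; exact (continuous_circleMap 0 r).mul continuous_const
    exact (h2.mul h1).aestronglyMeasurable
  · refine Eventually.of_forall fun θ => ?_
    exact (hd _ (hs θ)).const_mul _
  · refine Eventually.of_forall fun θ z hz => ?_
    have := hb z hz _ (hs θ)
    rw [norm_mul, deriv_circleMap, norm_mul, Complex.norm_I, norm_circleMap_zero, abs_of_pos hr,
      mul_one]
    gcongr

theorem eval_bind {σ τ : Type*} (g : σ → MvPolynomial τ ℂ) (v : τ → ℂ) (p : MvPolynomial σ ℂ) :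
    MvPolynomial.eval v (MvPolynomial.bind₁ g p) =
      MvPolynomial.eval (fun i => MvPolynomial.eval v (g i)) p :=
  MvPolynomial.eval₂Hom_bind₁ _ _ _ _

section Runge
variable {ι : Type*} [Fintype ι] [DecidableEq ι]

theorem pd_open (ρ : ι → ℝ) : IsOpen (pd ρ) := by
  have : pd ρ = ⋂ j, {v : ι → ℂ | ‖v j‖ < ρ j} := by ext v; simp [pd]
  rw [this]
  exact isOpen_iInter_of_finite fun j => isOpen_lt (by fun_prop) continuous_const

theorem pd_update {ρ : ι → ℝ} {v : ι → ℂ} (hv : v ∈ pd ρ) {j : ι} {z : ℂ} (hz : ‖z‖ < ρ j) :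
    update v j z ∈ pd ρ := by
  intro k
  rcases eq_or_ne k j with rfl | hk
  · simpa using hz
  · simpa [update_of_ne hk] using hv k

/-- Taylor coefficient -/
noncomputable def tc (F : (ι → ℂ) → ℂ) (j : ι) (r : ℝ) (n : ℕ) (w : ι → ℂ) : ℂ :=
  (2 * Real.pi * Complex.I)⁻¹ • ∮ z in C(0, r), (1 / (z - 0)) ^ n • (z - 0)⁻¹ • F (update w j z)

theorem tc_bound {F : (ι → ℂ) → ℂ} {ρ : ι → ℝ} {B : ℝ} (hb : ∀ v ∈ pd ρ, ‖F v‖ ≤ B)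
    {j : ι} {r : ℝ} (hr : 0 < r) (hrρ : r < ρ j) (n : ℕ) {w : ι → ℂ} (hw : w ∈ pd ρ) :
    ‖tc F j r n w‖ ≤ B * r⁻¹ ^ n := by
  unfold tc
  refine (circleIntegral.norm_two_pi_i_inv_smul_integral_le_of_norm_le_const
    (C := r⁻¹ ^ n * (r⁻¹ * B)) hr.le ?_).trans (le_of_eq ?_)
  · intro z hz
    have hz' : ‖z‖ = r := by simpa using hz
    have := hb _ (pd_update hw (j := j) (z := z) (by rw [hz']; exact hrρ))
    rw [norm_smul, norm_smul, norm_pow, norm_inv, norm_div, sub_zero, hz', norm_one, one_div]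
    gcongr
  · field_simp

theorem tc_SH {F : (ι → ℂ) → ℂ} {ρ : ι → ℝ} {B : ℝ} (hF : SH F (pd ρ))
    (hb : ∀ v ∈ pd ρ, ‖F v‖ ≤ B)
    {j : ι} {r : ℝ} (hr : 0 < r) (hrρ : r < ρ j) (n : ℕ) : SH (tc F j r n) (pd ρ) := by
  intro w hw k
  rcases eq_or_ne k j with rfl | hk
  · have : (fun z => tc F k r n (update w k z)) = fun _ => tc F k r n w := by
      ext z; simp [tc]
    rw [this]; exact differentiableAt_const _
  · unfold tc
    simp only [smul_eq_mul]
    refine DifferentiableAt.const_mul ?_ _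
    obtain ⟨ε, hε, hball⟩ := Metric.eventually_nhds_iff_ball.1 (upd_ev (pd_open ρ) hw k)
    have hz0 : ∀ z ∈ sphere (0 : ℂ) r, z ≠ 0 := by
      intro z hz h0; rw [h0] at hz; simp at hz; linarith
    have hzn : ∀ z ∈ sphere (0 : ℂ) r, ‖z‖ < ρ j := by
      intro z hz; rw [mem_sphere_zero_iff_norm.1 hz]; exact hrρ
    refine circle_diff (B := r⁻¹ ^ n * (r⁻¹ * B)) hε hr ?_ ?_ ?_
    · intro z hz
      refine ContinuousOn.mul (f := fun ζ : ℂ => (1 / (ζ - 0)) ^ n) ?_ (ContinuousOn.mul (f := fun ζ : ℂ => (ζ - 0)⁻¹) ?_ ?_)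
      · intro ζ hζ
        have := hz0 ζ hζ
        have h : ζ - 0 ≠ 0 := by simpa using this
        have hc : ContinuousAt (fun ζ : ℂ => ζ - 0) ζ := by fun_prop
        exact ((continuousAt_const.div hc h).pow n).continuousWithinAt
      · intro ζ hζ
        have := hz0 ζ hζ
        have h : ζ - 0 ≠ 0 := by simpa using this
        have hc : ContinuousAt (fun ζ : ℂ => ζ - 0) ζ := by fun_prop
        exact (hc.inv₀ h).continuousWithinAt
      · intro ζ hζ
        exact (hF.slice _ j ζ (pd_update (hball z hz) (hzn ζ hζ))).continuousAt.continuousWithinAt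
    · intro ζ hζ
      refine DifferentiableOn.const_mul (DifferentiableOn.const_mul ?_ _) _
      intro z hz
      have hm := pd_update (hball z hz) (hzn ζ hζ)
      have e : ∀ z, update (update w k z) j ζ = update (update w j ζ) k z :=
        fun z => update_comm hk _ _ _
      simp only [e] at hm ⊢
      exact (hF.slice _ k z hm).differentiableWithinAt
    · intro z hz ζ hζ
      have := hb _ (pd_update (hball z hz) (hzn ζ hζ))
      rw [norm_mul, norm_mul, norm_pow, norm_inv, norm_div, sub_zero,
        mem_sphere_zero_iff_norm.1 hζ, norm_one, one_div]
      gcongr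

theorem tc_sum {F : (ι → ℂ) → ℂ} {ρ : ι → ℝ} (hF : SH F (pd ρ))
    {j : ι} {r : ℝ} (hr : 0 < r) (hrρ : r < ρ j) {v : ι → ℂ} (hv : v ∈ pd ρ) (hvr : ‖v j‖ < r) :
    HasSum (fun n => v j ^ n * tc F j r n (update v j 0)) (F v) := by
  have hd : DifferentiableOn ℂ (fun z => F (update v j z)) (closedBall 0 r) := by
    intro z hz
    exact (hF.slice v j z (pd_update hv
      ((mem_closedBall_zero_iff.1 hz).trans_lt hrρ))).differentiableWithinAt
  lift r to NNReal using hr.le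
  have h1 := hd.hasFPowerSeriesOnBall (by exact_mod_cast hr)
  have h2 := h1.hasSum (y := v j) (by
    rw [Metric.mem_eball, edist_zero_right]
    exact_mod_cast hvr)
  simp only [zero_add, update_eq_self] at h2
  have e : (fun n => v j ^ n * tc F j r n (update v j 0)) =
      fun n => (cauchyPowerSeries (fun z => F (update v j z)) 0 (↑r) n) fun _ => v j := ?_
  · rw [e]; exact h2
  funext n
  rw [FormalMultilinearSeries.apply_eq_pow_smul_coeff, smul_eq_mul]
  congr 1
  rw [FormalMultilinearSeries.coeff]
  have := cauchyPowerSeries_apply (fun z => F (update v j z)) 0 r n 1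
  simp only [tc, update_idem]
  exact this.symm

theorem runge_aux (ρ ρ' : ι → ℝ) (h0 : ∀ j, 0 ≤ ρ' j) (hρ : ∀ j, ρ' j < ρ j) (S : Finset ι) :
    ∀ (F : (ι → ℂ) → ℂ) (B : ℝ), SH F (pd ρ) → (∀ v ∈ pd ρ, ‖F v‖ ≤ B) → ∀ η > 0,
      ∃ p : MvPolynomial ι ℂ, ∀ v : ι → ℂ, (∀ j, ‖v j‖ ≤ ρ' j) → (∀ j ∉ S, v j = 0) →
        ‖F v - MvPolynomial.eval v p‖ ≤ η := by
  induction S using Finset.induction_on with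
  | empty =>
    intro F B _ _ η hη
    refine ⟨MvPolynomial.C (F 0), fun v _ hv => ?_⟩
    have : v = 0 := by ext j; exact hv j (by simp)
    simp [this, hη.le]
  | insert j S hj ih =>
    intro F B hF hb η hη
    have hB : 0 ≤ B := (norm_nonneg _).trans (hb 0 fun k => by
      simpa using (h0 k).trans_lt (hρ k))
    set r := (ρ' j + ρ j) / 2 with hr
    have hr0 : 0 < r := by linarith [h0 j, hρ j]
    have hr1 : ρ' j < r := by linarith [hρ j]
    have hr2 : r < ρ j := by linarith [hρ j]
    set q := ρ' j / r with hq
    have hq0 : 0 ≤ q := div_nonneg (h0 j) hr0.le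
    have hq1 : q < 1 := (div_lt_one hr0).2 hr1
    obtain ⟨m, hm⟩ : ∃ m : ℕ, B * q ^ m / (1 - q) < η / 2 := by
      have h := ((tendsto_pow_atTop_nhds_zero_of_lt_one hq0 hq1).const_mul B).div_const (1 - q)
      simp only [mul_zero, zero_div] at h
      exact (h.eventually (gt_mem_nhds (half_pos hη))).exists
    set T : ℝ := ∑ n ∈ Finset.range m, ρ' j ^ n with hT
    have hT0 : 0 ≤ T := Finset.sum_nonneg fun n _ => pow_nonneg (h0 j) n
    set η' := η / (2 * (T + 1)) with hη'
    have hη'0 : 0 < η' := by positivity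
    have hex := fun n => ih (tc F j r n) (B * r⁻¹ ^ n) (tc_SH hF hb hr0 hr2 n)
      (fun v hv => tc_bound hb hr0 hr2 n hv) η' hη'0
    choose p hp using hex
    refine ⟨∑ n ∈ Finset.range m, MvPolynomial.X j ^ n *
      MvPolynomial.bind₁ (fun i => if i = j then 0 else MvPolynomial.X i) (p n), ?_⟩
    intro v hv hvS
    have hvpd : v ∈ pd ρ := fun k => (hv k).trans_lt (hρ k)
    have hv0 : (fun i => MvPolynomial.eval v
        (if i = j then (0 : MvPolynomial ι ℂ) else MvPolynomial.X i)) = update v j 0 := by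
      ext i
      rcases eq_or_ne i j with rfl | hi
      · simp
      · simp [hi]
    have hev : MvPolynomial.eval v (∑ n ∈ Finset.range m, MvPolynomial.X j ^ n *
        MvPolynomial.bind₁ (fun i => if i = j then 0 else MvPolynomial.X i) (p n)) =
        ∑ n ∈ Finset.range m, v j ^ n * MvPolynomial.eval (update v j 0) (p n) := by
      rw [map_sum]
      refine Finset.sum_congr rfl fun n _ => ?_
      rw [map_mul, map_pow, MvPolynomial.eval_X, eval_bind, hv0]
    rw [hev]
    have hvr : ‖v j‖ < r := (hv j).trans_lt hr1
    have hw : update v j 0 ∈ pd ρ := pd_update hvpd (by simpa using (h0 j).trans_lt (hρ j))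
    have hs := norm_sub_le_of_geometric_bound_of_hasSum (C := B) hq1 (fun n => ?_)
      (tc_sum hF hr0 hr2 hvpd hvr) m
    · have h2 : ‖∑ n ∈ Finset.range m, v j ^ n * tc F j r n (update v j 0) -
          ∑ n ∈ Finset.range m, v j ^ n * MvPolynomial.eval (update v j 0) (p n)‖ ≤ T * η' := by
        rw [← Finset.sum_sub_distrib, hT, Finset.sum_mul]
        refine norm_sum_le_of_le _ fun n _ => ?_
        rw [← mul_sub, norm_mul, norm_pow]
        have := hp n (update v j 0) (fun k => ?_) (fun k hk => ?_)
        · have h3 := hv j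
          have h5 := h0 j
          gcongr
        · rcases eq_or_ne k j with rfl | hk
          · simpa using h0 k
          · simpa [update_of_ne hk] using hv k
        · rcases eq_or_ne k j with rfl | hk'
          · simp
          · rw [update_of_ne hk']; exact hvS k (by simp [hk', hk])
      have h4 : T * η' ≤ η / 2 := by
        have : η' * (2 * (T + 1)) = η := by rw [hη']; field_simp
        nlinarith
      have := norm_sub_le_norm_sub_add_norm_sub (F v)
        (∑ n ∈ Finset.range m, v j ^ n * tc F j r n (update v j 0))
        (∑ n ∈ Finset.range m, v j ^ n * MvPolynomial.eval (update v j 0) (p n))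
      rw [norm_sub_rev] at hs
      linarith
    · rw [norm_mul, norm_pow]
      have := tc_bound hb hr0 hr2 n hw
      calc ‖v j‖ ^ n * ‖tc F j r n (update v j 0)‖ ≤ ρ' j ^ n * (B * r⁻¹ ^ n) := by
            have h3 := hv j
            have h4 := h0 j
            gcongr
        _ = B * q ^ n := by rw [hq, div_eq_mul_inv, mul_pow]; ring

theorem runge_pd (ρ ρ' : ι → ℝ) (h0 : ∀ j, 0 ≤ ρ' j) (hρ : ∀ j, ρ' j < ρ j)
    (F : (ι → ℂ) → ℂ) (B : ℝ) (hF : SH F (pd ρ)) (hb : ∀ v ∈ pd ρ, ‖F v‖ ≤ B) (η : ℝ) (hη : 0 < η) :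
    ∃ p : MvPolynomial ι ℂ, ∀ v : ι → ℂ, (∀ j, ‖v j‖ ≤ ρ' j) →
      ‖F v - MvPolynomial.eval v p‖ ≤ η := by
  obtain ⟨p, hp⟩ := runge_aux ρ ρ' h0 hρ Finset.univ F B hF hb η hη
  exact ⟨p, fun v hv => hp v hv (by simp)⟩
end Runge


section Oka
variable {ι : Type*} [Fintype ι] [DecidableEq ι]

theorem SH_of_diff {f : (ι → ℂ) → ℂ} {U : Set (ι → ℂ)} (hU : IsOpen U)
    (hf : DifferentiableOn ℂ f U) : SH f U := by
  intro v hv j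
  have h1 : DifferentiableAt ℂ f (update v j (v j)) := by
    rw [update_eq_self]; exact hf.differentiableAt (hU.mem_nhds hv)
  exact h1.comp (v j) (hasDerivAt_update v j (v j)).differentiableAt

theorem SH.inv {f : (ι → ℂ) → ℂ} {Ω : Set (ι → ℂ)} (h : SH f Ω) (h0 : ∀ v ∈ Ω, f v ≠ 0) :
    SH (fun v => (f v)⁻¹) Ω := by
  intro v hv j
  refine (h v hv j).inv ?_
  simpa using h0 v hv

/-- complex linear form -/
def ell (a : ι → ℂ) (v : ι → ℂ) : ℂ := ∑ j, a j * v j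

theorem ell_re (a v : ι → ℂ) : (ell a v).re = alf a v := by simp [ell, alf]

theorem ell_bound (a v : ι → ℂ) (r : ι → ℝ) (hv : ∀ j, ‖v j‖ ≤ r j) :
    ‖ell a v‖ ≤ ∑ j, ‖a j‖ * r j := by
  unfold ell
  refine norm_sum_le_of_le _ fun j _ => ?_
  rw [norm_mul]
  exact mul_le_mul_of_nonneg_left (hv j) (norm_nonneg _)

theorem oka (a : ι → ℂ) (r : ι → ℝ) (hr : ∀ i, 0 ≤ r i) (c ε B : ℝ) (hε : 0 < ε)
    (g : (ι → ℂ) → ℂ)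
    (hg : SH g (pd (fun i => r i + ε) ∩ {v | alf a v < c + ε}))
    (hb : ∀ v ∈ pd (fun i => r i + ε) ∩ {v | alf a v < c + ε}, ‖g v‖ ≤ B) (hB : 0 ≤ B)
    (η : ℝ) (hη : 0 < η) :
    ∃ p : MvPolynomial ι ℂ, ∀ v : ι → ℂ, (∀ i, ‖v i‖ ≤ r i) → alf a v ≤ c →
      ‖g v - MvPolynomial.eval v p‖ ≤ η := by
  set R := ∑ j, ‖a j‖ * r j with hR
  have hR0 : 0 ≤ R := Finset.sum_nonneg fun j _ => mul_nonneg (norm_nonneg _) (hr j)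
  set P : ℝ := 4 * R ^ 2 / ε + |c| with hP
  have hP1 : 4 * R ^ 2 ≤ P * ε := by
    have : 4 * R ^ 2 / ε * ε = 4 * R ^ 2 := by field_simp
    nlinarith [mul_nonneg (abs_nonneg c) hε.le]
  have hPc : 0 ≤ P + c := by
    have : 0 ≤ 4 * R ^ 2 / ε := by positivity
    linarith [neg_abs_le c]
  have hP0 : 0 ≤ P := by positivity
  -- the extended space
  let ρ : Option ι → ℝ := fun o => o.elim (P + c + ε / 4) (fun i => r i + ε)
  let ρ' : Option ι → ℝ := fun o => o.elim (P + c + ε / 8) r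
  let a' : Option ι → ℂ := fun o => o.elim 0 a
  let π : (Option ι → ℂ) → ι → ℂ := fun w i => w (some i)
  let d : (Option ι → ℂ) → ℂ := fun w => w none - P - ell a (π w)
  have half : ∀ w, alf a' w = alf a (π w) := by
    intro w; simp [alf, Fintype.sum_option, a', π]
  set A : Set (Option ι → ℂ) := {w | alf a' w < c + ε} with hA
  set A2 : Set (Option ι → ℂ) := {w | c + ε / 2 < alf a' w} with hA2
  have oA : IsOpen A := isOpen_lt (alf_cont a') continuous_const
  have oA2 : IsOpen A2 := isOpen_lt continuous_const (alf_cont a')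
  have hπ : ∀ w ∈ pd ρ ∩ A, π w ∈ pd (fun i => r i + ε) ∩ {v | alf a v < c + ε} := by
    rintro w ⟨hw, hwA⟩
    refine ⟨fun i => hw (some i), ?_⟩
    have : alf a' w < c + ε := hwA
    rw [half] at this; exact this
  have sg : SH (fun w => g (π w)) (pd ρ ∩ A) := by
    intro w hw o
    cases o with
    | none =>
      have : (fun z => g (π (update w none z))) = fun _ => g (π w) := by
        ext z; congr 1
      rw [this]; exact differentiableAt_const _
    | some i =>
      have : (fun z => g (π (update w (some i) z))) = fun z => g (update (π w) i z) := by
        ext z; congr 1; ext k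
        rcases eq_or_ne k i with rfl | hk
        · simp [π]
        · simp [π, hk]
      rw [this]; exact hg (π w) (hπ w hw) i
  have sd : ∀ Ω : Set (Option ι → ℂ), SH d Ω := by
    intro Ω
    refine (SH_of_diff (U := univ) isOpen_univ ?_).mono (subset_univ _)
    have : Differentiable ℂ d := by
      simp only [d, π, ell]
      fun_prop
    exact this.differentiableOn
  set Dm := (P + c + ε / 4) + P + ∑ j, ‖a j‖ * (r j + ε) with hDm
  have hDm0 : 0 ≤ Dm := by
    have : 0 ≤ ∑ j, ‖a j‖ * (r j + ε) :=
      Finset.sum_nonneg fun j _ => mul_nonneg (norm_nonneg _) (by linarith [hr j])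
    linarith
  have hdb : ∀ w ∈ pd ρ, ‖d w‖ ≤ Dm := by
    intro w hw
    have h1 : ‖w none‖ ≤ P + c + ε / 4 := (hw none).le
    have h2 := ell_bound a (π w) (fun i => r i + ε) (fun i => (hw (some i)).le)
    have h3 : ‖(P : ℂ)‖ = P := by rw [Complex.norm_real, Real.norm_of_nonneg hP0]
    calc ‖d w‖ ≤ ‖w none‖ + ‖(P : ℂ)‖ + ‖ell a (π w)‖ :=
          (norm_sub_le _ _).trans (by gcongr; exact norm_sub_le _ _)
      _ ≤ Dm := by rw [h3]; linarith
  have hdl : ∀ w ∈ pd ρ ∩ A ∩ A2, ε / 4 ≤ ‖d w‖ := by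
    rintro w ⟨⟨hw, -⟩, hw2⟩
    have h1 : ‖w none‖ < P + c + ε / 4 := hw none
    have h2 : c + ε / 2 < alf a' w := hw2
    rw [half] at h2
    have h3 : (d w).re = (w none).re - P - alf a (π w) := by simp [d, ell_re]
    have h4 := Complex.abs_re_le_norm (d w)
    have h5 := neg_abs_le (d w).re
    have h6 := Complex.re_le_norm (w none)
    linarith
  have hdne : ∀ w ∈ pd ρ ∩ A ∩ A2, d w ≠ 0 := by
    intro w hw h0
    have := hdl w hw
    rw [h0, norm_zero] at this; linarith
  obtain ⟨C, hC1, hC⟩ := split_thm a' (∑ o, |ρ o|) (ε / 2) (by linarith)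
  obtain ⟨G1, G2, s1, s2, eG, b1, b2⟩ := hC ρ (c + ε / 2) (c + ε)
    (fun o => (le_abs_self _).trans
      (Finset.single_le_sum (f := fun o => |ρ o|) (fun _ _ => abs_nonneg _) (Finset.mem_univ o)))
    (by linarith) (fun w => g (π w) * (d w)⁻¹) (B * (ε / 4)⁻¹) (by positivity)
    ((sg.mono inter_subset_left).mul ((sd _).inv hdne))
    (by
      intro w hw
      rw [norm_mul, norm_inv]
      have h1 := hb _ (hπ w hw.1)
      have h2 := hdl w hw
      gcongr)
  obtain ⟨F, F1, F2, sF⟩ := SH.glue (f1 := fun w => g (π w) - d w * G1 w)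
    (f2 := fun w => d w * G2 w) (Ω1 := pd ρ ∩ A) (Ω2 := pd ρ ∩ A2)
    (sg.sub ((sd _).mul s1)) ((sd _).mul s2) ((pd_open ρ).inter oA) ((pd_open ρ).inter oA2) (by
      intro w hw hw2
      have h := eG w ⟨hw, hw2.2⟩
      have h0 := hdne w ⟨hw, hw2.2⟩
      have h3 : g (π w) = d w * (G1 w + G2 w) := by
        rw [← h]; field_simp
      simp only [h3]; ring)
  have hcov : ∀ w ∈ pd ρ, w ∈ pd ρ ∩ A ∨ w ∈ pd ρ ∩ A2 := by
    intro w hw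
    rcases lt_or_ge (alf a' w) (c + ε) with h | h
    · exact Or.inl ⟨hw, h⟩
    · exact Or.inr ⟨hw, by show c + ε / 2 < alf a' w; linarith⟩
  set M := C * (B * (ε / 4)⁻¹) with hM
  have hM0 : 0 ≤ M := by positivity
  obtain ⟨p, hp⟩ := runge_pd ρ ρ' (by
      rintro (_ | i)
      · show 0 ≤ P + c + ε / 8; linarith
      · exact hr i) (by
      rintro (_ | i)
      · show P + c + ε / 8 < P + c + ε / 4; linarith
      · show r i < r i + ε; linarith) F (B + Dm * M) (sF.mono fun w hw => hcov w hw) (by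
      intro w hw
      have hd := hdb w hw
      rcases hcov w hw with h | h
      · rw [F1 w h]
        refine (norm_sub_le _ _).trans ?_
        rw [norm_mul]
        have h1 := hb _ (hπ w h)
        have h2 := b1 w h
        gcongr
      · rw [F2 w h, norm_mul]
        have h2 := b2 w h
        have : ‖d w‖ * ‖G2 w‖ ≤ Dm * M := by gcongr
        linarith) η hη
  refine ⟨MvPolynomial.bind₁ (fun o => o.elim
    (MvPolynomial.C (P : ℂ) + ∑ j, MvPolynomial.C (a j) * MvPolynomial.X j) MvPolynomial.X) p, ?_⟩
  intro v hv hvc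
  rw [eval_bind]
  set w0 : Option ι → ℂ := fun o => o.elim (P + ell a v) v with hw0
  have e0 : (fun i => MvPolynomial.eval v (Option.elim i
      (MvPolynomial.C (P : ℂ) + ∑ j, MvPolynomial.C (a j) * MvPolynomial.X j)
      MvPolynomial.X)) = w0 := by
    ext o
    cases o <;> simp [hw0, ell]
  rw [e0]
  have hnb : ‖(P : ℂ) + ell a v‖ ≤ P + c + ε / 8 := by
    have h1 := ell_bound a v r hv
    have h2 := ell_re a v
    refine abs_le_of_sq_le_sq' ?_ (by linarith) |>.2
    have h3 : ‖(P : ℂ) + ell a v‖ ^ 2 = P ^ 2 + 2 * P * alf a v + ‖ell a v‖ ^ 2 := by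
      rw [← Complex.normSq_eq_norm_sq, ← Complex.normSq_eq_norm_sq, Complex.normSq_apply,
        Complex.normSq_apply, ← h2]
      simp; ring
    have h4 : ‖ell a v‖ ^ 2 ≤ R ^ 2 := pow_le_pow_left₀ (norm_nonneg _) h1 2
    rw [h3]
    nlinarith [mul_le_mul_of_nonneg_left hvc hP0, sq_nonneg (c + ε / 8)]
  have hb0 : ∀ o, ‖w0 o‖ ≤ ρ' o := by
    rintro (_ | i)
    · exact hnb
    · exact hv i
  have hm0 : w0 ∈ pd ρ ∩ A := by
    refine ⟨fun o => (hb0 o).trans_lt ?_, ?_⟩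
    · cases o with
      | none => show P + c + ε / 8 < P + c + ε / 4; linarith
      | some i => show r i < r i + ε; linarith
    · show alf a' w0 < c + ε
      rw [half]
      show alf a v < c + ε
      linarith
  have := hp w0 hb0
  rw [F1 w0 hm0] at this
  have hd0 : d w0 = 0 := by
    show (P : ℂ) + ell a v - P - ell a v = 0
    ring
  rw [hd0, zero_mul, sub_zero] at this
  exact this
end Oka

end Aux

section Top
open MeasureTheory Filter Topology Metric Set Function
theorem to_BX {ι : Type*} [Fintype ι] {X : Set (ι → ℂ)} (hX : IsCompact X) (g : (ι → ℂ) → ℂ)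
    (h : ∀ η > 0, ∃ p : MvPolynomial ι ℂ, ∀ v ∈ X, ‖g v - MvPolynomial.eval v p‖ ≤ η) :
    ∃ G ∈ BXset X, ∀ v : X, G v = g v := by
  have : CompactSpace X := isCompact_iff_compactSpace.1 hX
  have hcont : Continuous (fun v : X => g v) := by
    refine continuous_of_uniform_approx_of_continuous fun u hu => ?_
    obtain ⟨ε, hε, hεu⟩ := Metric.mem_uniformity_dist.1 hu
    obtain ⟨p, hp⟩ := h (ε / 2) (half_pos hε)
    refine ⟨fun v : X => MvPolynomial.eval (v : ι → ℂ) p,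
      (MvPolynomial.continuous_eval p).comp continuous_subtype_val, fun v => hεu ?_⟩
    rw [dist_eq_norm]
    linarith [hp v v.2]
  refine ⟨⟨fun v => g v, hcont⟩, ?_, fun v => rfl⟩
  unfold BXset
  rw [Metric.mem_closure_range_iff]
  intro ε hε
  obtain ⟨p, hp⟩ := h (ε / 2) (half_pos hε)
  refine ⟨p, ?_⟩
  refine lt_of_le_of_lt ((ContinuousMap.dist_le (half_pos hε).le).2 fun v => ?_) (half_lt_self hε)
  rw [dist_eq_norm]
  exact hp v v.2

theorem zero_BX {ι : Type*} [Fintype ι] {X : Set (ι → ℂ)} : (0 : C(X, ℂ)) ∈ BXset X := by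
  refine subset_closure ⟨0, ?_⟩
  ext v; simp

theorem lin_alf {N : ℕ} (α : (Fin N → ℂ) →ₗ[ℝ] ℝ) : ∃ a : Fin N → ℂ, ∀ v, α v = alf a v := by
  refine ⟨fun i => (α (Pi.single i 1) : ℂ) - Complex.I * (α (Pi.single i Complex.I) : ℂ), ?_⟩
  intro v
  conv_lhs => rw [← Finset.univ_sum_single v]
  rw [map_sum]
  unfold alf
  refine Finset.sum_congr rfl fun i _ => ?_
  have : Pi.single i (v i) = (v i).re • (Pi.single i 1 : Fin N → ℂ) +
      (v i).im • (Pi.single i Complex.I : Fin N → ℂ) := by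
    ext k
    rcases eq_or_ne k i with rfl | hk
    · simp
    · simp [hk]
  rw [this, map_add, map_smul, map_smul]
  simp
  ring

theorem cpd_compact {N : ℕ} (r : Fin N → ℝ) : IsCompact {v : Fin N → ℂ | ∀ i, ‖v i‖ ≤ r i} := by
  have : {v : Fin N → ℂ | ∀ i, ‖v i‖ ≤ r i} = Set.pi univ fun i => closedBall 0 (r i) := by
    ext v; simp
  rw [this]
  exact isCompact_univ_pi fun i => isCompact_closedBall _ _

theorem shrink {N : ℕ} (r : Fin N → ℝ) (a : Fin N → ℂ) (c₁ c₂ : ℝ) (O : Set (Fin N → ℂ))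
    (hO : IsOpen O) (hK : ∀ v, (∀ i, ‖v i‖ ≤ r i) → alf a v ≤ c₂ → c₁ ≤ alf a v → v ∈ O) :
    ∃ ε : ℝ, 0 < ε ∧ ε ≤ 1 ∧ ∀ v, (∀ i, ‖v i‖ ≤ r i + ε) → alf a v ≤ c₂ + ε →
      c₁ - ε ≤ alf a v → v ∈ O := by
  set V : ℕ → Set (Fin N → ℂ) := fun n => {v | ∀ i, ‖v i‖ ≤ r i + 1 / ((n : ℝ) + 1)} ∩
    ({v | alf a v ≤ c₂ + 1 / ((n : ℝ) + 1)} ∩ {v | c₁ - 1 / ((n : ℝ) + 1) ≤ alf a v}) with hV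
  have hc : ∀ n, IsCompact (V n) := fun n => (cpd_compact _).inter_right
    ((isClosed_le (alf_cont a) continuous_const).inter (isClosed_le continuous_const (alf_cont a)))
  have hanti : Antitone V := by
    intro n m hnm v hv
    have h : 1 / ((m : ℝ) + 1) ≤ 1 / ((n : ℝ) + 1) := by gcongr
    refine ⟨fun i => (hv.1 i).trans (by linarith), ?_, ?_⟩
    · have : alf a v ≤ c₂ + 1 / ((m : ℝ) + 1) := hv.2.1
      show alf a v ≤ c₂ + 1 / ((n : ℝ) + 1)
      linarith
    · have : c₁ - 1 / ((m : ℝ) + 1) ≤ alf a v := hv.2.2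
      show c₁ - 1 / ((n : ℝ) + 1) ≤ alf a v
      linarith
  have hlim : ∀ x y : ℝ, (∀ n : ℕ, x ≤ y + 1 / ((n : ℝ) + 1)) → x ≤ y := by
    intro x y h
    refine le_of_forall_pos_le_add fun e he => ?_
    obtain ⟨n, hn⟩ := exists_nat_one_div_lt he
    linarith [h n]
  obtain ⟨n, hn⟩ := exists_subset_nhds_of_isCompact hanti.directed_ge hc (U := O) (by
    intro v hv
    rw [mem_iInter] at hv
    refine hO.mem_nhds (hK v (fun i => hlim _ _ fun n => (hv n).1 i)
      (hlim _ _ fun n => (hv n).2.1) (hlim _ _ fun n => ?_))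
    have : c₁ - 1 / ((n : ℝ) + 1) ≤ alf a v := (hv n).2.2
    linarith)
  refine ⟨1 / ((n : ℝ) + 1), by positivity, ?_, fun v h1 h2 h3 => hn ⟨h1, h2, h3⟩⟩
  rw [div_le_one (by positivity)]
  have : (0 : ℝ) ≤ n := Nat.cast_nonneg n
  linarith
end Top

/-- **Bounded additive decomposition of holomorphic functions over a sliced polydisk.**
Let `W ⊆ ℂᴺ` be a closed polydisk, `α` an `ℝ`-linear functional, `c₁ < c₂`, and
`W′ = {v ∈ W : α v ≤ c₂}`, `W″ = {v ∈ W : α v ≥ c₁}`. Then there is a constant `C > 0`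
such that every function `f` holomorphic on a neighborhood of `W′ ∩ W″` can be written
on `W′ ∩ W″` as a sum of restrictions of `f′ ∈ B(W′)` and `f″ ∈ B(W″)` with
`‖f′‖_{W′} ≤ C ⬝ ‖f‖_{W′ ∩ W″}` and `‖f″‖_{W″} ≤ C ⬝ ‖f‖_{W′ ∩ W″}`. -/
theorem BX_bounded_decomposition_of_holomorphic
    (N : ℕ) (hN : 1 ≤ N) (r : Fin N → ℝ) (hr : ∀ i, 0 < r i)
    (α : (Fin N → ℂ) →ₗ[ℝ] ℝ) (c₁ c₂ : ℝ) (hc : c₁ < c₂)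
    (W W' W'' : Set (Fin N → ℂ))
    (hW : W = {v | ∀ i, ‖v i‖ ≤ r i})
    (hW' : W' = {v ∈ W | α v ≤ c₂})
    (hW'' : W'' = {v ∈ W | c₁ ≤ α v}) :
    ∃ C : ℝ, 0 < C ∧
      ∀ (f : (Fin N → ℂ) → ℂ) (U : Set (Fin N → ℂ)),
        IsOpen U → W' ∩ W'' ⊆ U → DifferentiableOn ℂ f U →
        ∃ f' ∈ BXset W', ∃ f'' ∈ BXset W'',
          (∀ (v : Fin N → ℂ) (hv : v ∈ W' ∩ W''),
            f v = f' ⟨v, hv.1⟩ + f'' ⟨v, hv.2⟩) ∧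
          (∀ v : W', ‖f' v‖ ≤ C * ⨆ w : ↥(W' ∩ W''), ‖f w‖) ∧
          (∀ v : W'', ‖f'' v‖ ≤ C * ⨆ w : ↥(W' ∩ W''), ‖f w‖) := by
  obtain ⟨a, ha⟩ := lin_alf α
  obtain ⟨C, hC1, hC⟩ := split_thm a (∑ i, r i + 1) (c₂ - c₁) (by linarith)
  have hWc : IsCompact W := by rw [hW]; exact cpd_compact r
  have hW'c : IsCompact W' := by
    have : W' = W ∩ {v | alf a v ≤ c₂} := by
      rw [hW']; ext v; simp [ha]
    rw [this]
    exact hWc.inter_right (isClosed_le (alf_cont a) continuous_const)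
  have hW''c : IsCompact W'' := by
    have : W'' = W ∩ {v | c₁ ≤ alf a v} := by
      rw [hW'']; ext v; simp [ha]
    rw [this]
    exact hWc.inter_right (isClosed_le continuous_const (alf_cont a))
  have m' : ∀ v, v ∈ W' ↔ (∀ i, ‖v i‖ ≤ r i) ∧ alf a v ≤ c₂ := by
    intro v; rw [hW', hW]; simp [ha]
  have m'' : ∀ v, v ∈ W'' ↔ (∀ i, ‖v i‖ ≤ r i) ∧ c₁ ≤ alf a v := by
    intro v; rw [hW'', hW]; simp [ha]
  refine ⟨2 * C, by linarith, ?_⟩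
  intro f U hU hKU hf
  have hKc : IsCompact (W' ∩ W'') := hW'c.inter hW''c
  set S : ℝ := ⨆ w : ↥(W' ∩ W''), ‖f w‖ with hS
  have hbd : BddAbove (Set.range fun w : ↥(W' ∩ W'') => ‖f w‖) := by
    have := hKc.bddAbove_image (f := fun v => ‖f v‖) ((hf.continuousOn.mono hKU).norm)
    rw [Set.image_eq_range] at this
    exact this
  have hle : ∀ v ∈ W' ∩ W'', ‖f v‖ ≤ S := fun v hv =>
    le_ciSup hbd (⟨v, hv⟩ : ↥(W' ∩ W''))
  have hS0 : 0 ≤ S := Real.iSup_nonneg fun _ => norm_nonneg _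
  rcases hS0.eq_or_lt with h0 | hSpos
  · refine ⟨0, zero_BX, 0, zero_BX, ?_, ?_, ?_⟩
    · intro v hv
      have := hle v hv
      rw [← h0] at this
      simpa using this
    · intro v; rw [← h0]; simp
    · intro v; rw [← h0]; simp
  have hO : IsOpen (U ∩ f ⁻¹' Metric.ball 0 (2 * S)) :=
    hf.continuousOn.isOpen_inter_preimage hU Metric.isOpen_ball
  obtain ⟨ε, hε, hε1, hεO⟩ := shrink r a c₁ c₂ _ hO (by
    intro v h1 h2 h3
    have hv : v ∈ W' ∩ W'' := ⟨(m' v).2 ⟨h1, h2⟩, (m'' v).2 ⟨h1, h3⟩⟩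
    refine ⟨hKU hv, ?_⟩
    have := hle v hv
    simp only [Set.mem_preimage, mem_ball_zero_iff]
    linarith)
  have hsub : ∀ v ∈ pd (fun i => r i + ε) ∩ {v | alf a v < c₂ + ε} ∩ {v | c₁ - ε < alf a v},
      v ∈ U ∩ f ⁻¹' Metric.ball 0 (2 * S) := by
    rintro v ⟨⟨h1, h2⟩, h3⟩
    exact hεO v (fun i => (h1 i).le) (le_of_lt h2) (le_of_lt h3)
  obtain ⟨f', f'', s1, s2, e, b1, b2⟩ := hC (fun i => r i + ε) (c₁ - ε) (c₂ + ε)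
    (by
      intro j
      have := Finset.single_le_sum (f := r) (fun i _ => (hr i).le) (Finset.mem_univ j)
      show r j + ε ≤ _
      linarith) (by linarith) f (2 * S) (by linarith)
    ((SH_of_diff hU hf).mono fun v hv => (hsub v hv).1)
    (fun v hv => (mem_ball_zero_iff.1 (hsub v hv).2).le)
  have hCS : 0 ≤ C * (2 * S) := by positivity
  obtain ⟨F', hF', eF'⟩ := to_BX hW'c f' (by
    intro η hη
    obtain ⟨p, hp⟩ := oka a r (fun i => (hr i).le) c₂ ε _ hε f' s1 b1 hCS η hη
    exact ⟨p, fun v hv => hp v ((m' v).1 hv).1 ((m' v).1 hv).2⟩)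
  have hneg : ∀ v, alf (fun i => - a i) v = - alf a v := by
    intro v; simp [alf]
  have hset : pd (fun i => r i + ε) ∩ {v | alf (fun i => - a i) v < -c₁ + ε} =
      pd (fun i => r i + ε) ∩ {v | c₁ - ε < alf a v} := by
    ext v
    constructor
    · rintro ⟨h1, h2⟩
      refine ⟨h1, ?_⟩
      have h3 : alf (fun i => - a i) v < -c₁ + ε := h2
      rw [hneg] at h3
      show c₁ - ε < alf a v
      linarith
    · rintro ⟨h1, h2⟩
      refine ⟨h1, ?_⟩
      have h3 : c₁ - ε < alf a v := h2
      show alf (fun i => - a i) v < -c₁ + ε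
      rw [hneg]
      linarith
  obtain ⟨F'', hF'', eF''⟩ := to_BX hW''c f'' (by
    intro η hη
    obtain ⟨p, hp⟩ := oka (fun i => - a i) r (fun i => (hr i).le) (-c₁) ε _ hε f''
      (by rw [hset]; exact s2) (by rw [hset]; exact b2) hCS η hη
    exact ⟨p, fun v hv => hp v ((m'' v).1 hv).1 (by rw [hneg]; linarith [((m'' v).1 hv).2])⟩)
  have in' : ∀ v ∈ W', v ∈ pd (fun i => r i + ε) ∩ {v | alf a v < c₂ + ε} := by
    intro v hv
    obtain ⟨h1, h2⟩ := (m' v).1 hv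
    refine ⟨fun i => ?_, ?_⟩
    · show ‖v i‖ < r i + ε
      linarith [h1 i]
    · show alf a v < c₂ + ε
      linarith
  have in'' : ∀ v ∈ W'', v ∈ pd (fun i => r i + ε) ∩ {v | c₁ - ε < alf a v} := by
    intro v hv
    obtain ⟨h1, h2⟩ := (m'' v).1 hv
    refine ⟨fun i => ?_, ?_⟩
    · show ‖v i‖ < r i + ε
      linarith [h1 i]
    · show c₁ - ε < alf a v
      linarith
  refine ⟨F', hF', F'', hF'', ?_, ?_, ?_⟩
  · intro v hv
    rw [eF', eF'']
    exact e v ⟨in' v hv.1, (in'' v hv.2).2⟩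
  · intro v
    rw [eF']
    exact (b1 v (in' v v.2)).trans (le_of_eq (by ring))
  · intro v
    rw [eF'']
    exact (b2 v (in'' v v.2)).trans (le_of_eq (by ring))
end
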